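/- Let q be an odd prime and let e^γ denote the exponential of the Euler–Mascheroni constant. For every ε ∈ (0, 1/2) there exist positive constants A₁, A₂ and q₀ (depending only on ε) such that for every prime q ≥ q₀ and every real x with e ≤ x ≤ (1/2 − ε) log log q, one has exp(−A₁ e^x / x) ≥ (1/q) · #{k ∈ {0, 1, …, q−1} : C(k) ≥ (e^γ/2) x} ≥ exp(−A₂ e^x log x). -/

import Mathlib

open scoped Classical Real
open Complex MeasureTheory

/-- The sawtooth function `ψ`. -/
noncomputable def saw (x : ℝ) : ℝ := if Int.fract x = 0 then 0 else Int.fract x - 1/2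

/-- The Euler product `A_{q,χ}`. -/
noncomputable def Aq (q : ℕ) (χ : DirichletCharacter ℂ q) : ℂ :=
  ∏' p : Nat.Primes, if (p : ℕ) ∣ q then 1 else
    1 - (1 - χ ((p : ℕ) : ZMod q)) ^ 2 / (((p : ℕ) : ℂ) - 1) ^ 2

/-- The quantity `C(k) = C(k; q)` (a real number; we take the real part of the
defining expression, which is real). -/
noncomputable def Cfun (q : ℕ) (k : ℤ) : ℝ :=
  if h : q = 0 then 0 else
    haveI : NeZero q := ⟨h⟩
    ((↑q.totient : ℂ)⁻¹ *
      ∑ χ ∈ Finset.univ.filter (fun χ : DirichletCharacter ℂ q => χ ≠ 1),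
        (starRingEnd ℂ) (χ ((k : ZMod q))) * DirichletCharacter.LFunction χ 0 *
          DirichletCharacter.LFunction χ 1 * Aq q χ).re

/-! ### The theorems of Mertens -/

lemma log_factorial_eq_sum (N : ℕ) :
    Real.log (N.factorial) = ∑ p ∈ Nat.primesLE N, ((N.factorial).factorization p : ℝ) * Real.log p := by
  rw [Real.log_nat_eq_sum_factorization, Finsupp.sum]
  apply Finset.sum_subset
  · intro p hp
    have hp' := Nat.prime_of_mem_primeFactors hp
    have := (hp'.dvd_factorial).1 (Nat.dvd_of_mem_primeFactors hp)
    simp [Nat.primesLE_eq_filter_range, hp']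
    omega
  · intro p _ hp
    simp at hp ⊢
    left
    exact Nat.factorization_eq_zero_iff _ _ |>.2 (by tauto)

lemma factorization_factorial_le {p N : ℕ} (hp : p.Prime) :
    ((N.factorial).factorization p : ℝ) ≤ N / ((p : ℝ) - 1) := by
  have := Fact.mk hp
  have h := sub_one_mul_padicValNat_factorial (p := p) N
  rw [← Nat.factorization_def _ hp] at h
  have h1 : (p - 1) * (N.factorial).factorization p ≤ N := by rw [h]; exact Nat.sub_le _ _
  have hp1 : (1 : ℝ) < p := by exact_mod_cast hp.one_lt
  rw [le_div_iff₀ (by linarith)]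
  have h2 : (((p - 1 : ℕ) : ℝ)) * (N.factorial).factorization p ≤ N := by exact_mod_cast h1
  rw [Nat.cast_sub hp.one_le] at h2
  push_cast at h2
  linarith

lemma le_factorization_factorial {p N : ℕ} (hp : p.Prime) :
    (N : ℝ) / p - 1 ≤ ((N.factorial).factorization p : ℝ) := by
  have h : N / p ≤ (N.factorial).factorization p := by
    rw [← hp.pow_dvd_iff_le_factorization (Nat.factorial_ne_zero N)]
    refine dvd_trans ?_ (Nat.factorial_dvd_factorial (Nat.mul_div_le N p))
    rw [hp.pow_dvd_iff_le_factorization (Nat.factorial_ne_zero _), Nat.factorization_factorial_mul hp]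
    exact Nat.le_add_left _ _
  have h2 : (N : ℝ) / p < (N / p : ℕ) + 1 := by
    have := Nat.lt_div_mul_add (a := N) hp.pos
    rw [div_lt_iff₀ (by exact_mod_cast hp.pos)]
    have : N < (N / p + 1) * p := by rw [add_mul, one_mul]; exact this
    exact_mod_cast this
  have : ((N / p : ℕ) : ℝ) ≤ ((N.factorial).factorization p : ℝ) := by exact_mod_cast h
  linarith

lemma summable_rpow_neg_three_halves : Summable fun n : ℕ => 4 * (n : ℝ) ^ (-(3 / 2) : ℝ) :=
  (Real.summable_nat_rpow.2 (by norm_num)).mul_left 4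

lemma log_div_mul_pred_le {p : ℕ} (hp : 2 ≤ p) :
    Real.log p / (p * ((p : ℝ) - 1)) ≤ 4 * (p : ℝ) ^ (-(3 / 2) : ℝ) := by
  have hp2 : (2 : ℝ) ≤ p := by exact_mod_cast hp
  have h1 : Real.log p ≤ 2 * (p : ℝ) ^ (1 / 2 : ℝ) := by
    have := Real.log_le_rpow_div (x := p) (by positivity) (ε := 1 / 2) (by norm_num)
    linarith
  rw [div_le_iff₀ (by nlinarith)]
  have e : (p : ℝ) ^ (1 / 2 : ℝ) = (p : ℝ) ^ (-(3 / 2) : ℝ) * (p : ℝ) ^ 2 := by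
    rw [← Real.rpow_natCast, ← Real.rpow_add (by linarith)]; norm_num
  have h3 : 0 ≤ (p : ℝ) ^ (-(3 / 2) : ℝ) := by positivity
  calc Real.log p ≤ 2 * ((p : ℝ) ^ (-(3 / 2) : ℝ) * (p : ℝ) ^ 2) := by rw [← e]; exact h1
    _ ≤ _ := by nlinarith [mul_nonneg h3 (by nlinarith : (0:ℝ) ≤ p * (p - 2))]

lemma mertens_first : ∃ K : ℝ, 0 ≤ K ∧ ∀ N : ℕ, 1 ≤ N →
    |∑ p ∈ Nat.primesLE N, Real.log p / p - Real.log N| ≤ K := by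
  set K0 : ℝ := ∑' n : ℕ, 4 * (n : ℝ) ^ (-(3 / 2) : ℝ) with hK0
  have hK0' : 0 ≤ K0 := tsum_nonneg fun n => by positivity
  refine ⟨1 + K0 + Real.log 4, by have := Real.log_nonneg (by norm_num : (1:ℝ) ≤ 4); linarith, ?_⟩
  intro N hN
  have hNpos : (0 : ℝ) < N := by exact_mod_cast hN
  have hprime : ∀ p ∈ Nat.primesLE N, p.Prime := fun p hp => by
    rw [Nat.primesLE_eq_filter_range] at hp; exact (Finset.mem_filter.1 hp).2
  have hlog4 : 0 ≤ Real.log 4 := Real.log_nonneg (by norm_num)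
  have hL := log_factorial_eq_sum N
  set A := ∑ p ∈ Nat.primesLE N, Real.log p / p with hA
  have hup : Real.log (N.factorial) ≤ N * Real.log N := by
    rw [← Real.log_pow]
    apply Real.log_le_log (by exact_mod_cast Nat.factorial_pos N)
    exact_mod_cast Nat.factorial_le_pow N
  have hlow : N * Real.log N - N ≤ Real.log (N.factorial) := by
    have h := Real.pow_div_factorial_le_exp (x := N) (by positivity) N
    have h2 := Real.log_le_log (by positivity) h
    rw [Real.log_exp, Real.log_div (by positivity) (by positivity), Real.log_pow] at h2
    linarith
  have h1 : N * A - Real.log 4 * N ≤ Real.log (N.factorial) := by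
    have ht := Chebyshev.theta_le_log4_mul_x (x := N) (by positivity)
    rw [Chebyshev.theta_eq_sum_primesLE_log] at ht
    have : N * A - ∑ p ∈ Nat.primesLE N, Real.log p ≤ Real.log (N.factorial) := by
      rw [hL, hA, Finset.mul_sum, ← Finset.sum_sub_distrib]
      apply Finset.sum_le_sum
      intro p hp
      have := le_factorization_factorial (N := N) (hprime p hp)
      have hl : 0 ≤ Real.log p := Real.log_natCast_nonneg p
      calc N * (Real.log p / p) - Real.log p = (N / p - 1) * Real.log p := by ring
        _ ≤ _ := mul_le_mul_of_nonneg_right this hl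
    linarith
  have h2 : Real.log (N.factorial) ≤ N * A + N * K0 := by
    have hs : ∑ p ∈ Nat.primesLE N, Real.log p / (p * ((p : ℝ) - 1)) ≤ K0 := by
      refine le_trans (Finset.sum_le_sum fun p hp =>
        log_div_mul_pred_le (hprime p hp).two_le) ?_
      exact summable_rpow_neg_three_halves.sum_le_tsum _ (fun i _ => by positivity)
    have : Real.log (N.factorial) ≤
        N * A + N * ∑ p ∈ Nat.primesLE N, Real.log p / (p * ((p : ℝ) - 1)) := by
      rw [hL, hA, Finset.mul_sum, Finset.mul_sum, ← Finset.sum_add_distrib]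
      apply Finset.sum_le_sum
      intro p hp
      have hp1 : (1 : ℝ) < p := by exact_mod_cast (hprime p hp).one_lt
      have := factorization_factorial_le (N := N) (hprime p hp)
      have hl : 0 ≤ Real.log p := Real.log_natCast_nonneg p
      refine le_trans (mul_le_mul_of_nonneg_right this hl) (le_of_eq ?_)
      have : (p : ℝ) - 1 ≠ 0 := by linarith
      field_simp
      ring
    nlinarith
  rw [abs_le]
  constructor
  · have : N * (Real.log N - 1 - K0) ≤ N * A := by linarith
    have := le_of_mul_le_mul_left this hNpos
    linarith
  · have : N * A ≤ N * (Real.log N + Real.log 4) := by linarith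
    have := le_of_mul_le_mul_left this hNpos
    linarith

lemma exists_limit_of_increment_le {v f : ℕ → ℝ} {K : ℝ} (hK : 0 ≤ K)
    (hf : Filter.Tendsto f Filter.atTop (nhds 0)) (hf0 : ∀ n, 2 ≤ n → 0 ≤ f n)
    (h : ∀ n, 2 ≤ n → |v (n + 1) - v n| ≤ K * (f n - f (n + 1))) :
    ∃ b, ∀ n, 2 ≤ n → |v n - b| ≤ K * f n := by
  have h1 : ∀ M, 2 ≤ M → ∀ N, M ≤ N → |v N - v M| ≤ K * (f M - f N) := by
    intro M hM N hN
    induction N, hN using Nat.le_induction with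
    | base => simp
    | succ N hN ih =>
      have := h N (by omega)
      calc |v (N + 1) - v M| = |(v (N + 1) - v N) + (v N - v M)| := by ring_nf
        _ ≤ _ := abs_add_le _ _
        _ ≤ _ := by linarith
  have h2 : ∀ M, 2 ≤ M → ∀ N, M ≤ N → |v N - v M| ≤ K * f M := by
    intro M hM N hN
    have := h1 M hM N hN
    have := mul_nonneg hK (hf0 N (by omega))
    nlinarith
  have hc : CauchySeq (fun n => v (n + 2)) := by
    refine cauchySeq_of_le_tendsto_0' (fun n => K * f (n + 2)) ?_ ?_
    · intro n m hnm
      rw [dist_comm, Real.dist_eq]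
      exact h2 _ (by omega) _ (by omega)
    · have := (hf.comp (Filter.tendsto_add_atTop_nat 2)).const_mul K
      simpa using this
  obtain ⟨b, hb⟩ := cauchySeq_tendsto_of_complete hc
  rw [Filter.tendsto_add_atTop_iff_nat] at hb
  refine ⟨b, fun n hn => ?_⟩
  have h3 : Filter.Tendsto (fun N => |v n - v N|) Filter.atTop (nhds |v n - b|) :=
    (tendsto_const_nhds.sub hb).abs
  refine le_of_tendsto h3 ?_
  filter_upwards [Filter.eventually_ge_atTop n] with N hN
  rw [abs_sub_comm]
  exact h2 n hn N hN

lemma mertens_second : ∃ b K : ℝ, 0 ≤ K ∧ ∀ N : ℕ, 2 ≤ N →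
    |∑ p ∈ Nat.primesLE N, (1 : ℝ) / p - Real.log (Real.log N) - b| ≤ K / Real.log N := by
  obtain ⟨K, hK, hA⟩ := mertens_first
  set A : ℕ → ℝ := fun N => ∑ p ∈ Nat.primesLE N, Real.log p / p with hAdef
  set E : ℕ → ℝ := fun N => ∑ p ∈ Nat.primesLE N, (1 : ℝ) / p with hEdef
  have hstep : ∀ n : ℕ, 2 ≤ n → E (n + 1) - E n = (A (n + 1) - A n) / Real.log ((n + 1 : ℕ) : ℝ) := by
    intro n hn
    have hl : 0 < Real.log ((n + 1 : ℕ) : ℝ) := Real.log_pos (by exact_mod_cast (by omega : 1 < n + 1))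
    simp only [hEdef, hAdef, Nat.primesLE_eq_filter_range]
    rw [Finset.range_add_one (n := n + 1), Finset.filter_insert]
    split_ifs with hp
    · rw [Finset.sum_insert (by simp), Finset.sum_insert (by simp)]
      field_simp
      ring
    · simp
  have hlog : ∀ n : ℕ, 2 ≤ n → 0 < Real.log n := fun n hn =>
    Real.log_pos (by exact_mod_cast (by omega : 1 < n))
  set v : ℕ → ℝ := fun n => E n - Real.log (Real.log n) - (A n - Real.log n) / Real.log n with hv
  have key : ∀ n : ℕ, 2 ≤ n → |v (n + 1) - v n| ≤
      (K + 1) * (1 / Real.log n - 1 / Real.log ((n + 1 : ℕ) : ℝ)) := by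
    intro n hn
    have ha := hlog n hn
    have hb := hlog (n + 1) (by omega)
    have hR := hA n (by omega)
    have hs := hstep n hn
    set a := Real.log n
    set c := Real.log ((n + 1 : ℕ) : ℝ)
    have hac : a ≤ c := Real.log_le_log (by positivity) (by push_cast; linarith)
    have hca : c - a ≤ 1 := by
      have hn2 : (2 : ℝ) ≤ n := by exact_mod_cast hn
      rw [← Real.log_div (by positivity) (by positivity)]
      have h1 := Real.log_le_sub_one_of_pos (x := ((n + 1 : ℕ) : ℝ) / n) (by positivity)
      have : ((n + 1 : ℕ) : ℝ) / n ≤ 2 := by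
        rw [div_le_iff₀ (by positivity)]; push_cast; linarith
      linarith
    have hl1 : Real.log c - Real.log a ≤ (c - a) / a := by
      rw [← Real.log_div hb.ne' ha.ne']
      have := Real.log_le_sub_one_of_pos (x := c / a) (by positivity)
      rw [sub_div, div_self ha.ne']; exact this
    have hl2 : (c - a) / c ≤ Real.log c - Real.log a := by
      have := Real.log_le_sub_one_of_pos (x := a / c) (by positivity)
      rw [Real.log_div ha.ne' hb.ne'] at this
      rw [sub_div, div_self hb.ne']; linarith
    have hd : 0 ≤ 1 / a - 1 / c := by
      have := one_div_le_one_div_of_le ha hac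
      linarith
    have hl3 : (c - a) / a - (c - a) / c ≤ 1 / a - 1 / c := by
      have : (c - a) / a - (c - a) / c = (c - a) * (1 / a - 1 / c) := by ring
      rw [this]; nlinarith
    have e : v (n + 1) - v n = ((c - a) / c - (Real.log c - Real.log a)) +
        (A n - a) * (1 / a - 1 / c) := by
      have h1 : E (n + 1) = E n + (A (n + 1) - A n) / c := by linarith
      simp only [hv]
      rw [h1]
      change E n + (A (n + 1) - A n) / c - Real.log c - (A (n + 1) - c) / c -
        (E n - Real.log a - (A n - a) / a) = _
      field_simp
      ring
    rw [e]
    refine (abs_add_le _ _).trans ?_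
    rw [abs_mul, abs_of_nonneg hd]
    have h1 : |(c - a) / c - (Real.log c - Real.log a)| ≤ 1 / a - 1 / c := by
      rw [abs_le]; constructor <;> linarith
    have h2 := mul_le_mul_of_nonneg_right hR hd
    linarith
  have hf : Filter.Tendsto (fun n : ℕ => 1 / Real.log n) Filter.atTop (nhds 0) := by
    simp only [one_div]
    exact (Real.tendsto_log_atTop.comp tendsto_natCast_atTop_atTop).inv_tendsto_atTop
  obtain ⟨b, hb⟩ := exists_limit_of_increment_le (v := v) (f := fun n : ℕ => 1 / Real.log n)
    (K := K + 1) (by linarith) hf (fun n hn => (one_div_pos.2 (hlog n hn)).le) key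
  refine ⟨b, 2 * K + 1, by linarith, fun N hN => ?_⟩
  have h1 := hb N hN
  have h2 := hA N (by omega)
  have hl := hlog N hN
  have e : E N - Real.log (Real.log N) - b = (v N - b) + (A N - Real.log N) / Real.log N := by
    simp only [hv]; ring
  change |E N - Real.log (Real.log N) - b| ≤ _
  rw [e]
  refine (abs_add_le _ _).trans ?_
  rw [abs_div, abs_of_pos hl]
  have h3 : |A N - Real.log N| / Real.log N ≤ K / Real.log N := by gcongr
  calc _ ≤ (K + 1) * (1 / Real.log N) + K / Real.log N := add_le_add h1 h3
    _ = _ := by ring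

namespace Mertens

lemma hasSum_of_eq {ι : Type*} {f g : ι → ℝ} {a b : ℝ} (h : HasSum f a) (hfg : ∀ i, g i = f i)
    (hab : b = a) : HasSum g b := by
  rw [hab, funext hfg]; exact h

/-- Abel summation for a power series with regrouped coefficients. -/
lemma hasSum_one_sub_mul_pow {ι : Type*} {a : ι → ℝ} {m : ι → ℕ} {D : ℕ → ℝ} {x S : ℝ}
    (ha : ∀ i, 0 ≤ a i) (hx0 : 0 ≤ x) (hx1 : x < 1)
    (hD : ∀ n, HasSum (fun i => if m i ≤ n then a i else 0) (D n))
    (hS : HasSum (fun i => a i * x ^ m i) S) :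
    HasSum (fun n => (1 - x) * x ^ n * D n) S := by
  obtain ⟨F, hF⟩ : ∃ F : ι × ℕ → ℝ, ∀ i n,
      F (i, n) = if m i ≤ n then a i * ((1 - x) * x ^ n) else 0 :=
    ⟨fun z => if m z.1 ≤ z.2 then a z.1 * ((1 - x) * x ^ z.2) else 0, fun _ _ => rfl⟩
  have h1x : 0 < 1 - x := by linarith
  have hF0 : 0 ≤ F := fun ⟨i, n⟩ => by
    rw [hF, Pi.zero_apply]
    split_ifs
    · have := ha i
      positivity
    · exact le_rfl
  have hrow : ∀ i, HasSum (fun n => F (i, n)) (a i * x ^ m i) := by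
    intro i
    rw [← hasSum_nat_add_iff' (m i)]
    have h0 : ∑ n ∈ Finset.range (m i), F (i, n) = 0 := by
      refine Finset.sum_eq_zero fun n hn => ?_
      rw [hF, if_neg]
      simpa using hn
    rw [h0, sub_zero]
    have h2 := (hasSum_geometric_of_lt_one hx0 hx1).mul_left (a i * (1 - x) * x ^ m i)
    refine hasSum_of_eq h2 (fun n => ?_) (by field_simp)
    rw [hF, if_pos (by omega), pow_add]
    ring
  have hsum : Summable F := by
    rw [summable_prod_of_nonneg hF0]
    refine ⟨fun i => (hrow i).summable, ?_⟩
    simp only [(hrow _).tsum_eq]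
    exact hS.summable
  have hT : HasSum F S := by
    have h3 := hS.unique (hsum.hasSum.prod_fiberwise hrow)
    rw [h3]
    exact hsum.hasSum
  have hT' : HasSum (fun z : ℕ × ι => F z.swap) S := (Equiv.prodComm ℕ ι).hasSum_iff.2 hT
  refine hT'.prod_fiberwise fun n => ?_
  refine hasSum_of_eq ((hD n).mul_left ((1 - x) * x ^ n)) (fun i => ?_) rfl
  rw [Prod.swap, hF]
  split_ifs <;> ring

/-- Abelian theorem for bounded convergent sequences. -/
lemma tendsto_abel_mean {u : ℕ → ℝ} {l : ℝ} (hu : Filter.Tendsto u Filter.atTop (nhds l))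
    {G : ℝ → ℝ} (hG : ∀ x, 0 < x → x < 1 → HasSum (fun n => (1 - x) * x ^ n * u n) (G x)) :
    Filter.Tendsto G (nhdsWithin 1 (Set.Iio 1)) (nhds l) := by
  rw [Metric.tendsto_nhds]
  intro ε hε
  obtain ⟨N, hN⟩ := Metric.tendsto_atTop.1 hu (ε / 2) (by positivity)
  set M := ∑ n ∈ Finset.range N, |u n - l| with hM
  have hM0 : 0 ≤ M := Finset.sum_nonneg fun _ _ => abs_nonneg _
  have hx : ∀ᶠ x : ℝ in nhdsWithin 1 (Set.Iio 1), 1 - ε / (2 * (M + 1)) < x ∧ 0 < x ∧ x < 1 := by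
    have h1 : ∀ᶠ x : ℝ in nhds 1, 1 - ε / (2 * (M + 1)) < x := 
      lt_mem_nhds (by have : 0 < ε / (2 * (M + 1)) := by positivity
                      linarith)
    have h2 : ∀ᶠ x : ℝ in nhds 1, 0 < x := lt_mem_nhds one_pos
    filter_upwards [h1.filter_mono nhdsWithin_le_nhds, h2.filter_mono nhdsWithin_le_nhds,
      self_mem_nhdsWithin] with x a b c
    exact ⟨a, b, c⟩
  filter_upwards [hx] with x ⟨hx, hx0, hx1⟩
  have hg := (hasSum_geometric_of_lt_one hx0.le hx1)
  have h1x : 0 < 1 - x := by linarith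
  have hd : HasSum (fun n => (1 - x) * x ^ n * (u n - l)) (G x - l) := by
    have := (hG x hx0 hx1).sub (hg.mul_left ((1 - x) * l))
    exact hasSum_of_eq this (fun n => by ring) (by field_simp)
  have hb : HasSum (fun n => (1 - x) * x ^ n * (ε / 2)) (ε / 2) := by
    have := hg.mul_left ((1 - x) * (ε / 2))
    exact hasSum_of_eq this (fun n => by ring) (by field_simp)
  have hc : HasSum (fun n => if n ∈ Finset.range N then (1 - x) * |u n - l| else 0)
      ((1 - x) * M) := by
    rw [hM, Finset.mul_sum]
    rw [← Finset.sum_congr rfl (fun n hn => if_pos hn)]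
    exact hasSum_sum_of_ne_finset_zero fun n hn => if_neg hn
  have hbound : ∀ n, |(1 - x) * x ^ n * (u n - l)| ≤ (1 - x) * x ^ n * (ε / 2) +
      (if n ∈ Finset.range N then (1 - x) * |u n - l| else 0) := by
    intro n
    rw [abs_mul, abs_of_nonneg (by positivity)]
    have hp : x ^ n ≤ 1 := pow_le_one₀ hx0.le hx1.le
    split_ifs with h
    · have : (1 - x) * x ^ n * |u n - l| ≤ (1 - x) * 1 * |u n - l| := by gcongr
      have : 0 ≤ (1 - x) * x ^ n * (ε / 2) := by positivity
      linarith
    · have := hN n (by simpa using h)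
      rw [Real.dist_eq] at this
      rw [add_zero]
      gcongr
  have habs : |G x - l| ≤ ε / 2 + (1 - x) * M := by
    rw [abs_le]
    constructor
    · have := hasSum_le (fun n => neg_le_of_abs_le (hbound n)) (hb.add hc).neg hd
      linarith
    · exact hasSum_le (fun n => le_of_abs_le (hbound n)) hd (hb.add hc)
  rw [Real.dist_eq]
  have : (1 - x) * (M + 1) < ε / 2 := by
    have h1 : 1 - x < ε / (2 * (M + 1)) := by linarith
    calc (1 - x) * (M + 1) < ε / (2 * (M + 1)) * (M + 1) := by gcongr
      _ = ε / 2 := by field_simp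
  nlinarith

lemma hasSum_primes_log_le (n : ℕ) :
    HasSum (fun p : Nat.Primes => if ⌈Real.log (p : ℕ)⌉₊ ≤ n then (1 : ℝ) / (p : ℕ) else 0)
      (∑ p ∈ Nat.primesLE ⌊Real.exp n⌋₊, (1 : ℝ) / p) := by
  set f : ℕ → ℝ := fun p => if ⌈Real.log p⌉₊ ≤ n then (1 : ℝ) / p else 0
  refine (hasSum_subtype_iff_indicator (f := f) (s := {p | p.Prime})).2 ?_
  have hmem : ∀ p : ℕ, p.Prime → (p ∈ Nat.primesLE ⌊Real.exp n⌋₊ ↔ ⌈Real.log p⌉₊ ≤ n) := by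
    intro p hp
    have : (0 : ℝ) < p := by exact_mod_cast hp.pos
    rw [Nat.mem_primesLE, Nat.le_floor_iff (Real.exp_pos _).le, Nat.ceil_le,
      Real.log_le_iff_le_exp this]
    simp [hp]
  have : ∑ p ∈ Nat.primesLE ⌊Real.exp n⌋₊, (1 : ℝ) / p =
      ∑ p ∈ Nat.primesLE ⌊Real.exp n⌋₊, Set.indicator {p | p.Prime} f p := by
    refine Finset.sum_congr rfl fun p hp => ?_
    have hpp := (Nat.mem_primesLE.1 hp).2
    rw [Set.indicator_of_mem (by exact hpp)]
    simp only [f]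
    rw [if_pos ((hmem p hpp).1 hp)]
  rw [this]
  refine hasSum_sum_of_ne_finset_zero fun p hp => ?_
  by_cases hpp : p.Prime
  · rw [Set.indicator_of_mem (by exact hpp)]
    simp only [f]
    rw [if_neg (fun h => hp ((hmem p hpp).2 h))]
  · exact Set.indicator_of_notMem (by exact hpp) _

lemma tendsto_sum_primes_sub_harmonic {b K : ℝ} (hK : 0 ≤ K)
    (h : ∀ N, 2 ≤ N →
      |∑ p ∈ Nat.primesLE N, (1:ℝ)/p - Real.log (Real.log N) - b| ≤ K / Real.log N) :
    Filter.Tendsto (fun n : ℕ => ∑ p ∈ Nat.primesLE ⌊Real.exp n⌋₊, (1 : ℝ) / p - harmonic n)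
      Filter.atTop (nhds (b - Real.eulerMascheroniConstant)) := by
  have h1 : Filter.Tendsto (fun n : ℕ => (K + 1) / ((n : ℝ) - 1)) Filter.atTop (nhds 0) := by
    apply Filter.Tendsto.const_div_atTop
    exact Filter.tendsto_atTop_add_const_right _ _ tendsto_natCast_atTop_atTop
  have h2 : Filter.Tendsto (fun n : ℕ => ∑ p ∈ Nat.primesLE ⌊Real.exp n⌋₊, (1 : ℝ) / p
      - Real.log n) Filter.atTop (nhds b) := by
    rw [tendsto_iff_norm_sub_tendsto_zero]
    refine squeeze_zero' (Filter.Eventually.of_forall fun _ => norm_nonneg _) ?_ h1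
    filter_upwards [Filter.eventually_ge_atTop 2] with n hn
    have hn2 : (2 : ℝ) ≤ n := by exact_mod_cast hn
    set N := ⌊Real.exp n⌋₊
    have he : (n : ℝ) + 1 ≤ Real.exp n := Real.add_one_le_exp _
    have hN1 : (N : ℝ) ≤ Real.exp n := Nat.floor_le (Real.exp_pos _).le
    have hN2 : Real.exp n < N + 1 := Nat.lt_floor_add_one _
    have hN : 2 ≤ N := Nat.le_floor (by push_cast; linarith)
    have hNr : (2 : ℝ) ≤ N := by exact_mod_cast hN
    have hl1 : Real.log N ≤ n := (Real.log_le_iff_le_exp (by linarith)).2 hN1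
    have hl2 : (n : ℝ) - 1 ≤ Real.log N := by
      rw [Real.le_log_iff_exp_le (by linarith), Real.exp_sub, div_le_iff₀ (Real.exp_pos _)]
      have : (2 : ℝ) ≤ Real.exp 1 := by have := Real.add_one_le_exp 1; linarith
      nlinarith
    have hn1 : (0 : ℝ) < n - 1 := by linarith
    have hlp : 0 < Real.log N := by linarith
    have ha := h N hN
    have hb : |Real.log (Real.log N) - Real.log n| ≤ 1 / ((n : ℝ) - 1) := by
      rw [abs_sub_comm, abs_of_nonneg (sub_nonneg.2 (Real.log_le_log hlp hl1)),
        ← Real.log_div (by linarith) hlp.ne']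
      refine (Real.log_le_sub_one_of_pos (by positivity)).trans ?_
      rw [div_sub_one hlp.ne']
      gcongr
      linarith
    rw [Real.norm_eq_abs]
    have hc : K / Real.log N ≤ K / ((n : ℝ) - 1) := by gcongr
    calc _ = |(∑ p ∈ Nat.primesLE N, (1:ℝ)/p - Real.log (Real.log N) - b) +
            (Real.log (Real.log N) - Real.log n)| := by congr 1; ring
      _ ≤ _ := abs_add_le _ _
      _ ≤ K / ((n : ℝ) - 1) + 1 / ((n : ℝ) - 1) := by linarith
      _ = _ := by ring
  have h3 := h2.sub Real.tendsto_harmonic_sub_log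
  refine h3.congr fun n => by ring

lemma rpow_neg_one_add (p : Nat.Primes) (σ : ℝ) :
    ((p : ℕ) : ℝ) ^ (-(1 + σ)) = 1 / (p : ℕ) * Real.exp (-σ * Real.log (p : ℕ)) := by
  have hp : (0 : ℝ) < (p : ℕ) := by exact_mod_cast p.2.pos
  rw [neg_add, Real.rpow_add hp, Real.rpow_neg_one, one_div, Real.rpow_def_of_pos hp]
  ring_nf

lemma exp_neg_pow_ceil_le {σ t : ℝ} (hσ : 0 < σ) :
    Real.exp (-σ) ^ ⌈t⌉₊ ≤ Real.exp (-σ * t) := by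
  rw [← Real.exp_nat_mul]
  have := Nat.le_ceil t
  exact Real.exp_le_exp.2 (by nlinarith)

lemma exp_neg_le_pow_ceil {σ t : ℝ} (hσ : 0 < σ) (ht : 0 ≤ t) :
    Real.exp (-σ * t) ≤ Real.exp σ * Real.exp (-σ) ^ ⌈t⌉₊ := by
  rw [← Real.exp_nat_mul, ← Real.exp_add]
  have := Nat.ceil_lt_add_one ht
  exact Real.exp_le_exp.2 (by nlinarith)

lemma summable_primes_rpow {σ : ℝ} (hσ : 0 < σ) :
    Summable fun p : Nat.Primes => ((p : ℕ) : ℝ) ^ (-(1 + σ)) :=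
  Nat.Primes.summable_rpow.2 (by linarith)

lemma summable_primes_pow_ceil {σ : ℝ} (hσ : 0 < σ) :
    Summable fun p : Nat.Primes => (1 : ℝ) / (p : ℕ) * Real.exp (-σ) ^ ⌈Real.log (p : ℕ)⌉₊ := by
  refine (summable_primes_rpow hσ).of_nonneg_of_le (fun p => by positivity) fun p => ?_
  rw [rpow_neg_one_add]
  have := exp_neg_pow_ceil_le (t := Real.log (p : ℕ)) hσ
  gcongr

/-- The prime zeta function at `1 + σ`, shifted by `log σ`, in terms of the Mertens constant. -/
lemma tendsto_primes_pow_ceil {b K : ℝ} (hK : 0 ≤ K)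
    (h : ∀ N, 2 ≤ N →
      |∑ p ∈ Nat.primesLE N, (1:ℝ)/p - Real.log (Real.log N) - b| ≤ K / Real.log N) :
    Filter.Tendsto (fun x : ℝ => ∑' p : Nat.Primes, (1 : ℝ) / (p : ℕ) *
        x ^ ⌈Real.log (p : ℕ)⌉₊ + Real.log (1 - x))
      (nhdsWithin 1 (Set.Iio 1)) (nhds (b - Real.eulerMascheroniConstant)) := by
  refine tendsto_abel_mean (tendsto_sum_primes_sub_harmonic hK h) fun x hx0 hx1 => ?_
  have hs : Summable fun p : Nat.Primes => (1 : ℝ) / (p : ℕ) * x ^ ⌈Real.log (p : ℕ)⌉₊ := by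
    have := summable_primes_pow_ceil (σ := -Real.log x) (by have := Real.log_neg hx0 hx1; linarith)
    simpa [Real.exp_log hx0] using this
  have h1 := hasSum_one_sub_mul_pow (fun p => by positivity) hx0.le hx1 hasSum_primes_log_le
    hs.hasSum
  have h2 : HasSum (fun n : ℕ => (1 - x) * x ^ n * (harmonic n : ℝ)) (-Real.log (1 - x)) := by
    have h3 := Real.hasSum_pow_div_log_of_abs_lt_one (x := x) (by rwa [abs_of_pos hx0])
    refine hasSum_one_sub_mul_pow (ι := ℕ) (a := fun n => 1 / ((n : ℝ) + 1)) (m := fun n => n + 1)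
      (fun n => by positivity) hx0.le hx1 (fun n => ?_)
      (hasSum_of_eq h3 (fun n => by ring) rfl)
    have : ((harmonic n : ℚ) : ℝ) = ∑ i ∈ Finset.range n,
        (if i + 1 ≤ n then 1 / ((i : ℝ) + 1) else 0) := by
      rw [harmonic]
      push_cast
      refine Finset.sum_congr rfl fun i hi => ?_
      rw [if_pos (by simpa using hi), one_div]
    rw [this]
    refine hasSum_sum_of_ne_finset_zero fun i hi => ?_
    rw [if_neg (by simpa using hi)]
  refine hasSum_of_eq (h1.sub h2) (fun n => by ring) (by ring)

/-- The quadratic remainder of `-log (1 - u)`. -/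
noncomputable def logRem (u : ℝ) : ℝ := -Real.log (1 - u) - u

lemma logRem_nonneg {u : ℝ} (hu : u < 1) : 0 ≤ logRem u := by
  have := Real.log_le_sub_one_of_pos (x := 1 - u) (by linarith)
  unfold logRem; linarith

lemma logRem_le {u : ℝ} (hu : u < 1) : logRem u ≤ u ^ 2 / (1 - u) := by
  have h1 : 0 < 1 - u := by linarith
  have := Real.log_le_sub_one_of_pos (x := (1 - u)⁻¹) (by positivity)
  rw [Real.log_inv] at this
  have e : u ^ 2 / (1 - u) = (1 - u)⁻¹ - 1 - u := by field_simp; ring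
  rw [e]; unfold logRem; linarith

lemma primes_rpow_le_half (p : Nat.Primes) {s : ℝ} (hs : 1 ≤ s) :
    ((p : ℕ) : ℝ) ^ (-s) ≤ 1 / (p : ℕ) := by
  have hp : (2 : ℝ) ≤ (p : ℕ) := by exact_mod_cast p.2.two_le
  rw [one_div, ← Real.rpow_neg_one]
  exact Real.rpow_le_rpow_of_exponent_le (by linarith) (by linarith)

lemma logRem_prime_le (p : Nat.Primes) {s : ℝ} (hs : 1 ≤ s) :
    logRem (((p : ℕ) : ℝ) ^ (-s)) ≤ 2 * ((p : ℕ) : ℝ) ^ (-2 : ℝ) := by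
  have hp : (2 : ℝ) ≤ (p : ℕ) := by exact_mod_cast p.2.two_le
  have h0 : (0 : ℝ) < ((p : ℕ) : ℝ) ^ (-s) := by positivity
  have h1 := primes_rpow_le_half p hs
  have h2 : (1 : ℝ) / (p : ℕ) ≤ 1 / 2 := by gcongr
  refine (logRem_le (by linarith)).trans ?_
  have e : ((p : ℕ) : ℝ) ^ (-2 : ℝ) = (1 / (p : ℕ)) ^ 2 := by
    rw [Real.rpow_neg (by linarith), Real.rpow_two]; simp
  rw [e, div_le_iff₀ (by linarith)]
  have h3 : (((p : ℕ) : ℝ) ^ (-s)) ^ 2 ≤ (1 / (p : ℕ)) ^ 2 := by gcongr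
  nlinarith

lemma tendsto_tsum_logRem :
    Filter.Tendsto (fun σ : ℝ => ∑' p : Nat.Primes, logRem (((p : ℕ) : ℝ) ^ (-(1 + σ))))
      (nhdsWithin 0 (Set.Ioi 0)) (nhds (∑' p : Nat.Primes, logRem (1 / (p : ℕ)))) := by
  refine tendsto_tsum_of_dominated_convergence
    (bound := fun p : Nat.Primes => 2 * ((p : ℕ) : ℝ) ^ (-2 : ℝ))
    ((Nat.Primes.summable_rpow.2 (by norm_num)).mul_left 2) (fun p => ?_) ?_
  · have hp : (2 : ℝ) ≤ (p : ℕ) := by exact_mod_cast p.2.two_le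
    have h1 : Filter.Tendsto (fun σ : ℝ => ((p : ℕ) : ℝ) ^ (-(1 + σ))) (nhdsWithin 0 (Set.Ioi 0))
        (nhds (1 / (p : ℕ))) := by
      have : Continuous fun σ : ℝ => ((p : ℕ) : ℝ) ^ (-(1 + σ)) :=
        Continuous.rpow continuous_const (by fun_prop) fun _ => Or.inl (by positivity)
      have h2 := this.tendsto 0
      rw [add_zero, Real.rpow_neg_one, ← one_div] at h2
      exact h2.mono_left nhdsWithin_le_nhds
    have h3 : ContinuousAt logRem (1 / (p : ℕ)) := by
      have : (1 : ℝ) / (p : ℕ) ≤ 1 / 2 := by gcongr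
      unfold logRem
      refine ContinuousAt.sub (ContinuousAt.neg (ContinuousAt.log (by fun_prop) ?_)) (by fun_prop)
      linarith
    exact h3.tendsto.comp h1
  · filter_upwards [self_mem_nhdsWithin] with σ hσ p
    have hσ : 0 < σ := hσ
    have hp : (2 : ℝ) ≤ (p : ℕ) := by exact_mod_cast p.2.two_le
    have h1 := primes_rpow_le_half p (s := 1 + σ) (by linarith)
    have h2 : (1 : ℝ) / (p : ℕ) ≤ 1 / 2 := by gcongr
    rw [Real.norm_eq_abs, abs_of_nonneg (logRem_nonneg (by linarith))]
    exact logRem_prime_le p (by linarith)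

/-- `n ↦ n ^ (-s)` as a monoid-with-zero homomorphism. -/
noncomputable def rpowNegHom (s : ℝ) (hs : s ≠ 0) : ℕ →*₀ ℝ where
  toFun n := (n : ℝ) ^ (-s)
  map_zero' := by simp [hs]
  map_one' := by simp
  map_mul' m n := by
    push_cast
    exact Real.mul_rpow (by positivity) (by positivity)

lemma exp_tsum_primes_eq {σ : ℝ} (hσ : 0 < σ) :
    Real.exp (∑' p : Nat.Primes, ((p : ℕ) : ℝ) ^ (-(1 + σ)) +
      ∑' p : Nat.Primes, logRem (((p : ℕ) : ℝ) ^ (-(1 + σ)))) =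
      ∑' n : ℕ, 1 / (n : ℝ) ^ (1 + σ) := by
  have hlt : ∀ p : Nat.Primes, ((p : ℕ) : ℝ) ^ (-(1 + σ)) ≤ 1 / 2 := fun p => by
    have hp : (2 : ℝ) ≤ (p : ℕ) := by exact_mod_cast p.2.two_le
    exact (primes_rpow_le_half p (by linarith)).trans (by gcongr)
  have hs2 : Summable fun p : Nat.Primes => logRem (((p : ℕ) : ℝ) ^ (-(1 + σ))) :=
    ((Nat.Primes.summable_rpow.2 (by norm_num : (-2 : ℝ) < -1)).mul_left 2).of_nonneg_of_le
      (fun p => logRem_nonneg (by have := hlt p; linarith))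
      (fun p => logRem_prime_le p (by linarith))
  have h1 := ((summable_primes_rpow hσ).hasSum.add hs2.hasSum).rexp
  have hne : (1 + σ) ≠ 0 := by linarith
  have hsum : Summable fun n : ℕ => ‖rpowNegHom (1 + σ) hne n‖ :=
    (Real.summable_nat_rpow.2 (by linarith)).norm
  have h2 := EulerProduct.eulerProduct_completely_multiplicative_hasProd hsum
  have h3 : ∀ n : ℕ, rpowNegHom (1 + σ) hne n = (n : ℝ) ^ (-(1 + σ)) := fun _ => rfl
  rw [show (∑' n : ℕ, 1 / (n : ℝ) ^ (1 + σ)) = ∑' n : ℕ, rpowNegHom (1 + σ) hne n from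
    tsum_congr fun n => by rw [h3, Real.rpow_neg (by positivity), one_div]]
  have e : (Real.exp ∘ fun p : Nat.Primes => ((p : ℕ) : ℝ) ^ (-(1 + σ)) +
      logRem (((p : ℕ) : ℝ) ^ (-(1 + σ)))) =
      fun p : Nat.Primes => (1 - rpowNegHom (1 + σ) hne (p : ℕ))⁻¹ := by
    funext p
    have := hlt p
    rw [h3, Function.comp, logRem, add_sub_cancel, Real.exp_neg, Real.exp_log (by linarith)]
  rw [e] at h1
  exact h1.unique h2

lemma tendsto_tsum_primes_add_log :
    Filter.Tendsto (fun σ : ℝ => ∑' p : Nat.Primes, ((p : ℕ) : ℝ) ^ (-(1 + σ)) + Real.log σ)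
      (nhdsWithin 0 (Set.Ioi 0)) (nhds (-∑' p : Nat.Primes, logRem (1 / (p : ℕ)))) := by
  have h1 : Filter.Tendsto (fun σ : ℝ => σ * ∑' n : ℕ, 1 / (n : ℝ) ^ (1 + σ))
      (nhdsWithin 0 (Set.Ioi 0)) (nhds 1) := by
    have h2 : Filter.Tendsto (fun σ : ℝ => 1 + σ) (nhdsWithin 0 (Set.Ioi 0))
        (nhdsWithin 1 (Set.Ioi 1)) := by
      refine tendsto_nhdsWithin_iff.2 ⟨?_, ?_⟩
      · have : Continuous fun σ : ℝ => 1 + σ := by fun_prop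
        have h := this.tendsto 0
        rw [add_zero] at h
        exact h.mono_left nhdsWithin_le_nhds
      · filter_upwards [self_mem_nhdsWithin] with σ hσ
        have hσ : 0 < σ := hσ
        exact (by linarith : 1 < 1 + σ)
    refine (tendsto_sub_mul_tsum_nat_rpow.comp h2).congr fun σ => ?_
    simp
  have h3 := (Real.continuousAt_log one_ne_zero).tendsto.comp h1
  rw [Real.log_one] at h3
  have h4 := h3.sub tendsto_tsum_logRem
  rw [zero_sub] at h4
  refine h4.congr' ?_
  filter_upwards [self_mem_nhdsWithin] with σ hσ
  have hσ : 0 < σ := hσ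
  simp only [Function.comp]
  rw [← exp_tsum_primes_eq hσ, Real.log_mul hσ.ne' (Real.exp_pos _).ne', Real.log_exp]
  ring

/-- Identification of the Mertens constant. -/
lemma mertens_constant {b K : ℝ} (hK : 0 ≤ K)
    (h : ∀ N, 2 ≤ N →
      |∑ p ∈ Nat.primesLE N, (1:ℝ)/p - Real.log (Real.log N) - b| ≤ K / Real.log N) :
    b + ∑' p : Nat.Primes, logRem (1 / (p : ℕ)) = Real.eulerMascheroniConstant := by
  set l := nhdsWithin (0 : ℝ) (Set.Ioi 0)
  have hpos : ∀ᶠ σ : ℝ in l, 0 < σ := self_mem_nhdsWithin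
  have hx : Filter.Tendsto (fun σ : ℝ => Real.exp (-σ)) l (nhdsWithin 1 (Set.Iio 1)) := by
    refine tendsto_nhdsWithin_iff.2 ⟨?_, ?_⟩
    · have : Continuous fun σ : ℝ => Real.exp (-σ) := by fun_prop
      have h := this.tendsto 0
      rw [neg_zero, Real.exp_zero] at h
      exact h.mono_left nhdsWithin_le_nhds
    · filter_upwards [hpos] with σ hσ
      exact Real.exp_lt_one_iff.2 (by linarith)
  have hP := (tendsto_primes_pow_ceil hK h).comp hx
  set P : ℝ → ℝ := fun σ => ∑' p : Nat.Primes, (1 : ℝ) / (p : ℕ) *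
        Real.exp (-σ) ^ ⌈Real.log (p : ℕ)⌉₊ with hPdef
  set Z : ℝ → ℝ := fun σ => ∑' p : Nat.Primes, ((p : ℕ) : ℝ) ^ (-(1 + σ))
  have hP : Filter.Tendsto (fun σ => P σ + Real.log (1 - Real.exp (-σ))) l
    (nhds (b - Real.eulerMascheroniConstant)) := hP
  have hq : Filter.Tendsto (fun σ : ℝ => (1 - Real.exp (-σ)) / σ) l (nhds 1) := by
    have hd : HasDerivAt (fun σ : ℝ => -Real.exp (-σ)) 1 0 := by
      have := ((hasDerivAt_neg (0 : ℝ)).exp).fun_neg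
      simpa using this
    have := (hasDerivAt_iff_tendsto_slope.1 hd).mono_left
      (nhdsWithin_mono 0 (fun x hx => (ne_of_gt hx : x ≠ 0)) : l ≤ _)
    refine this.congr fun σ => ?_
    rw [slope_def_field]
    simp
    ring
  have hlq : Filter.Tendsto (fun σ : ℝ => Real.log (1 - Real.exp (-σ)) - Real.log σ) l
      (nhds 0) := by
    have := (Real.continuousAt_log one_ne_zero).tendsto.comp hq
    rw [Real.log_one] at this
    refine this.congr' ?_
    filter_upwards [hpos] with σ hσ
    have : Real.exp (-σ) < 1 := Real.exp_lt_one_iff.2 (by linarith)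
    simp only [Function.comp]
    rw [Real.log_div (by linarith) hσ.ne']
  have hP2 : Filter.Tendsto (fun σ => P σ + Real.log σ) l
      (nhds (b - Real.eulerMascheroniConstant)) := by
    have := hP.sub hlq
    rw [sub_zero] at this
    exact this.congr fun σ => by ring
  have hlow : ∀ σ, 0 < σ → P σ ≤ Z σ := fun σ hσ => by
    refine (summable_primes_pow_ceil hσ).tsum_le_tsum (fun p => ?_) (summable_primes_rpow hσ)
    rw [rpow_neg_one_add]
    have := exp_neg_pow_ceil_le (t := Real.log (p : ℕ)) hσ
    gcongr
  have hup : ∀ σ, 0 < σ → Z σ ≤ Real.exp σ * P σ := fun σ hσ => by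
    simp only [hPdef]
    rw [← tsum_mul_left]
    refine (summable_primes_rpow hσ).tsum_le_tsum (fun p => ?_)
      ((summable_primes_pow_ceil hσ).mul_left _)
    rw [rpow_neg_one_add]
    have hp : (1 : ℝ) ≤ (p : ℕ) := by exact_mod_cast p.2.one_le
    have := exp_neg_le_pow_ceil (t := Real.log (p : ℕ)) hσ (Real.log_nonneg hp)
    calc _ ≤ 1 / ((p : ℕ) : ℝ) * (Real.exp σ * Real.exp (-σ) ^ ⌈Real.log (p : ℕ)⌉₊) := by gcongr
      _ = _ := by ring
  have he : Filter.Tendsto (fun σ : ℝ => (Real.exp σ - 1) / σ) l (nhds 1) := by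
    have hd : HasDerivAt (fun σ : ℝ => Real.exp σ) 1 0 := by
      simpa using Real.hasDerivAt_exp 0
    have := (hasDerivAt_iff_tendsto_slope.1 hd).mono_left
      (nhdsWithin_mono 0 (fun x hx => (ne_of_gt hx : x ≠ 0)) : l ≤ _)
    refine this.congr fun σ => ?_
    rw [slope_def_field]
    simp
  have hid : Filter.Tendsto (fun σ : ℝ => σ) l (nhds 0) :=
    Filter.tendsto_id.mono_left nhdsWithin_le_nhds
  have hsl : Filter.Tendsto (fun σ : ℝ => Real.log σ * σ) l (nhds 0) := by
    simpa using tendsto_log_mul_rpow_nhdsGT_zero one_pos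
  have hsP : Filter.Tendsto (fun σ => σ * P σ) l (nhds 0) := by
    have := (hid.mul hP2).sub hsl
    rw [zero_mul, sub_zero] at this
    exact this.congr fun σ => by ring
  have hdiff : Filter.Tendsto (fun σ => Z σ - P σ) l (nhds 0) := by
    have h1 := he.mul hsP
    rw [mul_zero] at h1
    refine squeeze_zero' ?_ ?_ h1
    · filter_upwards [hpos] with σ hσ
      linarith [hlow σ hσ]
    · filter_upwards [hpos] with σ hσ
      have : (Real.exp σ - 1) / σ * (σ * P σ) = Real.exp σ * P σ - P σ := by
        field_simp
      rw [this]
      linarith [hup σ hσ]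
  have hZ : Filter.Tendsto (fun σ => Z σ + Real.log σ) l
      (nhds (b - Real.eulerMascheroniConstant)) := by
    have := hdiff.add hP2
    rw [zero_add] at this
    exact this.congr fun σ => by ring
  have := tendsto_nhds_unique hZ tendsto_tsum_primes_add_log
  linarith

lemma logRem_primes_tail {N : ℕ} (hN : 1 ≤ N) :
    |∑' p : Nat.Primes, logRem (1 / (p : ℕ)) -
      ∑ p ∈ Nat.primesLE N, logRem (1 / p)| ≤ 1 / N := by
  set f : ℕ → ℝ := Set.indicator {p | p.Prime} fun p => logRem (1 / (p : ℝ)) with hf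
  have hp2 : ∀ p : ℕ, p.Prime → (1 : ℝ) / p ≤ 1 / 2 := fun p hp => by
    have : (2 : ℝ) ≤ p := by exact_mod_cast hp.two_le
    gcongr
  have hf0 : ∀ n, 0 ≤ f n := fun n => by
    refine Set.indicator_nonneg (fun p hp => ?_) n
    exact logRem_nonneg (by have := hp2 p hp; linarith)
  have hs0 : Summable fun p : Nat.Primes => logRem (1 / ((p : ℕ) : ℝ)) := by
    refine ((Nat.Primes.summable_rpow.2 (by norm_num : (-2 : ℝ) < -1)).mul_left 2).of_nonneg_of_le
      (fun p => logRem_nonneg (by have := hp2 p p.2; linarith)) (fun p => ?_)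
    have := logRem_prime_le p le_rfl
    rwa [Real.rpow_neg_one, ← one_div] at this
  have hs : HasSum f (∑' p : Nat.Primes, logRem (1 / (p : ℕ))) :=
    (hasSum_subtype_iff_indicator (f := fun p : ℕ => logRem (1 / (p : ℝ)))
      (s := {p | p.Prime})).1 hs0.hasSum
  have h1 := hs.summable.sum_add_tsum_nat_add (N + 1)
  have h2 : ∑ i ∈ Finset.range (N + 1), f i = ∑ p ∈ Nat.primesLE N, logRem (1 / p) := by
    rw [Nat.primesLE_eq_filter_range, Finset.sum_filter]
    refine Finset.sum_congr rfl fun i _ => ?_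
    simp only [hf, Set.indicator, Set.mem_ofPred_eq]
    congr
  rw [h2, hs.tsum_eq] at h1
  have h3 : ∑' i, f (i + (N + 1)) ≤ 1 / N := by
    refine Real.tsum_le_of_sum_range_le (fun _ => hf0 _) fun n => ?_
    have hNr : (1 : ℝ) ≤ N := by exact_mod_cast hN
    have : ∀ n : ℕ, ∑ i ∈ Finset.range n, f (i + (N + 1)) ≤ 1 / N - 1 / (N + n) := by
      intro n
      induction n with
      | zero => simp
      | succ n ih =>
        rw [Finset.sum_range_succ]
        have hn : (0 : ℝ) ≤ n := by positivity
        have h4 : f (n + (N + 1)) ≤ 1 / ((N : ℝ) + n) - 1 / (N + n + 1) := by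
          have e : (1 : ℝ) / ((N : ℝ) + n) - 1 / (N + n + 1) = 1 / ((N + n) * (N + n + 1)) := by
            field_simp; ring
          rw [e]
          simp only [hf, Set.indicator, Set.mem_ofPred_eq]
          split_ifs with hp
          · have h5 := hp2 _ hp
            refine (logRem_le (by linarith)).trans (le_of_eq ?_)
            push_cast
            have : (N : ℝ) + n ≠ 0 := by positivity
            have h6 : (n : ℝ) + (N + 1) ≠ 0 := by positivity
            have h7 : 1 - 1 / ((n : ℝ) + (N + 1)) = (N + n) / (N + n + 1) := by
              field_simp; ring
            rw [h7]
            field_simp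
            ring
          · positivity
        push_cast
        rw [← add_assoc (N : ℝ)]
        linarith
    have h8 := this n
    have : (0 : ℝ) ≤ 1 / (N + n) := by positivity
    linarith
  have h9 : 0 ≤ ∑' i, f (i + (N + 1)) := tsum_nonneg fun _ => hf0 _
  rw [abs_le]
  constructor <;> linarith

/-- Mertens' third theorem with an explicit error term. -/
theorem mertens_third : ∃ C : ℝ, 0 ≤ C ∧ ∀ N : ℕ, 2 ≤ N →
    Real.exp Real.eulerMascheroniConstant * (Real.log N - C) ≤
      ∏ p ∈ Nat.primesLE N, (1 - (1 : ℝ) / p)⁻¹ ∧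
    ∏ p ∈ Nat.primesLE N, (1 - (1 : ℝ) / p)⁻¹ ≤
      Real.exp Real.eulerMascheroniConstant * (Real.log N + C) := by
  obtain ⟨b, K, hK, h⟩ := mertens_second
  have hb := mertens_constant hK h
  set R : ℝ := ∑' p : Nat.Primes, logRem (1 / (p : ℕ)) with hR
  set γ := Real.eulerMascheroniConstant
  refine ⟨(K + 1) * Real.exp (2 * (K + 1)), by positivity, fun N hN => ?_⟩
  have hNr : (2 : ℝ) ≤ N := by exact_mod_cast hN
  have hL : 1 / 2 ≤ Real.log N :=
    le_trans (by have := Real.log_two_gt_d9; linarith) (Real.log_le_log two_pos hNr)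
  set L := Real.log N with hLdef
  have hLN : L ≤ N := Real.log_le_self (by linarith)
  set Q := ∏ p ∈ Nat.primesLE N, (1 - (1 : ℝ) / p)⁻¹
  have hpos : ∀ p ∈ Nat.primesLE N, 0 < 1 - (1 : ℝ) / p := fun p hp => by
    have h2 : (2 : ℝ) ≤ p := by exact_mod_cast (Nat.mem_primesLE.1 hp).2.two_le
    have : (1 : ℝ) / p ≤ 1 / 2 := by gcongr
    linarith
  have hQ : 0 < Q := Finset.prod_pos fun p hp => inv_pos.2 (hpos p hp)
  have hlog : Real.log Q = ∑ p ∈ Nat.primesLE N, (1 : ℝ) / p +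
      ∑ p ∈ Nat.primesLE N, logRem (1 / p) := by
    rw [Real.log_prod (fun p hp => (inv_pos.2 (hpos p hp)).ne'), ← Finset.sum_add_distrib]
    refine Finset.sum_congr rfl fun p _ => ?_
    rw [Real.log_inv, logRem]; ring
  have h1 := h N hN
  have h2 := logRem_primes_tail (N := N) (by omega)
  have h3 : (1 : ℝ) / N ≤ 1 / L := by gcongr
  have h4 : |Real.log Q - (Real.log L + γ)| ≤ (K + 1) / L := by
    have e : Real.log Q - (Real.log L + γ) =
        (∑ p ∈ Nat.primesLE N, (1:ℝ)/p - Real.log L - b) -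
        (R - ∑ p ∈ Nat.primesLE N, logRem (1 / p)) := by
      rw [hlog, ← hb]; ring
    rw [e]
    refine (abs_sub _ _).trans ?_
    rw [add_div]
    linarith
  obtain ⟨h5, h6⟩ := abs_le.1 h4
  set u := (K + 1) / L with hu
  have hu0 : 0 ≤ u := by positivity
  have hu2 : u ≤ 2 * (K + 1) := by
    rw [hu, div_le_iff₀ (by linarith)]; nlinarith
  have huL : u * L = K + 1 := by rw [hu]; field_simp
  have hL0 : 0 < L := by linarith
  have e1 : ∀ v : ℝ, Real.exp (Real.log L + γ + v) = Real.exp γ * (L * Real.exp v) := fun v => by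
    rw [Real.exp_add, Real.exp_add, Real.exp_log hL0]; ring
  constructor
  · calc _ ≤ Real.exp γ * (L * Real.exp (-u)) := by
          gcongr
          have h7 := Real.add_one_le_exp (-u)
          have h8 := Real.one_le_exp (x := 2 * (K + 1)) (by linarith)
          have h9 : L * (-u + 1) ≤ L * Real.exp (-u) := by gcongr
          nlinarith
      _ = Real.exp (Real.log L + γ + -u) := (e1 _).symm
      _ ≤ Real.exp (Real.log Q) := Real.exp_le_exp.2 (by linarith)
      _ = Q := Real.exp_log hQ
  · calc Q = Real.exp (Real.log Q) := (Real.exp_log hQ).symm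
      _ ≤ Real.exp (Real.log L + γ + u) := Real.exp_le_exp.2 (by linarith)
      _ = Real.exp γ * (L * Real.exp u) := e1 _
      _ ≤ _ := by
          gcongr
          have h7 := Real.add_one_le_exp (-u)
          have h8 : Real.exp u ≤ 1 + u * Real.exp u := by
            have : Real.exp (-u) * Real.exp u = 1 := by rw [← Real.exp_add]; simp
            have := mul_le_mul_of_nonneg_right h7 (Real.exp_pos u).le
            linarith
          have h9 : Real.exp u ≤ Real.exp (2 * (K + 1)) := Real.exp_le_exp.2 hu2
          calc L * Real.exp u ≤ L * (1 + u * Real.exp u) := by gcongr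
            _ = L + (K + 1) * Real.exp u := by rw [← huL]; ring
            _ ≤ _ := by gcongr

end Mertens

namespace DirL

variable {q : ℕ} [Fact q.Prime]

lemma sum_range_eq_sum_zmod {M : Type*} [AddCommMonoid M] (f : ZMod q → M) :
    ∑ k ∈ Finset.range q, f (k : ZMod q) = ∑ a : ZMod q, f a := by
  refine Finset.sum_nbij' (fun k => (k : ZMod q)) (fun a => a.val) (by simp) ?_ ?_ (by simp)
    (by simp)
  · intro a _
    simpa using ZMod.val_lt a
  · intro k hk
    exact ZMod.val_cast_of_lt (by simpa using hk)

/-- Partial sums of a Dirichlet character. -/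
noncomputable def charSum (χ : DirichletCharacter ℂ q) (n : ℕ) : ℂ :=
  ∑ k ∈ Finset.Icc 1 n, χ (k : ZMod q)

lemma charSum_succ (χ : DirichletCharacter ℂ q) (n : ℕ) :
    charSum χ (n + 1) = charSum χ n + χ ((n + 1 : ℕ) : ZMod q) := by
  unfold charSum
  rw [Finset.sum_Icc_succ_top (by omega)]

lemma charSum_eq_range (χ : DirichletCharacter ℂ q) (n : ℕ) :
    charSum χ n = ∑ k ∈ Finset.range (n + 1), χ (k : ZMod q) := by
  induction n with
  | zero => simp [charSum, MulChar.map_zero]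
  | succ n ih => rw [charSum_succ, ih, Finset.sum_range_succ _ (n + 1)]

lemma charSum_add_period {χ : DirichletCharacter ℂ q} (hχ : χ ≠ 1) (n : ℕ) :
    charSum χ (n + q) = charSum χ n := by
  induction n with
  | zero =>
    rw [zero_add, charSum_eq_range, Finset.sum_range_succ, sum_range_eq_sum_zmod (fun a => χ a),
      MulChar.sum_eq_zero_of_ne_one hχ]
    simp [charSum, MulChar.map_zero]
  | succ n ih =>
    rw [add_right_comm, charSum_succ, ih, charSum_succ]
    push_cast
    simp

lemma norm_charSum_le {χ : DirichletCharacter ℂ q} (hχ : χ ≠ 1) (n : ℕ) :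
    ‖charSum χ n‖ ≤ q := by
  have hq : 0 < q := (Fact.out : q.Prime).pos
  have h1 : ∀ j, charSum χ (n % q + q * j) = charSum χ (n % q) := by
    intro j
    induction j with
    | zero => simp
    | succ j ih => rw [mul_add, mul_one, ← add_assoc, charSum_add_period hχ, ih]
  rw [← Nat.mod_add_div n q, h1]
  refine (norm_sum_le _ _).trans ?_
  calc _ ≤ ∑ k ∈ Finset.Icc 1 (n % q), (1 : ℝ) :=
        Finset.sum_le_sum fun k _ => DirichletCharacter.norm_le_one χ _
    _ ≤ q := by simp [(Nat.mod_lt n hq).le]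

lemma measurable_charSum_floor (χ : DirichletCharacter ℂ q) :
    Measurable fun t : ℝ => charSum χ ⌊t⌋₊ :=
  (measurable_from_nat (f := charSum χ)).comp Nat.measurable_floor

lemma charSum_floor_of_lt_one (χ : DirichletCharacter ℂ q) {t : ℝ} (ht : t < 1) :
    charSum χ ⌊t⌋₊ = 0 := by
  rw [Nat.floor_eq_zero.2 ht]; simp [charSum]

lemma integral_eq_mellin (χ : DirichletCharacter ℂ q) (s : ℂ) :
    ∫ t in Set.Ioi (1 : ℝ), charSum χ ⌊t⌋₊ * (t : ℂ) ^ (-(s + 1)) =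
      mellin (fun t : ℝ => charSum χ ⌊t⌋₊) (-s) := by
  unfold mellin
  have h : ∀ t : ℝ, (t : ℂ) ^ (-s - 1) • charSum χ ⌊t⌋₊ =
      charSum χ ⌊t⌋₊ * (t : ℂ) ^ (-(s + 1)) := fun t => by
    rw [smul_eq_mul, mul_comm, neg_add']
  simp only [h]
  symm
  refine setIntegral_eq_of_subset_of_ae_sdiff_eq_zero measurableSet_Ioi.nullMeasurableSet
    (Set.Ioi_subset_Ioi zero_le_one) ?_
  have : ∀ᵐ t : ℝ, t ≠ 1 := by
    rw [ae_iff]; simp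
  filter_upwards [this] with t ht1 ht
  have h1 : t ≤ 1 := by
    by_contra h; exact ht.2 (not_le.1 h)
  rw [charSum_floor_of_lt_one χ (lt_of_le_of_ne h1 ht1), zero_mul]

lemma differentiableAt_mellin {χ : DirichletCharacter ℂ q} (hχ : χ ≠ 1) {s : ℂ} (hs : s.re < 0) :
    DifferentiableAt ℂ (mellin (fun t : ℝ => charSum χ ⌊t⌋₊)) s := by
  refine mellin_differentiableAt_of_isBigO_rpow (a := 0) (b := s.re - 1) ?_ ?_ hs ?_ (by linarith)
  · refine LocallyIntegrable.locallyIntegrableOn ?_ _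
    refine (locallyIntegrable_const (q : ℝ)).mono
      (measurable_charSum_floor χ).aestronglyMeasurable ?_
    exact Filter.Eventually.of_forall fun t => (norm_charSum_le hχ _).trans (le_abs_self _)
  · refine Asymptotics.IsBigO.of_bound q (Filter.Eventually.of_forall fun t => ?_)
    simpa using norm_charSum_le hχ _
  · refine Asymptotics.IsBigO.of_bound 1 ?_
    have : ∀ᶠ t : ℝ in nhdsWithin 0 (Set.Ioi 0), t < 1 :=
      nhdsWithin_le_nhds (gt_mem_nhds one_pos)
    filter_upwards [this] with t ht
    rw [charSum_floor_of_lt_one χ ht]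
    simp

lemma LFunction_eq_mul_integral {χ : DirichletCharacter ℂ q} (hχ : χ ≠ 1) {s : ℂ}
    (hs : 0 < s.re) : DirichletCharacter.LFunction χ s =
      s * ∫ t in Set.Ioi (1 : ℝ), charSum χ ⌊t⌋₊ * (t : ℂ) ^ (-(s + 1)) := by
  rw [integral_eq_mellin]
  set U : Set ℂ := {s | 0 < s.re}
  have hU : IsOpen U := isOpen_lt continuous_const Complex.continuous_re
  have h1 : AnalyticOnNhd ℂ (DirichletCharacter.LFunction χ) U :=
    (DirichletCharacter.differentiable_LFunction hχ).differentiableOn.analyticOnNhd hU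
  have h2 : AnalyticOnNhd ℂ (fun s => s * mellin (fun t : ℝ => charSum χ ⌊t⌋₊) (-s)) U := by
    refine DifferentiableOn.analyticOnNhd (fun s hs => ?_) hU
    have hs : 0 < s.re := hs
    refine DifferentiableAt.differentiableWithinAt ?_
    refine differentiableAt_id.mul ?_
    exact (differentiableAt_mellin hχ (s := -s) (by simpa using hs)).comp s
      differentiableAt_id.neg
  have hpre : IsPreconnected U := (convex_halfSpace_re_gt 0).isPreconnected
  refine h1.eqOn_of_preconnected_of_eventuallyEq h2 hpre (z₀ := 2) (by simp [U]) ?_ hs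
  have : ∀ᶠ s : ℂ in nhds 2, 1 < s.re :=
    (isOpen_lt continuous_const Complex.continuous_re).mem_nhds (by simp)
  filter_upwards [this] with s hs
  rw [DirichletCharacter.LFunction_eq_LSeries χ hs, ← integral_eq_mellin]
  refine LSeries_eq_mul_integral _ (r := 0) le_rfl (by linarith)
    (DirichletCharacter.LSeriesSummable_of_one_lt_re χ hs) ?_
  refine Asymptotics.IsBigO.of_bound q (Filter.Eventually.of_forall fun n => ?_)
  simpa [charSum] using norm_charSum_le hχ n

lemma norm_LFunction_one_sub_le {χ : DirichletCharacter ℂ q} (hχ : χ ≠ 1) {X : ℕ} (hX : 1 ≤ X) :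
    ‖DirichletCharacter.LFunction χ 1 - ∑ n ∈ Finset.Icc 1 X, χ (n : ZMod q) / n‖ ≤
      2 * q / X := by
  have hXr : (1 : ℝ) ≤ X := by exact_mod_cast hX
  have hc0 : χ ((0 : ℕ) : ZMod q) = 0 := by simp [MulChar.map_zero]
  have hI : ∀ n : ℕ, ∑ k ∈ Finset.Icc 0 n, χ (k : ZMod q) = charSum χ n := fun n => by
    rw [charSum_eq_range, Nat.range_succ_eq_Icc_zero]
  have hderiv : ∀ t : ℝ, t ≠ 0 → HasDerivAt (fun t : ℝ => (t : ℂ)⁻¹) (-((t : ℂ) ^ 2)⁻¹) t := by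
    intro t ht
    have := (hasDerivAt_inv (𝕜 := ℂ) (x := (t : ℂ)) (by exact_mod_cast ht)).comp_ofReal
    exact this
  have hcongr : ∀ t ∈ Set.Ici (1 : ℝ), deriv (fun t : ℝ => (t : ℂ)⁻¹) t = -((t : ℂ) ^ 2)⁻¹ := by
    intro t ht
    have ht : (1 : ℝ) ≤ t := ht
    exact (hderiv t (by linarith)).deriv
  have habel := sum_mul_eq_sub_integral_mul₀' (𝕜 := ℂ) (fun k => χ (k : ZMod q))
    (f := fun t : ℝ => (t : ℂ)⁻¹) hc0 X
    (fun t ht => (hderiv t (by linarith [ht.1])).differentiableAt) (by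
      refine ContinuousOn.integrableOn_Icc ?_
      refine ContinuousOn.congr (f := fun t : ℝ => -((t : ℂ) ^ 2)⁻¹) ?_
        (fun t ht => hcongr t ht.1)
      refine ContinuousOn.neg (ContinuousOn.inv₀ (by fun_prop) fun t ht => ?_)
      have : (t : ℂ) ≠ 0 := by
        have := ht.1
        exact_mod_cast (by linarith : t ≠ 0)
      positivity)
  set g : ℝ → ℂ := fun t => charSum χ ⌊t⌋₊ * (t : ℂ) ^ (-((1 : ℂ) + 1)) with hg
  have hgn : ∀ t : ℝ, 0 < t → ‖g t‖ ≤ q * t ^ (-2 : ℝ) := fun t ht => by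
    rw [hg, norm_mul, Complex.norm_cpow_eq_rpow_re_of_pos ht]
    have : (-((1 : ℂ) + 1)).re = -2 := by simp; norm_num
    rw [this]
    gcongr
    exact norm_charSum_le hχ _
  have hgm : AEStronglyMeasurable g :=
    ((measurable_charSum_floor χ).mul (by fun_prop)).aestronglyMeasurable
  have hgi : ∀ c : ℝ, 0 < c → IntegrableOn g (Set.Ioi c) := fun c hc => by
    refine ((integrableOn_Ioi_rpow_of_lt (a := -2) (by norm_num) hc).const_mul (q : ℝ)).mono'
      hgm.restrict ?_
    refine (ae_restrict_iff' measurableSet_Ioi).2 (Filter.Eventually.of_forall fun t ht => ?_)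
    have ht : c < t := ht
    exact hgn t (by linarith)
  have hL := LFunction_eq_mul_integral hχ (s := 1) (by simp)
  rw [one_mul, ← Set.Ioc_union_Ioi_eq_Ioi hXr, setIntegral_union
    (Set.Ioc_disjoint_Ioi le_rfl) measurableSet_Ioi
    ((hgi 1 one_pos).mono_set Set.Ioc_subset_Ioi_self) (hgi X (by linarith))] at hL
  have hsum : ∑ n ∈ Finset.Icc 1 X, χ (n : ZMod q) / n =
      ∑ k ∈ Finset.Icc 0 X, (((k : ℕ) : ℝ) : ℂ)⁻¹ * χ (k : ZMod q) := by
    rw [← Nat.range_succ_eq_Icc_zero, Finset.range_eq_Ico, Finset.sum_eq_sum_Ico_succ_bot (by omega)]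
    rw [hc0, mul_zero, zero_add]
    refine Finset.sum_congr rfl fun n _ => ?_
    push_cast
    rw [div_eq_inv_mul]
  have hInt : ∫ t in Set.Ioc (1 : ℝ) X, deriv (fun t : ℝ => (t : ℂ)⁻¹) t *
      ∑ k ∈ Finset.Icc 0 ⌊t⌋₊, χ (k : ZMod q) = -∫ t in Set.Ioc (1 : ℝ) X, g t := by
    rw [← integral_neg]
    refine setIntegral_congr_fun measurableSet_Ioc fun t ht => ?_
    have h0 : (t : ℂ) ≠ 0 := by
      have := ht.1
      exact_mod_cast (by linarith : t ≠ 0)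
    change _ = - g t
    rw [hcongr t ht.1.le, hI, hg]
    have : (t : ℂ) ^ (-((1 : ℂ) + 1)) = ((t : ℂ) ^ 2)⁻¹ := by
      rw [Complex.cpow_neg]
      norm_num
    simp only [this]
    ring
  rw [hInt, hI] at habel
  rw [hsum, habel, hL]
  have h1 : ‖∫ t in Set.Ioi (X : ℝ), g t‖ ≤ q / X := by
    calc _ ≤ ∫ t in Set.Ioi (X : ℝ), q * t ^ (-2 : ℝ) := by
          refine norm_integral_le_of_norm_le
            ((integrableOn_Ioi_rpow_of_lt (a := -2) (by norm_num) (by linarith)).const_mul _) ?_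
          refine (ae_restrict_iff' measurableSet_Ioi).2 (Filter.Eventually.of_forall fun t ht => ?_)
          have ht : (X : ℝ) < t := ht
          exact hgn t (by linarith)
      _ = q / X := by
          rw [integral_const_mul, integral_Ioi_rpow_of_lt (by norm_num) (by linarith)]
          norm_num
          rw [Real.rpow_neg_one]
          ring
  have h2 : ‖((X : ℝ) : ℂ)⁻¹ * charSum χ X‖ ≤ q / X := by
    rw [norm_mul, norm_inv]
    have := norm_charSum_le hχ X
    simp only [Complex.norm_real, Real.norm_natCast]
    rw [inv_mul_eq_div]
    gcongr
  have e : (∫ t in Set.Ioc (1 : ℝ) X, g t) + (∫ t in Set.Ioi (X : ℝ), g t) -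
      (((X : ℝ) : ℂ)⁻¹ * charSum χ X - -∫ t in Set.Ioc (1 : ℝ) X, g t) =
      (∫ t in Set.Ioi (X : ℝ), g t) - ((X : ℝ) : ℂ)⁻¹ * charSum χ X := by ring
  rw [e]
  refine (norm_sub_le _ _).trans ?_
  rw [mul_div_assoc]
  linarith

lemma setIntegral_Ioi_add {E : Type*} [NormedAddCommGroup E] [NormedSpace ℝ E] (g : ℝ → E)
    (a k : ℝ) : ∫ t in Set.Ioi a, g (t + k) = ∫ t in Set.Ioi (a + k), g t := by
  have h := (measurePreserving_add_right (volume : Measure ℝ) k).setIntegral_preimage_emb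
    (measurableEmbedding_addRight k) g (Set.Ioi (a + k))
  rw [← h]
  congr 2
  ext t
  simp

lemma integrableOn_Ioi_add {E : Type*} [NormedAddCommGroup E] {g : ℝ → E}
    {a k : ℝ} (hg : IntegrableOn g (Set.Ioi (a + k))) :
    IntegrableOn (fun t => g (t + k)) (Set.Ioi a) := by
  have h := ((measurePreserving_add_right (volume : Measure ℝ) k).integrableOn_comp_preimage
    (measurableEmbedding_addRight k) (f := g) (s := Set.Ioi (a + k))).2 hg
  have e : Set.Ioi a = (fun x => x + k) ⁻¹' Set.Ioi (a + k) := by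
    ext t; simp
  rw [e]
  exact h

/-- Translating a bounded function changes its integral against `t ^ (-s-1)` boundedly. -/
lemma norm_integral_sub_shift_le {f : ℝ → ℂ} {B s k : ℝ} (hf : Measurable f)
    (hB : ∀ t, ‖f t‖ ≤ B) (hs : 0 < s) (hk : 0 ≤ k) :
    ‖(∫ t in Set.Ioi (1 : ℝ), f t * ((t ^ (-s - 1) : ℝ) : ℂ)) -
      ∫ t in Set.Ioi (1 : ℝ), f (t + k) * ((t ^ (-s - 1) : ℝ) : ℂ)‖ ≤ 2 * B * k := by
  have hB0 : 0 ≤ B := (norm_nonneg _).trans (hB 0)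
  set w : ℝ → ℝ := fun t => t ^ (-s - 1) with hw
  have hwm : Measurable w := by fun_prop
  have hwi : ∀ c : ℝ, 0 < c → IntegrableOn w (Set.Ioi c) := fun c hc =>
    integrableOn_Ioi_rpow_of_lt (by linarith) hc
  have hw0 : ∀ t, 1 < t → 0 ≤ w t := fun t ht => Real.rpow_nonneg (by linarith) _
  have hw1 : ∀ t, 1 < t → w t ≤ 1 := fun t ht =>
    Real.rpow_le_one_of_one_le_of_nonpos ht.le (by linarith)
  have hwk : ∀ t, 1 < t → w (t + k) ≤ w t := fun t ht =>
    Real.rpow_le_rpow_of_nonpos (by linarith) (by linarith) (by linarith)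
  have hfw : ∀ (F : ℝ → ℂ) (v : ℝ → ℝ), Measurable F → (∀ t, ‖F t‖ ≤ B) →
      IntegrableOn v (Set.Ioi 1) → IntegrableOn (fun t => F t * (v t : ℂ)) (Set.Ioi 1) := by
    intro F v hF hFB hv
    exact hv.ofReal.bdd_mul hF.aestronglyMeasurable (Filter.Eventually.of_forall hFB)
  have hk1 : (1 : ℝ) ≤ 1 + k := by linarith
  have hsplit : ∀ {E : Type} [NormedAddCommGroup E] [NormedSpace ℝ E] (g : ℝ → E),
      IntegrableOn g (Set.Ioi 1) → ∫ t in Set.Ioi (1 : ℝ), g t =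
        (∫ t in Set.Ioc (1 : ℝ) (1 + k), g t) + ∫ t in Set.Ioi (1 : ℝ), g (t + k) := by
    intro E _ _ g hg
    rw [setIntegral_Ioi_add, ← setIntegral_union (Set.Ioc_disjoint_Ioi le_rfl) measurableSet_Ioi
      (hg.mono_set Set.Ioc_subset_Ioi_self) (hg.mono_set (Set.Ioi_subset_Ioi hk1)),
      Set.Ioc_union_Ioi_eq_Ioi hk1]
  have hwsh : IntegrableOn (fun t => w (t + k)) (Set.Ioi 1) :=
    integrableOn_Ioi_add (hwi _ (by linarith))
  have hfk : Measurable fun t => f (t + k) := hf.comp (measurable_add_const k)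
  rw [hsplit _ (hfw f w hf hB (hwi 1 one_pos)), add_sub_assoc, ← integral_sub
    (hfw _ _ hfk (fun t => hB _) hwsh) (hfw _ _ hfk (fun t => hB _) (hwi 1 one_pos))]
  have hvol : (volume.restrict (Set.Ioc 1 (1 + k))).real Set.univ = k := by
    simp [Measure.real, hk]
  have h1 : ‖∫ t in Set.Ioc (1 : ℝ) (1 + k), f t * (w t : ℂ)‖ ≤ B * k := by
    have := norm_setIntegral_le_of_norm_le_const (μ := volume) (s := Set.Ioc (1 : ℝ) (1 + k))
      (f := fun t => f t * (w t : ℂ)) (C := B) (by simp) (fun t ht => by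
        rw [norm_mul, Complex.norm_real, Real.norm_of_nonneg (hw0 t ht.1)]
        calc _ ≤ B * 1 := mul_le_mul (hB t) (hw1 t ht.1) (hw0 t ht.1) hB0
          _ = B := mul_one B)
    simpa [Measure.real, hk] using this
  have h2 : ‖∫ t in Set.Ioi (1 : ℝ), (f (t + k) * (w (t + k) : ℂ) - f (t + k) * (w t : ℂ))‖ ≤
      B * k := by
    calc _ ≤ ∫ t in Set.Ioi (1 : ℝ), B * (w t - w (t + k)) := by
          refine norm_integral_le_of_norm_le (((hwi 1 one_pos).sub hwsh).const_mul _) ?_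
          refine (ae_restrict_iff' measurableSet_Ioi).2 (Filter.Eventually.of_forall fun t ht => ?_)
          rw [← mul_sub, norm_mul, ← Complex.ofReal_sub, Complex.norm_real, Real.norm_eq_abs,
            abs_sub_comm, abs_of_nonneg (sub_nonneg.2 (hwk t ht))]
          exact mul_le_mul_of_nonneg_right (hB _) (sub_nonneg.2 (hwk t ht))
      _ = B * ∫ t in Set.Ioc (1 : ℝ) (1 + k), w t := by
          rw [integral_const_mul, integral_sub (hwi 1 one_pos) hwsh, hsplit w (hwi 1 one_pos)]
          ring
      _ ≤ B * k := by
          gcongr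
          have := norm_setIntegral_le_of_norm_le_const (μ := volume)
            (s := Set.Ioc (1 : ℝ) (1 + k)) (f := w) (C := 1) (by simp) (fun t ht => by
              rw [Real.norm_of_nonneg (hw0 t ht.1)]; exact hw1 t ht.1)
          refine (le_abs_self _).trans ?_
          simpa [Measure.real, hk] using this
  refine (norm_add_le _ _).trans ?_
  linarith

lemma sum_charSum_add {χ : DirichletCharacter ℂ q} (hχ : χ ≠ 1) (n : ℕ) :
    ∑ k ∈ Finset.range q, charSum χ (n + k) = ∑ k ∈ Finset.range q, charSum χ k := by
  induction n with
  | zero => simp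
  | succ n ih =>
    rw [← ih]
    have h1 := Finset.sum_range_succ (fun k => charSum χ (n + k)) q
    have h2 := Finset.sum_range_succ' (fun k => charSum χ (n + k)) q
    rw [h1, charSum_add_period hχ, add_zero] at h2
    have h3 := add_right_cancel h2
    rw [h3]
    exact Finset.sum_congr rfl fun k _ => by rw [add_assoc, add_comm 1 k]

lemma sum_charSum_range {χ : DirichletCharacter ℂ q} (hχ : χ ≠ 1) :
    ∑ k ∈ Finset.range q, charSum χ k = -∑ a : ZMod q, χ a * (a.val : ℂ) := by
  have h : ∀ n : ℕ, ∑ k ∈ Finset.range n, charSum χ k =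
      ∑ k ∈ Finset.range n, ((n : ℂ) - k) * χ (k : ZMod q) := by
    intro n
    induction n with
    | zero => simp
    | succ n ih =>
      rw [Finset.sum_range_succ, ih, charSum_eq_range, Finset.sum_range_succ, Finset.sum_range_succ,
        ← add_assoc, ← Finset.sum_add_distrib]
      push_cast
      congr 1
      · exact Finset.sum_congr rfl fun k _ => by ring
      · ring
  rw [h, ← sum_range_eq_sum_zmod, ← Finset.sum_neg_distrib]
  have h0 : ∑ k ∈ Finset.range q, (q : ℂ) * χ (k : ZMod q) = 0 := by
    rw [← Finset.mul_sum, sum_range_eq_sum_zmod (fun a => χ a), MulChar.sum_eq_zero_of_ne_one hχ,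
      mul_zero]
  rw [← sub_zero (∑ k ∈ Finset.range q, ((q : ℂ) - k) * χ (k : ZMod q)), ← h0,
    ← Finset.sum_sub_distrib]
  refine Finset.sum_congr rfl fun k hk => ?_
  rw [ZMod.val_cast_of_lt (by simpa using hk)]
  ring

/-- The centred sawtooth on residues. -/
noncomputable def bz (a : ZMod q) : ℝ := (a.val : ℝ) / q - 1 / 2

theorem LFunction_zero {χ : DirichletCharacter ℂ q} (hχ : χ ≠ 1) :
    DirichletCharacter.LFunction χ 0 = -∑ a : ZMod q, χ a * (bz a : ℂ) := by
  have hq : (0 : ℝ) < q := by exact_mod_cast (Fact.out : q.Prime).pos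
  set m := ∑ k ∈ Finset.range q, charSum χ k with hm
  have hbound : ∀ s : ℝ, 0 < s →
      ‖q * DirichletCharacter.LFunction χ (s : ℂ) - m‖ ≤ 2 * q ^ 3 * s := by
    intro s hs
    have hL := LFunction_eq_mul_integral hχ (s := (s : ℂ)) (by simpa using hs)
    have hcp : ∫ t in Set.Ioi (1 : ℝ), charSum χ ⌊t⌋₊ * (t : ℂ) ^ (-((s : ℂ) + 1)) =
        ∫ t in Set.Ioi (1 : ℝ), charSum χ ⌊t⌋₊ * ((t ^ (-s - 1) : ℝ) : ℂ) := by
      refine setIntegral_congr_fun measurableSet_Ioi fun t ht => ?_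
      have ht : (1 : ℝ) < t := ht
      rw [Complex.ofReal_cpow (by linarith)]
      push_cast
      ring_nf
    rw [hcp] at hL
    set I := ∫ t in Set.Ioi (1 : ℝ), charSum χ ⌊t⌋₊ * ((t ^ (-s - 1) : ℝ) : ℂ)
    have hshift : ∀ k : ℕ, ‖I - ∫ t in Set.Ioi (1 : ℝ), charSum χ (⌊t⌋₊ + k) *
        ((t ^ (-s - 1) : ℝ) : ℂ)‖ ≤ 2 * q * k := by
      intro k
      have := norm_integral_sub_shift_le (k := k) (measurable_charSum_floor χ)
        (fun t => norm_charSum_le hχ _) hs (by positivity)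
      refine le_trans (le_of_eq ?_) this
      congr 2
      refine setIntegral_congr_fun measurableSet_Ioi fun t ht => ?_
      have ht : (1 : ℝ) < t := ht
      rw [Nat.floor_add_natCast (by linarith)]
    have hInt : ∀ k : ℕ, IntegrableOn (fun t : ℝ => charSum χ (⌊t⌋₊ + k) *
        ((t ^ (-s - 1) : ℝ) : ℂ)) (Set.Ioi 1) := fun k => by
      refine Integrable.bdd_mul (c := q)
        (integrableOn_Ioi_rpow_of_lt (by linarith) one_pos).ofReal ?_
        (Filter.Eventually.of_forall fun t => norm_charSum_le hχ _)
      exact ((measurable_from_nat (f := fun n => charSum χ (n + k))).comp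
        Nat.measurable_floor).aestronglyMeasurable
    have hsum : ∑ k ∈ Finset.range q, ∫ t in Set.Ioi (1 : ℝ), charSum χ (⌊t⌋₊ + k) *
        ((t ^ (-s - 1) : ℝ) : ℂ) = m / s := by
      rw [← integral_finsetSum _ fun k _ => hInt k]
      simp only [← Finset.sum_mul, sum_charSum_add hχ]
      rw [integral_const_mul, integral_complex_ofReal, integral_Ioi_rpow_of_lt (by linarith) one_pos]
      simp
      ring
    have h1 : ‖(q : ℂ) * I - m / s‖ ≤ 2 * q ^ 3 := by
      rw [← hsum]
      have : (q : ℂ) * I = ∑ k ∈ Finset.range q, I := by simp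
      rw [this, ← Finset.sum_sub_distrib]
      refine (norm_sum_le _ _).trans ?_
      calc _ ≤ ∑ k ∈ Finset.range q, 2 * (q : ℝ) * q := by
            refine Finset.sum_le_sum fun k hk => (hshift k).trans ?_
            have : (k : ℝ) ≤ q := by exact_mod_cast (Finset.mem_range.1 hk).le
            gcongr
        _ = 2 * q ^ 3 := by simp; ring
    have hs0 : (s : ℂ) ≠ 0 := by exact_mod_cast hs.ne'
    have e : q * DirichletCharacter.LFunction χ (s : ℂ) - m = s * ((q : ℂ) * I - m / s) := by
      rw [hL]; field_simp
    rw [e, norm_mul, Complex.norm_real, Real.norm_of_nonneg hs.le]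
    nlinarith
  have hlim : Filter.Tendsto (fun s : ℝ => ‖q * DirichletCharacter.LFunction χ (s : ℂ) - m‖)
      (nhdsWithin 0 (Set.Ioi 0)) (nhds ‖q * DirichletCharacter.LFunction χ 0 - m‖) := by
    have hc : Continuous fun s : ℝ => ‖q * DirichletCharacter.LFunction χ (s : ℂ) - m‖ := by
      have := (DirichletCharacter.differentiable_LFunction hχ).continuous
      fun_prop
    have := hc.tendsto 0
    rw [Complex.ofReal_zero] at this
    exact this.mono_left nhdsWithin_le_nhds
  have hlim2 : Filter.Tendsto (fun s : ℝ => 2 * (q : ℝ) ^ 3 * s)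
      (nhdsWithin 0 (Set.Ioi 0)) (nhds 0) := by
    have hc : Continuous fun s : ℝ => 2 * (q : ℝ) ^ 3 * s := by fun_prop
    have := hc.tendsto 0
    rw [mul_zero] at this
    exact this.mono_left nhdsWithin_le_nhds
  have h0 : ‖q * DirichletCharacter.LFunction χ 0 - m‖ ≤ 0 :=
    le_of_tendsto_of_tendsto hlim hlim2 (by
      filter_upwards [self_mem_nhdsWithin] with s hs
      exact hbound s hs)
  have h1 : q * DirichletCharacter.LFunction χ 0 = m := by
    rwa [norm_le_zero_iff, sub_eq_zero] at h0
  have hq0 : (q : ℂ) ≠ 0 := by exact_mod_cast hq.ne'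
  rw [sum_charSum_range hχ] at hm
  have h2 : ∑ a : ZMod q, χ a * (bz a : ℂ) = (∑ a : ZMod q, χ a * (a.val : ℂ)) / q := by
    have : ∑ a : ZMod q, χ a * (bz a : ℂ) = ∑ a : ZMod q, (χ a * (a.val : ℂ) / q -
        χ a * (1 / 2)) := Finset.sum_congr rfl fun a _ => by
      unfold bz; push_cast; ring
    rw [this, Finset.sum_sub_distrib, ← Finset.sum_mul, MulChar.sum_eq_zero_of_ne_one hχ, zero_mul,
      sub_zero, Finset.sum_div]
  rw [h2, ← mul_right_inj' hq0, h1, hm]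
  field_simp

/-- The multiplicative weight `∏_{p ∣ n} 1 / (p - 2)`, supported on odd squarefree integers. -/
noncomputable def hw (n : ℕ) : ℝ :=
  if Odd n ∧ Squarefree n then ∏ p ∈ n.primeFactors, (1 / ((p : ℝ) - 2)) else 0

/-- Prime power values of the convolution inverse factor of `n ↦ n * hw n`. -/
noncomputable def gloc (p e : ℕ) : ℝ :=
  if p = 2 then (if e = 1 then -1 else if e = 0 then 1 else 0)
  else if e = 0 then 1 else if e = 1 then 2 / ((p : ℝ) - 2)
    else if e = 2 then -p / ((p : ℝ) - 2) else 0

/-- The multiplicative function `g` with `∑_{d ∣ n} g d = n * hw n`. -/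
noncomputable def gfun : ArithmeticFunction ℝ :=
  ⟨fun n => if n = 0 then 0 else n.factorization.prod gloc, by simp⟩

lemma gfun_apply {n : ℕ} (hn : n ≠ 0) : gfun n = n.factorization.prod gloc := by
  simp [gfun, hn]

lemma gfun_one : gfun 1 = 1 := by simp [gfun_apply]

lemma gfun_mul {m n : ℕ} (h : m.Coprime n) : gfun (m * n) = gfun m * gfun n := by
  rcases eq_or_ne m 0 with rfl | hm
  · simp
  rcases eq_or_ne n 0 with rfl | hn
  · simp
  rw [gfun_apply hm, gfun_apply hn, gfun_apply (mul_ne_zero hm hn),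
    Nat.factorization_mul_of_coprime h, Finsupp.prod_add_index_of_disjoint]
  simpa using h.disjoint_primeFactors

lemma gloc_zero (p : ℕ) : gloc p 0 = 1 := by simp [gloc]

lemma gfun_prime_pow {p : ℕ} (hp : p.Prime) (e : ℕ) : gfun (p ^ e) = gloc p e := by
  rw [gfun_apply (pow_ne_zero _ hp.ne_zero), hp.factorization_pow,
    Finsupp.prod_single_index (gloc_zero p)]

lemma gloc_of_three_le (p : ℕ) {e : ℕ} (he : 3 ≤ e) : gloc p e = 0 := by
  have h0 : e ≠ 0 := by omega
  have h1 : e ≠ 1 := by omega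
  have h2 : e ≠ 2 := by omega
  simp [gloc, h0, h1, h2]

lemma isMultiplicative_gfun : gfun.IsMultiplicative :=
  ⟨gfun_one, fun h => gfun_mul h⟩

lemma hw_zero : hw 0 = 0 := by simp [hw]

lemma hw_one : hw 1 = 1 := by simp [hw]

lemma hw_mul {m n : ℕ} (h : m.Coprime n) : hw (m * n) = hw m * hw n := by
  unfold hw
  simp only [Nat.squarefree_mul h, Nat.odd_mul, h.primeFactors_mul,
    Finset.prod_union h.disjoint_primeFactors]
  by_cases h1 : Odd m ∧ Squarefree m
  · by_cases h2 : Odd n ∧ Squarefree n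
    · rw [if_pos h1, if_pos h2, if_pos ⟨⟨h1.1, h2.1⟩, h1.2, h2.2⟩]
    · rw [if_neg h2, if_neg (fun h => h2 ⟨h.1.2, h.2.2⟩), mul_zero]
  · rw [if_neg h1, if_neg (fun h => h1 ⟨h.1.1, h.2.1⟩), zero_mul]

lemma hw_nonneg (n : ℕ) : 0 ≤ hw n := by
  unfold hw
  split_ifs with h
  · refine Finset.prod_nonneg fun p hp => ?_
    have h2 : 2 ≤ p := (Nat.prime_of_mem_primeFactors hp).two_le
    have : (2 : ℝ) ≤ p := by exact_mod_cast h2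
    exact div_nonneg zero_le_one (by linarith)
  · exact le_rfl

lemma hw_prime {p : ℕ} (hp : p.Prime) (hp2 : p ≠ 2) : hw p = 1 / ((p : ℝ) - 2) := by
  simp [hw, hp.odd_of_ne_two hp2, hp.prime.squarefree, hp.primeFactors]

/-- The arithmetic function `n ↦ n * hw n`. -/
noncomputable def nhw : ArithmeticFunction ℝ := ⟨fun n => n * hw n, by simp⟩

lemma isMultiplicative_nhw : nhw.IsMultiplicative :=
  ⟨by simp [nhw, hw_one], fun {m n} h => by simp [nhw, hw_mul h]; ring⟩

lemma two_lt_of_prime {p : ℕ} (hp : p.Prime) (h2 : p ≠ 2) : (3 : ℝ) ≤ p := by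
  have : 3 ≤ p := by have := hp.two_le; omega
  exact_mod_cast this

theorem sum_divisors_gfun (n : ℕ) : ∑ d ∈ n.divisors, gfun d = n * hw n := by
  have h : gfun * (ArithmeticFunction.zeta : ArithmeticFunction ℝ) = nhw := by
    rw [(isMultiplicative_gfun.mul ArithmeticFunction.isMultiplicative_zeta.natCast
      ).eq_iff_eq_on_prime_powers _ _ isMultiplicative_nhw]
    intro p k hp
    rw [ArithmeticFunction.coe_mul_zeta_apply, Nat.sum_divisors_prime_pow hp]
    simp only [gfun_prime_pow hp]
    have hn : nhw (p ^ k) = ((p ^ k : ℕ) : ℝ) * hw (p ^ k) := rfl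
    rw [hn]
    rcases k with _ | _ | k
    · simp [gloc, hw_one]
    · by_cases h2 : p = 2
      · subst h2; simp [gloc, Finset.sum_range_succ, hw, Nat.not_odd_iff_even]
      · have := two_lt_of_prime hp h2
        have : (p : ℝ) - 2 ≠ 0 := by linarith
        simp [gloc, Finset.sum_range_succ, h2, hw_prime hp h2]
        field_simp
        ring
    · have hz : hw (p ^ (k + 1 + 1)) = 0 := by
        unfold hw
        rw [if_neg]
        rintro ⟨-, h⟩
        have := (Nat.squarefree_iff_prime_squarefree.1 h) p hp
        exact this ⟨p ^ k, by ring⟩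
      rw [hz, mul_zero]
      have e : ∑ x ∈ Finset.range (k + 1 + 1 + 1), gloc p x = ∑ x ∈ Finset.range 3, gloc p x := by
        symm
        refine Finset.sum_subset (Finset.range_subset_range.2 (by omega)) fun x _ hx => ?_
        exact gloc_of_three_le p (by simpa using hx)
      rw [e]
      by_cases h2 : p = 2
      · subst h2; simp [gloc, Finset.sum_range_succ]
      · have := two_lt_of_prime hp h2
        have : (p : ℝ) - 2 ≠ 0 := by linarith
        simp [gloc, Finset.sum_range_succ, h2]
        field_simp
        ring
  rw [← ArithmeticFunction.coe_mul_zeta_apply, h]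
  rfl

lemma tsum_three {E : Type*} [AddCommMonoid E] [TopologicalSpace E] {f : ℕ → E}
    (h : ∀ e, 3 ≤ e → f e = 0) : ∑' e, f e = f 0 + f 1 + f 2 := by
  rw [tsum_eq_sum (s := Finset.range 3) (fun e he => h e (by simpa using he))]
  simp [Finset.sum_range_succ]

theorem summable_gfun : Summable fun d : ℕ => |gfun d| * (d : ℝ) ^ (-(2 / 3 : ℝ)) := by
  set f : ℕ → ℝ := fun d => |gfun d| * (d : ℝ) ^ (-(2 / 3 : ℝ)) with hf
  have hf0 : ∀ n, 0 ≤ f n := fun n => by positivity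
  have hpp : ∀ {p : ℕ}, p.Prime → ∀ e, 3 ≤ e → f (p ^ e) = 0 := fun hp e he => by
    simp [hf, gfun_prime_pow hp, gloc_of_three_le _ he]
  have hS : Summable fun n : ℕ => 9 * (n : ℝ) ^ (-(4 / 3 : ℝ)) :=
    (Real.summable_nat_rpow.2 (by norm_num)).mul_left 9
  have hS0 : ∀ n : ℕ, 0 ≤ 9 * (n : ℝ) ^ (-(4 / 3 : ℝ)) := fun n => by positivity
  have hloc : ∀ {p : ℕ}, p.Prime → ∑' e, f (p ^ e) ≤ Real.exp (9 * (p : ℝ) ^ (-(4 / 3 : ℝ))) := by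
    intro p hp
    refine le_trans ?_ (Real.add_one_le_exp _)
    rw [tsum_three (hpp hp)]
    have hp0 : (0 : ℝ) < p := by exact_mod_cast hp.pos
    have e1 : f (p ^ 1) = |gloc p 1| * (p : ℝ) ^ (-(2 / 3 : ℝ)) := by
      simp [hf, ← gfun_prime_pow hp 1]
    have e2 : f (p ^ 2) = |gloc p 2| * (p : ℝ) ^ (-(4 / 3 : ℝ)) := by
      simp only [hf, gfun_prime_pow hp]
      push_cast
      rw [← Real.rpow_natCast, ← Real.rpow_mul hp0.le]
      norm_num
    have e0 : f (p ^ 0) = 1 := by simp [hf, gfun_one]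
    have e3 : (p : ℝ) ^ (-(2 / 3 : ℝ)) = (p : ℝ) ^ (-(4 / 3 : ℝ)) * (p : ℝ) ^ (2 / 3 : ℝ) := by
      rw [← Real.rpow_add hp0]; norm_num
    rw [e0, e1, e2, e3]
    have hu : 0 < (p : ℝ) ^ (-(4 / 3 : ℝ)) := Real.rpow_pos_of_pos hp0 _
    have hv : (p : ℝ) ^ (2 / 3 : ℝ) ≤ p := by
      have h1 : (1 : ℝ) ≤ p := by exact_mod_cast hp.one_le
      calc _ ≤ (p : ℝ) ^ (1 : ℝ) := Real.rpow_le_rpow_of_exponent_le h1 (by norm_num)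
        _ = p := Real.rpow_one _
    have key : |gloc p 1| * (p : ℝ) ^ (2 / 3 : ℝ) + |gloc p 2| ≤ 9 := by
      by_cases h2 : p = 2
      · subst h2
        simp [gloc]
        have : ((2 : ℕ) : ℝ) = 2 := by norm_num
        rw [this] at hv
        linarith
      · have h3 := two_lt_of_prime hp h2
        have h4 : (0 : ℝ) < p - 2 := by linarith
        have a1 : |gloc p 1| = 2 / ((p : ℝ) - 2) := by
          simp [gloc, h2, abs_div, abs_of_pos h4]
        have a2 : |gloc p 2| = p / ((p : ℝ) - 2) := by
          simp [gloc, h2, abs_div, abs_of_pos h4]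
        rw [a1, a2]
        calc _ ≤ 2 / ((p : ℝ) - 2) * p + p / ((p : ℝ) - 2) := by gcongr
          _ = 3 * p / ((p : ℝ) - 2) := by ring
          _ ≤ 9 := by rw [div_le_iff₀ h4]; linarith
    nlinarith
  refine summable_of_sum_range_le (c := Real.exp (∑' n : ℕ, 9 * (n : ℝ) ^ (-(4 / 3 : ℝ)))) hf0
    fun N => ?_
  obtain ⟨hs1, hs2⟩ := EulerProduct.summable_and_hasSum_smoothNumbers_prod_primesBelow_tsum
    (f := f) (by simp [hf, gfun_one]) (fun {m n} h => by
      simp only [hf, gfun_mul h, abs_mul, Nat.cast_mul]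
      rw [Real.mul_rpow (by positivity) (by positivity)]; ring)
    (fun {p} hp => summable_of_ne_finset_zero (s := Finset.range 3) fun e he => by
      rw [hpp hp e (by simpa using he), norm_zero]) N
  calc ∑ n ∈ Finset.range N, f n = ∑ n ∈ (Finset.range N).erase 0, f n := by
        symm
        refine Finset.sum_subset (Finset.erase_subset _ _) fun x hx hx' => ?_
        have : x = 0 := by
          by_contra h; exact hx' (Finset.mem_erase.2 ⟨h, hx⟩)
        simp [this, hf]
    _ ≤ ∏ p ∈ N.primesBelow, ∑' (n : ℕ), f (p ^ n) := by
        have hmem : ∀ n ∈ (Finset.range N).erase 0, n ∈ Nat.smoothNumbers N := fun n hn => by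
          rw [Finset.mem_erase, Finset.mem_range] at hn
          exact Nat.mem_smoothNumbers_of_lt (Nat.pos_of_ne_zero hn.1) hn.2
        rw [← hs2.tsum_eq, ← Finset.sum_subtype_of_mem f hmem]
        exact hs2.summable.sum_le_tsum _ fun i _ => hf0 _
    _ ≤ ∏ p ∈ N.primesBelow, Real.exp (9 * (p : ℝ) ^ (-(4 / 3 : ℝ))) :=
        Finset.prod_le_prod (fun p _ => tsum_nonneg fun _ => hf0 _) fun p hp =>
          hloc (Nat.prime_of_mem_primesBelow hp)
    _ = Real.exp (∑ p ∈ N.primesBelow, 9 * (p : ℝ) ^ (-(4 / 3 : ℝ))) := (Real.exp_sum _ _).symm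
    _ ≤ _ := Real.exp_le_exp.2 (hS.sum_le_tsum _ fun n _ => hS0 n)

/-- Local factor of the twin-prime type constant. -/
noncomputable def cfac (q p : ℕ) : ℝ := if p = 2 ∨ p ∣ q then 1 else 1 - 1 / ((p : ℝ) - 1) ^ 2

/-- The twin-prime type constant with the factors at `2` and at divisors of `q` removed. -/
noncomputable def C2 (q : ℕ) : ℝ := ∏' p : Nat.Primes, cfac q p

lemma abs_cfac_sub_one_le (q : ℕ) (p : Nat.Primes) : |cfac q p - 1| ≤ 4 * ((p : ℕ) : ℝ) ^ (-2 : ℝ) := by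
  have hp0 : (0 : ℝ) < (p : ℕ) := by exact_mod_cast p.2.pos
  have hr : ((p : ℕ) : ℝ) ^ (-2 : ℝ) = (((p : ℕ) : ℝ) ^ 2)⁻¹ := by
    rw [Real.rpow_neg hp0.le]; norm_num
  rw [hr]
  unfold cfac
  split_ifs with h
  · simp
  · have h3 := two_lt_of_prime p.2 (fun h' => h (Or.inl h'))
    have h1 : (0 : ℝ) < (p : ℕ) - 1 := by linarith
    rw [show 1 - 1 / (((p : ℕ) : ℝ) - 1) ^ 2 - 1 = -(1 / (((p : ℕ) : ℝ) - 1) ^ 2) by ring,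
      abs_neg, abs_of_pos (by positivity), div_le_iff₀ (by positivity), mul_assoc, mul_comm,
      mul_assoc, inv_mul_eq_div, le_div_iff₀ (by positivity)]
    nlinarith

lemma cfac_bounds (q : ℕ) {p : ℕ} (hp : p.Prime) : 0 < cfac q p ∧ cfac q p ≤ 1 := by
  unfold cfac
  split_ifs with h
  · norm_num
  · have h3 := two_lt_of_prime hp (fun h' => h (Or.inl h'))
    constructor
    · rw [sub_pos, div_lt_one (by nlinarith)]
      nlinarith
    · have : 0 ≤ 1 / ((p : ℝ) - 1) ^ 2 := by positivity
      linarith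

lemma hasProd_cfac (q : ℕ) : HasProd (fun p : Nat.Primes => cfac q p) (C2 q) := by
  have hs : Summable fun p : Nat.Primes => cfac q p - 1 := by
    refine Summable.of_norm_bounded (g := fun p : Nat.Primes => 4 * ((p : ℕ) : ℝ) ^ (-2 : ℝ))
      ((Nat.Primes.summable_rpow.2 (by norm_num)).mul_left 4) (abs_cfac_sub_one_le q)
  have := (Real.multipliable_one_add_of_summable hs).hasProd
  simpa [C2] using this

lemma C2_le_prod (q : ℕ) (s : Finset Nat.Primes) : C2 q ≤ ∏ p ∈ s, cfac q p := by
  refine le_of_tendsto (hasProd_cfac q) ?_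
  filter_upwards [Filter.eventually_ge_atTop s] with t ht
  rw [← Finset.prod_sdiff ht]
  exact mul_le_of_le_one_left (Finset.prod_nonneg fun p _ => (cfac_bounds q p.2).1.le)
    (Finset.prod_le_one (fun p _ => (cfac_bounds q p.2).1.le) fun p _ => (cfac_bounds q p.2).2)

lemma C2_nonneg (q : ℕ) : 0 ≤ C2 q :=
  ge_of_tendsto' (hasProd_cfac q) fun _ => Finset.prod_nonneg fun p _ => (cfac_bounds q p.2).1.le

lemma C2_le_one (q : ℕ) : C2 q ≤ 1 := by simpa using C2_le_prod q ∅

lemma one_sub_sum_le_prod {ι : Type*} (s : Finset ι) (a : ι → ℝ) (h : ∀ i, a i ≤ 1)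
    (h1 : ∀ i, 0 ≤ a i) : 1 - ∑ i ∈ s, (1 - a i) ≤ ∏ i ∈ s, a i := by
  induction s using Finset.induction_on with
  | empty => simp
  | insert i s hi ih =>
    rw [Finset.sum_insert hi, Finset.prod_insert hi]
    have hp1 : ∏ i ∈ s, a i ≤ 1 := Finset.prod_le_one (fun i _ => h1 i) fun i _ => h i
    nlinarith [h i, h1 i]

lemma sum_inv_sq_le (y : ℕ) (hy : 3 ≤ y) (B : ℕ) :
    ∑ n ∈ Finset.Ico y B, 1 / ((n : ℝ) - 1) ^ 2 ≤ 1 / ((y : ℝ) - 2) := by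
  rcases le_total B y with h | h
  · rw [Finset.Ico_eq_empty_of_le h, Finset.sum_empty]
    have : (3 : ℝ) ≤ y := by exact_mod_cast hy
    exact div_nonneg zero_le_one (by linarith)
  have key : ∑ n ∈ Finset.Ico y B, 1 / ((n : ℝ) - 1) ^ 2 ≤ 1 / ((y : ℝ) - 2) - 1 / ((B : ℝ) - 2) := by
    induction B, h using Nat.le_induction with
    | base => simp
    | succ n hn ih =>
      rw [Finset.sum_Ico_succ_top hn]
      have h3 : (3 : ℝ) ≤ n := by exact_mod_cast hy.trans hn
      have h1 : (0 : ℝ) < n - 1 := by linarith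
      have h2 : (0 : ℝ) < n - 2 := by linarith
      have h4 : 1 / ((n : ℝ) - 1) ^ 2 ≤ 1 / ((n : ℝ) - 2) - 1 / (((n + 1 : ℕ) : ℝ) - 2) := by
        push_cast
        rw [show (n : ℝ) + 1 - 2 = n - 1 by ring, div_sub_div _ _ h2.ne' h1.ne',
          div_le_div_iff₀ (by positivity) (by positivity)]
        nlinarith
      linarith
  have h3 : (3 : ℝ) ≤ B := by exact_mod_cast hy.trans h
  have : 0 ≤ 1 / ((B : ℝ) - 2) := div_nonneg zero_le_one (by linarith)
  linarith

lemma exists_finset_primes (y : ℕ) : ∃ s : Finset Nat.Primes, (∀ p, p ∈ s ↔ (p : ℕ) < y) ∧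
    ∀ f : ℕ → ℝ, ∏ p ∈ s, f p = ∏ p ∈ y.primesBelow, f p := by
  refine ⟨y.primesBelow.attach.map ⟨fun p : y.primesBelow => (⟨p.1, Nat.prime_of_mem_primesBelow p.2⟩ : Nat.Primes),
    fun a b h => Subtype.ext (congrArg (fun p : Nat.Primes => (p : ℕ)) h)⟩, fun p => ?_,
    fun f => ?_⟩
  · simp only [Finset.mem_map, Finset.mem_attach, true_and, Subtype.exists, Nat.mem_primesBelow]
    constructor
    · rintro ⟨a, ⟨ha, _⟩, rfl⟩; exact ha
    · intro h; exact ⟨p, ⟨h, p.2⟩, rfl⟩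
  · rw [Finset.prod_map]
    exact Finset.prod_attach y.primesBelow f

lemma C2_le_prod_primesBelow (q y : ℕ) : C2 q ≤ ∏ p ∈ y.primesBelow, cfac q p := by
  obtain ⟨s, -, hs⟩ := exists_finset_primes y
  exact hs (cfac q) ▸ C2_le_prod q s

/-- `C2 q` is at least the partial product over primes below `y` times `1 - 1 / (y - 2)`. -/
lemma prod_mul_le_C2 (q : ℕ) {y : ℕ} (hy : 3 ≤ y) :
    (∏ p ∈ y.primesBelow, cfac q p) * (1 - 1 / ((y : ℝ) - 2)) ≤ C2 q := by
  obtain ⟨s, hsmem, hsprod⟩ := exists_finset_primes y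
  refine ge_of_tendsto (hasProd_cfac q) ?_
  filter_upwards [Filter.eventually_ge_atTop s] with t ht
  rw [← Finset.prod_sdiff ht, mul_comm, hsprod (cfac q)]
  refine mul_le_mul_of_nonneg_right ?_
    (Finset.prod_nonneg fun p hp => (cfac_bounds q (Nat.prime_of_mem_primesBelow hp)).1.le)
  refine le_trans ?_ (one_sub_sum_le_prod (t \ s) (fun p => cfac q p)
    (fun p => (cfac_bounds q p.2).2) fun p => (cfac_bounds q p.2).1.le)
  refine sub_le_sub_left ?_ 1
  obtain ⟨B, hB⟩ : ∃ B, ∀ p ∈ t \ s, (p : ℕ) < B := by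
    obtain ⟨B, hB⟩ := ((t \ s).image fun p : Nat.Primes => (p : ℕ)).exists_nat_subset_range
    exact ⟨B, fun p hp => by simpa using hB (Finset.mem_image_of_mem _ hp)⟩
  refine le_trans ?_ (sum_inv_sq_le y hy B)
  have hinj : Set.InjOn (fun p : Nat.Primes => (p : ℕ)) (t \ s : Finset Nat.Primes) :=
    fun a _ b _ h => Subtype.ext h
  calc ∑ p ∈ t \ s, (1 - cfac q p) ≤ ∑ p ∈ t \ s, 1 / (((p : ℕ) : ℝ) - 1) ^ 2 := by
        refine Finset.sum_le_sum fun p _ => ?_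
        unfold cfac
        split_ifs
        · rw [sub_self]; positivity
        · linarith
    _ = ∑ n ∈ (t \ s).image (fun p : Nat.Primes => (p : ℕ)), 1 / ((n : ℝ) - 1) ^ 2 :=
        (Finset.sum_image (f := fun n : ℕ => 1 / ((n : ℝ) - 1) ^ 2) hinj).symm
    _ ≤ _ := by
        refine Finset.sum_le_sum_of_subset_of_nonneg ?_ fun _ _ _ => by positivity
        intro n hn
        obtain ⟨p, hp, rfl⟩ := Finset.mem_image.1 hn
        have := (hsmem p).not.1 (Finset.mem_sdiff.1 hp).2
        exact Finset.mem_Ico.2 ⟨not_lt.1 this, hB p hp⟩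

/-- Euler product identity for `A_{q,χ}`. -/
theorem Aq_eq {q : ℕ} [Fact q.Prime] (hq : q ≠ 2) (χ : DirichletCharacter ℂ q) :
    Aq q χ = 2 * χ 2 * C2 q * ∑' d : ℕ, (gfun d : ℂ) * χ (d : ZMod q) / d := by
  have hqp : q.Prime := Fact.out
  set f : ℕ → ℂ := fun d => (gfun d : ℂ) * χ (d : ZMod q) / d with hf
  have hfm : ∀ {m n : ℕ}, m.Coprime n → f (m * n) = f m * f n := fun {m n} h => by
    simp only [hf, gfun_mul h]; push_cast; rw [map_mul]; field_simp
  have hsum : Summable fun d => ‖f d‖ := by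
    refine Summable.of_nonneg_of_le (fun _ => norm_nonneg _) (fun d => ?_) summable_gfun
    simp only [hf, norm_div, norm_mul, Complex.norm_real, Complex.norm_natCast, Real.norm_eq_abs]
    rcases Nat.eq_zero_or_pos d with rfl | hd
    · simp
    have hd1 : (1 : ℝ) ≤ d := by exact_mod_cast hd
    have h1 : ((d : ℝ))⁻¹ ≤ (d : ℝ) ^ (-(2 / 3 : ℝ)) := by
      rw [← Real.rpow_neg_one]
      exact Real.rpow_le_rpow_of_exponent_le hd1 (by norm_num)
    rw [div_eq_mul_inv]
    have h2 := DirichletCharacter.norm_le_one χ (d : ZMod q)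
    calc _ ≤ |gfun d| * 1 * (d : ℝ) ^ (-(2 / 3 : ℝ)) := by gcongr
      _ = _ := by rw [mul_one]
  have hP := EulerProduct.eulerProduct_hasProd (f := f) (by simp [hf, gfun_one]) hfm hsum
    (by simp [hf])
  have hC : HasProd (fun p : Nat.Primes => ((cfac q p : ℝ) : ℂ)) (C2 q : ℂ) :=
    (hasProd_cfac q).map Complex.ofRealHom Complex.continuous_ofReal
  have hE := hasProd_ite_eq (⟨2, Nat.prime_two⟩ : Nat.Primes) (2 * χ 2)
  have hAll := (hE.mul hC).mul hP
  unfold Aq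
  rw [← hAll.tprod_eq]
  congr 1
  ext p
  obtain ⟨p, hp⟩ := p
  have hp0 : (p : ℂ) ≠ 0 := by exact_mod_cast hp.ne_zero
  rw [tsum_three (f := fun e => f (p ^ e)) (fun e he => by
    simp [hf, gfun_prime_pow hp, gloc_of_three_le p he])]
  have e0 : f (p ^ 0) = 1 := by simp [hf, gfun_one]
  have e1 : f (p ^ 1) = gloc p 1 * χ (p : ZMod q) / p := by
    simp only [hf, gfun_prime_pow hp]; simp
  have e2 : f (p ^ 2) = gloc p 2 * χ (p : ZMod q) ^ 2 / p ^ 2 := by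
    simp only [hf, gfun_prime_pow hp]; simp
  rw [e0, e1, e2]
  by_cases h2 : p = 2
  · subst h2
    have h2q : ¬ 2 ∣ q := fun h => hq ((Nat.prime_dvd_prime_iff_eq Nat.prime_two hqp).1 h).symm
    simp [h2q, cfac, gloc]
    ring
  · have hne : (⟨p, hp⟩ : Nat.Primes) ≠ ⟨2, Nat.prime_two⟩ := fun h => h2 (congrArg Subtype.val h)
    by_cases hpq : p ∣ q
    · have : p = q := (Nat.prime_dvd_prime_iff_eq hp hqp).1 hpq
      subst this
      simp [hne, cfac, MulChar.map_zero]
    · have h3 := two_lt_of_prime hp h2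
      have h4 : (p : ℂ) - 2 ≠ 0 := by
        have : ((p : ℝ) - 2) ≠ 0 := by linarith
        exact_mod_cast this
      have h5 : (p : ℂ) - 1 ≠ 0 := by
        have : ((p : ℝ) - 1) ≠ 0 := by linarith
        exact_mod_cast this
      simp [hne, hpq, cfac, gloc, h2]
      field_simp
      ring

lemma sum_hw_mul_char {q : ℕ} (χ : DirichletCharacter ℂ q) (Q : ℕ) :
    ∑ n ∈ Finset.Icc 1 Q, (hw n : ℂ) * χ (n : ZMod q) =
      ∑ d ∈ Finset.Icc 1 Q, (gfun d : ℂ) * χ (d : ZMod q) / d *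
        ∑ m ∈ Finset.Icc 1 (Q / d), χ (m : ZMod q) / m := by
  set f : ArithmeticFunction ℂ := ⟨fun d => (gfun d : ℂ) * χ (d : ZMod q) / d, by simp⟩ with hf
  set g : ArithmeticFunction ℂ := ⟨fun d => χ (d : ZMod q) / d, by simp⟩ with hg
  have key := ArithmeticFunction.sum_Ioc_mul_eq_sum_sum f g Q
  have hIoc : ∀ n : ℕ, Finset.Ioc 0 n = Finset.Icc 1 n := fun n => by ext; simp; omega
  simp only [hIoc] at key
  change _ = ∑ d ∈ Finset.Icc 1 Q, f d * ∑ m ∈ Finset.Icc 1 (Q / d), g m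
  rw [← key]
  refine Finset.sum_congr rfl fun n hn => ?_
  have hn0 : n ≠ 0 := by have := (Finset.mem_Icc.1 hn).1; omega
  have hn0' : (n : ℂ) ≠ 0 := by exact_mod_cast hn0
  rw [ArithmeticFunction.mul_apply]
  have h1 : ∀ x ∈ n.divisorsAntidiagonal, f x.1 * g x.2 = (gfun x.1 : ℂ) * (χ (n : ZMod q) / n) := by
    intro x hx
    obtain ⟨hx1, -⟩ := Nat.mem_divisorsAntidiagonal.1 hx
    have : f x.1 * g x.2 = (gfun x.1 : ℂ) * χ (x.1 : ZMod q) / x.1 * (χ (x.2 : ZMod q) / x.2) := rfl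
    rw [this, ← hx1]
    push_cast
    rw [map_mul]
    field_simp
  rw [Finset.sum_congr rfl h1, ← Finset.sum_mul,
    Nat.sum_divisorsAntidiagonal (fun d _ => (gfun d : ℂ)), ← Complex.ofReal_sum, sum_divisors_gfun]
  push_cast
  field_simp

/-- `L(1,χ) A_{q,χ}` is well approximated by a short character sum weighted by `hw`. -/
theorem exists_norm_LFunction_mul_Aq_sub_le : ∃ K : ℝ, 0 ≤ K ∧ ∀ (q : ℕ) [Fact q.Prime], q ≠ 2 →
    ∀ χ : DirichletCharacter ℂ q, χ ≠ 1 → ∀ Q : ℕ, 1 ≤ Q →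
    ‖DirichletCharacter.LFunction χ 1 * Aq q χ -
      2 * χ 2 * C2 q * ∑ n ∈ Finset.Icc 1 Q, (hw n : ℂ) * χ (n : ZMod q)‖ ≤
      K * q * (Q : ℝ) ^ (-(1 / 3 : ℝ)) := by
  set G0 := ∑' d : ℕ, |gfun d| * (d : ℝ) ^ (-(2 / 3 : ℝ)) with hG0
  have hG0n : 0 ≤ G0 := tsum_nonneg fun d => by positivity
  refine ⟨20 * G0, by positivity, fun q _ hq χ hχ Q hQ => ?_⟩
  have hqp : q.Prime := Fact.out
  have hq1 : (1 : ℝ) ≤ q := by exact_mod_cast hqp.one_le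
  have hQ0 : (0 : ℝ) < Q := by exact_mod_cast hQ
  set f : ℕ → ℂ := fun d => (gfun d : ℂ) * χ (d : ZMod q) / d with hf
  set a : ℕ → ℝ := fun d => |gfun d| * (d : ℝ) ^ (-(2 / 3 : ℝ)) with ha
  have ha0 : ∀ d, 0 ≤ a d := fun d => by positivity
  have hfa : ∀ d : ℕ, ‖f d‖ ≤ |gfun d| / d := by
    intro d
    simp only [hf, norm_div, norm_mul, Complex.norm_real, Complex.norm_natCast, Real.norm_eq_abs]
    have h2 := DirichletCharacter.norm_le_one χ (d : ZMod q)
    calc _ ≤ |gfun d| * 1 / d := by gcongr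
      _ = _ := by rw [mul_one]
  have hgd : ∀ d : ℕ, 0 < d → |gfun d| / d = a d * (d : ℝ) ^ (-(1 / 3 : ℝ)) := by
    intro d hd
    have hd0 : (0 : ℝ) < d := by exact_mod_cast hd
    rw [ha, mul_assoc, ← Real.rpow_add hd0, div_eq_mul_inv, ← Real.rpow_neg_one]
    norm_num
  have hfs : Summable f := by
    refine Summable.of_norm_bounded summable_gfun fun d => ?_
    rcases Nat.eq_zero_or_pos d with rfl | hd
    · simp [hf]
    refine (hfa d).trans ?_
    rw [hgd d hd]
    refine mul_le_of_le_one_right (ha0 d) ?_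
    exact Real.rpow_le_one_of_one_le_of_nonpos (by exact_mod_cast hd) (by norm_num)
  set L := DirichletCharacter.LFunction χ 1 with hL
  have hLn : ‖L‖ ≤ 4 * q := by
    have h1 := norm_LFunction_one_sub_le hχ (X := 1) le_rfl
    simp only [Finset.Icc_self, Finset.sum_singleton, Nat.cast_one, map_one, div_one] at h1
    have := norm_le_norm_add_norm_sub' L 1
    rw [norm_one] at this
    linarith
  have hsplit : ∑' d, f d = ∑ d ∈ Finset.range (Q + 1), f d + ∑' d, f (d + (Q + 1)) :=
    (hfs.sum_add_tsum_nat_add (Q + 1)).symm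
  have htail : ‖∑' d, f (d + (Q + 1))‖ ≤ G0 * (Q : ℝ) ^ (-(1 / 3 : ℝ)) := by
    have hs' : Summable fun d => a (d + (Q + 1)) := (summable_nat_add_iff (Q + 1)).2 summable_gfun
    have h1 : ∀ d, ‖f (d + (Q + 1))‖ ≤ a (d + (Q + 1)) * (Q : ℝ) ^ (-(1 / 3 : ℝ)) := by
      intro d
      refine (hfa _).trans ?_
      rw [hgd _ (by omega)]
      refine mul_le_mul_of_nonneg_left ?_ (ha0 _)
      refine Real.rpow_le_rpow_of_nonpos hQ0 ?_ (by norm_num)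
      push_cast; linarith [(Nat.cast_nonneg d : (0 : ℝ) ≤ d)]
    refine (tsum_of_norm_bounded (hs'.mul_right _).hasSum h1).trans ?_
    rw [tsum_mul_right]
    refine mul_le_mul_of_nonneg_right ?_ (by positivity)
    have := summable_gfun.sum_add_tsum_nat_add (Q + 1)
    rw [hG0, ← this]
    exact le_add_of_nonneg_left (Finset.sum_nonneg fun d _ => ha0 d)
  have hrange : ∑ d ∈ Finset.range (Q + 1), f d = ∑ d ∈ Finset.Icc 1 Q, f d := by
    symm
    refine Finset.sum_subset (fun x hx => ?_) fun x hx hx' => ?_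
    · have := Finset.mem_Icc.1 hx
      exact Finset.mem_range.2 (by omega)
    · have : x = 0 := by
        rw [Finset.mem_range] at hx
        rw [Finset.mem_Icc] at hx'
        omega
      simp [this, hf]
  have hmain : ‖∑ d ∈ Finset.Icc 1 Q, f d * L - ∑ d ∈ Finset.Icc 1 Q, f d *
      ∑ m ∈ Finset.Icc 1 (Q / d), χ (m : ZMod q) / m‖ ≤ 4 * q * G0 * (Q : ℝ) ^ (-(1 / 3 : ℝ)) := by
    rw [← Finset.sum_sub_distrib]
    refine (norm_sum_le _ _).trans ?_
    calc _ ≤ ∑ d ∈ Finset.Icc 1 Q, a d * (4 * q * (Q : ℝ) ^ (-(1 / 3 : ℝ))) := by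
          refine Finset.sum_le_sum fun d hd => ?_
          obtain ⟨hd1, hd2⟩ := Finset.mem_Icc.1 hd
          have hd0 : (0 : ℝ) < d := by exact_mod_cast hd1
          have hX : 1 ≤ Q / d := (Nat.one_le_div_iff hd1).2 hd2
          rw [← mul_sub, norm_mul]
          have h1 := norm_LFunction_one_sub_le hχ hX
          have h2 : 2 * (q : ℝ) / ((Q / d : ℕ) : ℝ) ≤ 4 * q * d / Q := by
            have h3 : (Q : ℝ) ≤ 2 * d * ((Q / d : ℕ) : ℝ) := by
              have h4 : Q < d * (Q / d) + d := Nat.lt_mul_div_succ Q hd1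
              have h5 : Q ≤ 2 * d * (Q / d) := by nlinarith
              exact_mod_cast h5
            have h6 : (0 : ℝ) < ((Q / d : ℕ) : ℝ) := by exact_mod_cast hX
            rw [div_le_div_iff₀ h6 hQ0]
            nlinarith
          have h3 : (d : ℝ) ^ (2 / 3 : ℝ) ≤ (Q : ℝ) ^ (2 / 3 : ℝ) :=
            Real.rpow_le_rpow hd0.le (by exact_mod_cast hd2) (by norm_num)
          calc ‖f d‖ * _ ≤ |gfun d| / d * (4 * q * d / Q) :=
                mul_le_mul (hfa d) (h1.trans h2) (norm_nonneg _) (by positivity)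
            _ = |gfun d| * (d : ℝ) ^ (-(2 / 3 : ℝ)) * (4 * q * (d : ℝ) ^ (2 / 3 : ℝ) / Q) := by
                rw [Real.rpow_neg hd0.le]
                field_simp
            _ ≤ |gfun d| * (d : ℝ) ^ (-(2 / 3 : ℝ)) * (4 * q * (Q : ℝ) ^ (2 / 3 : ℝ) / Q) := by
                gcongr
            _ = _ := by
                rw [mul_div_assoc, div_eq_mul_inv ((Q : ℝ) ^ (2 / 3 : ℝ)), ← Real.rpow_neg_one,
                  ← Real.rpow_add hQ0]
                norm_num
                exact Or.inl rfl
      _ = (∑ d ∈ Finset.Icc 1 Q, a d) * (4 * q * (Q : ℝ) ^ (-(1 / 3 : ℝ))) := by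
          rw [Finset.sum_mul]
      _ ≤ G0 * (4 * q * (Q : ℝ) ^ (-(1 / 3 : ℝ))) := by
          gcongr
          exact summable_gfun.sum_le_tsum _ fun d _ => ha0 d
      _ = _ := by ring
  have hA : DirichletCharacter.LFunction χ 1 * Aq q χ -
      2 * χ 2 * C2 q * ∑ n ∈ Finset.Icc 1 Q, (hw n : ℂ) * χ (n : ZMod q) =
      2 * χ 2 * C2 q * ((∑ d ∈ Finset.Icc 1 Q, f d * L - ∑ d ∈ Finset.Icc 1 Q, f d *
      ∑ m ∈ Finset.Icc 1 (Q / d), χ (m : ZMod q) / m) + L * ∑' d, f (d + (Q + 1))) := by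
    rw [sum_hw_mul_char, Aq_eq hq, ← Finset.sum_mul]
    change L * (2 * χ 2 * C2 q * ∑' d, f d) - _ = _
    rw [hsplit, hrange]
    ring
  rw [hA, norm_mul]
  have hc : ‖2 * χ 2 * (C2 q : ℂ)‖ ≤ 2 := by
    rw [norm_mul, norm_mul, Complex.norm_real, Real.norm_of_nonneg (C2_nonneg q)]
    have h1 := DirichletCharacter.norm_le_one χ (2 : ZMod q)
    have h2 := C2_le_one q
    have h3 := C2_nonneg q
    have h4 : ‖(2 : ℂ)‖ = 2 := by simp
    rw [h4]
    have := norm_nonneg (χ 2)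
    nlinarith
  have hin : ‖(∑ d ∈ Finset.Icc 1 Q, f d * L - ∑ d ∈ Finset.Icc 1 Q, f d *
      ∑ m ∈ Finset.Icc 1 (Q / d), χ (m : ZMod q) / m) + L * ∑' d, f (d + (Q + 1))‖ ≤
      8 * q * G0 * (Q : ℝ) ^ (-(1 / 3 : ℝ)) := by
    refine (norm_add_le _ _).trans ?_
    rw [norm_mul]
    have := mul_le_mul hLn htail (norm_nonneg _) (by positivity)
    linarith
  calc _ ≤ 2 * (8 * q * G0 * (Q : ℝ) ^ (-(1 / 3 : ℝ))) :=
        mul_le_mul hc hin (norm_nonneg _) (by norm_num)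
    _ ≤ _ := by
        have : 0 ≤ q * G0 * (Q : ℝ) ^ (-(1 / 3 : ℝ)) := by positivity
        linarith

lemma bz_neg {a : ZMod q} (ha : a ≠ 0) : bz (-a) = -bz a := by
  have hq : (0 : ℝ) < q := by exact_mod_cast (Fact.out : q.Prime).pos
  unfold bz
  rw [ZMod.neg_val, if_neg ha, Nat.cast_sub (ZMod.val_lt a).le]
  field_simp
  ring

lemma abs_bz_le (a : ZMod q) : |bz a| ≤ 1 / 2 := by
  have hq : (0 : ℝ) < q := by exact_mod_cast (Fact.out : q.Prime).pos
  have h1 : (a.val : ℝ) / q ≤ 1 := by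
    rw [div_le_one hq]; exact_mod_cast (ZMod.val_lt a).le
  have h2 : 0 ≤ (a.val : ℝ) / q := by positivity
  unfold bz
  rw [abs_le]; constructor <;> linarith

lemma sum_char_mul_bz_neg (χ : DirichletCharacter ℂ q) :
    χ (-1) * ∑ a : ZMod q, χ a * (bz a : ℂ) = -∑ a : ZMod q, χ a * (bz a : ℂ) := by
  rw [Finset.mul_sum, ← Finset.sum_neg_distrib, ← Equiv.sum_comp (Equiv.neg (ZMod q))]
  refine Finset.sum_congr rfl fun a _ => ?_
  rcases eq_or_ne a 0 with rfl | ha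
  · simp [MulChar.map_zero]
  · simp only [Equiv.neg_apply]
    rw [bz_neg ha, ← mul_assoc, ← map_mul]
    simp

lemma LFunction_zero_mul_neg_one {χ : DirichletCharacter ℂ q} (hχ : χ ≠ 1) :
    χ (-1) * DirichletCharacter.LFunction χ 0 = -DirichletCharacter.LFunction χ 0 := by
  rw [LFunction_zero hχ, mul_neg, sum_char_mul_bz_neg]

lemma norm_LFunction_zero_le {χ : DirichletCharacter ℂ q} (hχ : χ ≠ 1) :
    ‖DirichletCharacter.LFunction χ 0‖ ≤ q / 2 := by
  rw [LFunction_zero hχ, norm_neg]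
  refine (norm_sum_le _ _).trans ?_
  calc _ ≤ ∑ a : ZMod q, (1 / 2 : ℝ) := by
        refine Finset.sum_le_sum fun a _ => ?_
        rw [norm_mul, Complex.norm_real, Real.norm_eq_abs]
        have h1 := DirichletCharacter.norm_le_one χ a
        have h2 := abs_bz_le a
        have h3 := norm_nonneg (χ a)
        have h4 := abs_nonneg (bz a)
        nlinarith
    _ = q / 2 := by simp [ZMod.card]; ring

lemma Cfun_eq (k : ℤ) : Cfun q k = ((↑q.totient : ℂ)⁻¹ *
      ∑ χ ∈ Finset.univ.filter (fun χ : DirichletCharacter ℂ q => χ ≠ 1),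
        (starRingEnd ℂ) (χ ((k : ZMod q))) * DirichletCharacter.LFunction χ 0 *
          DirichletCharacter.LFunction χ 1 * Aq q χ).re := by
  unfold Cfun
  rw [dif_neg (Fact.out : q.Prime).ne_zero]

lemma Cfun_congr {k l : ℤ} (h : (k : ZMod q) = l) : Cfun q k = Cfun q l := by
  rw [Cfun_eq, Cfun_eq, h]

lemma Cfun_neg (k : ℤ) : Cfun q (-k) = -Cfun q k := by
  rw [Cfun_eq, Cfun_eq, ← Complex.neg_re, ← mul_neg, ← Finset.sum_neg_distrib]
  congr 2
  refine Finset.sum_congr rfl fun χ hχ => ?_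
  have hχ1 : χ ≠ 1 := (Finset.mem_filter.1 hχ).2
  have h1 : (starRingEnd ℂ) (χ ((-k : ℤ) : ZMod q)) =
      χ (-1) * (starRingEnd ℂ) (χ ((k : ℤ) : ZMod q)) := by
    have h2 : χ (-1) = 1 ∨ χ (-1) = -1 := by
      have : χ (-1) * χ (-1) = 1 := by rw [← map_mul]; simp
      exact mul_self_eq_one_iff.1 this
    have h3 : ((-k : ℤ) : ZMod q) = -1 * (k : ZMod q) := by push_cast; ring
    rw [h3, map_mul, map_mul]
    rcases h2 with h | h <;> simp [h]
  rw [h1]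
  have := LFunction_zero_mul_neg_one hχ1
  linear_combination (starRingEnd ℂ) (χ ((k : ℤ) : ZMod q)) *
    DirichletCharacter.LFunction χ 1 * Aq q χ * this

lemma sum_bz_ne_zero : ∑ a : ZMod q, (if a = 0 then 0 else bz a) = 0 := by
  have h : ∑ a : ZMod q, (if a = 0 then 0 else bz a) = -∑ a : ZMod q, (if a = 0 then 0 else bz a) := by
    rw [← Finset.sum_neg_distrib]
    rw [← Equiv.sum_comp (Equiv.neg (ZMod q))]
    refine Finset.sum_congr rfl fun a _ => ?_
    rcases eq_or_ne a 0 with rfl | ha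
    · simp
    · simp [ha, bz_neg ha]
  linarith

/-- Orthogonality evaluation of the truncated main term. -/
lemma sum_char_main {κ : ZMod q} (hκ : κ ≠ 0) (Q : ℕ) :
    (↑q.totient : ℂ)⁻¹ * ∑ χ ∈ Finset.univ.filter (fun χ : DirichletCharacter ℂ q => χ ≠ 1),
      χ κ⁻¹ * DirichletCharacter.LFunction χ 0 *
        ∑ n ∈ Finset.Icc 1 Q, (hw n : ℂ) * χ (n : ZMod q) =
    ((-∑ n ∈ (Finset.Icc 1 Q).filter (fun n : ℕ => (n : ZMod q) ≠ 0),
      hw n * bz (κ * (n : ZMod q)⁻¹) : ℝ) : ℂ) := by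
  have hqt : (q.totient : ℂ) ≠ 0 := by
    exact_mod_cast (Nat.totient_pos.2 (Fact.out : q.Prime).pos).ne'
  set F : DirichletCharacter ℂ q → ℂ := fun χ => χ κ⁻¹ * (-∑ a : ZMod q, χ a * (bz a : ℂ)) *
        ∑ n ∈ Finset.Icc 1 Q, (hw n : ℂ) * χ (n : ZMod q) with hF
  have h1 : ∑ χ ∈ Finset.univ.filter (fun χ : DirichletCharacter ℂ q => χ ≠ 1),
      χ κ⁻¹ * DirichletCharacter.LFunction χ 0 *
        ∑ n ∈ Finset.Icc 1 Q, (hw n : ℂ) * χ (n : ZMod q) = ∑ χ, F χ := by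
    have : ∑ χ ∈ Finset.univ.filter (fun χ : DirichletCharacter ℂ q => χ ≠ 1), F χ = ∑ χ, F χ := by
      rw [Finset.sum_filter]
      refine Finset.sum_congr rfl fun χ _ => ?_
      split_ifs with h
      · rfl
      · push Not at h
        subst h
        have h0 : ∑ a : ZMod q, (1 : DirichletCharacter ℂ q) a * (bz a : ℂ) = 0 := by
          have h2 := congrArg (fun x : ℝ => (x : ℂ)) (sum_bz_ne_zero (q := q))
          push_cast at h2
          rw [← h2]
          refine Finset.sum_congr rfl fun a _ => ?_
          by_cases ha : a = 0
          · simp [ha, MulChar.map_zero]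
          · rw [MulChar.one_apply (isUnit_iff_ne_zero.2 ha)]; simp [ha]
        simp only [hF, h0]
        simp
    rw [← this]
    refine Finset.sum_congr rfl fun χ hχ => ?_
    simp only [hF]
    rw [LFunction_zero (Finset.mem_filter.1 hχ).2]
  rw [h1]
  have h2 : ∑ χ, F χ = -∑ n ∈ Finset.Icc 1 Q, ∑ a : ZMod q, (hw n : ℂ) * (bz a : ℂ) *
      ∑ χ : DirichletCharacter ℂ q, χ κ⁻¹ * χ (a * n) := by
    simp only [hF]
    simp only [Finset.mul_sum, mul_neg, neg_mul, Finset.sum_mul, ← Finset.sum_neg_distrib]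
    rw [Finset.sum_comm]
    refine Finset.sum_congr rfl fun n _ => ?_
    rw [Finset.sum_comm]
    refine Finset.sum_congr rfl fun a _ => ?_
    refine Finset.sum_congr rfl fun χ _ => ?_
    rw [map_mul]; ring
  rw [h2, mul_neg]
  push_cast
  congr 1
  rw [Finset.mul_sum, Finset.sum_filter]
  refine Finset.sum_congr rfl fun n _ => ?_
  have hu : IsUnit κ := isUnit_iff_ne_zero.2 hκ
  simp only [DirichletCharacter.sum_char_inv_mul_char_eq ℂ hu]
  split_ifs with hn
  · rw [Finset.sum_eq_single (κ * (n : ZMod q)⁻¹)]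
    · rw [if_pos]
      · field_simp
      · field_simp
    · intro a _ ha
      rw [if_neg, mul_zero]
      intro h
      exact ha (by rw [h]; field_simp)
    · simp
  · push Not at hn
    have : ∀ a : ZMod q, ¬ κ = a * (n : ZMod q) := fun a h => hκ (by rw [h, hn, mul_zero])
    simp [this]

omit [Fact q.Prime] in
theorem exists_abs_Cfun_add_le : ∃ K : ℝ, 0 ≤ K ∧ ∀ (q : ℕ) [Fact q.Prime], q ≠ 2 →
    ∀ κ : ZMod q, κ ≠ 0 → ∀ k : ℤ, (k : ZMod q) = 2 * κ →
    |Cfun q k + 2 * C2 q * ∑ n ∈ (Finset.Icc 1 (q ^ 9)).filter (fun n : ℕ => (n : ZMod q) ≠ 0),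
      hw n * bz (κ * (n : ZMod q)⁻¹)| ≤ K / q := by
  obtain ⟨K, hK, h⟩ := exists_norm_LFunction_mul_Aq_sub_le
  refine ⟨K, hK, fun q _ hq κ hκ k hk => ?_⟩
  have hqp : q.Prime := Fact.out
  have hq0 : (0 : ℝ) < q := by exact_mod_cast hqp.pos
  have hqt : (0 : ℝ) < q.totient := by exact_mod_cast Nat.totient_pos.2 hqp.pos
  have h20 : (2 : ZMod q) ≠ 0 := by
    have : ((2 : ℕ) : ZMod q) ≠ 0 := by
      rw [Ne, ZMod.natCast_eq_zero_iff]
      intro h'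
      exact hq ((Nat.prime_dvd_prime_iff_eq hqp Nat.prime_two).1 h')
    exact_mod_cast this
  set S := ∑ n ∈ (Finset.Icc 1 (q ^ 9)).filter (fun n : ℕ => (n : ZMod q) ≠ 0),
      hw n * bz (κ * (n : ZMod q)⁻¹) with hS
  have hstar : ∀ (χ : DirichletCharacter ℂ q) (a : ZMod q), (starRingEnd ℂ) (χ a) = χ a⁻¹ := by
    intro χ a
    have := MulChar.star_apply' χ a
    rw [MulChar.inv_apply'] at this
    simpa using this
  have hchar : ∀ χ : DirichletCharacter ℂ q, (starRingEnd ℂ) (χ (k : ZMod q)) * χ 2 = χ κ⁻¹ := by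
    intro χ
    rw [hstar, hk, ← map_mul]
    congr 1
    field_simp
  have hmain := sum_char_main hκ (q ^ 9)
  rw [← hS] at hmain
  set P : DirichletCharacter ℂ q → ℂ := fun χ =>
    ∑ n ∈ Finset.Icc 1 (q ^ 9), (hw n : ℂ) * χ (n : ZMod q) with hP
  have hdiff : (↑q.totient : ℂ)⁻¹ *
      ∑ χ ∈ Finset.univ.filter (fun χ : DirichletCharacter ℂ q => χ ≠ 1),
        (starRingEnd ℂ) (χ ((k : ZMod q))) * DirichletCharacter.LFunction χ 0 *
          DirichletCharacter.LFunction χ 1 * Aq q χ + ((2 * C2 q * S : ℝ) : ℂ) =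
      (↑q.totient : ℂ)⁻¹ *
      ∑ χ ∈ Finset.univ.filter (fun χ : DirichletCharacter ℂ q => χ ≠ 1),
        (starRingEnd ℂ) (χ ((k : ZMod q))) * DirichletCharacter.LFunction χ 0 *
          (DirichletCharacter.LFunction χ 1 * Aq q χ - 2 * χ 2 * C2 q * P χ) := by
    have e1 : ((2 * C2 q * S : ℝ) : ℂ) = -(2 * C2 q * ((-S : ℝ) : ℂ)) := by push_cast; ring
    have e2 : ∑ χ ∈ Finset.univ.filter (fun χ : DirichletCharacter ℂ q => χ ≠ 1),
        (starRingEnd ℂ) (χ ((k : ZMod q))) * DirichletCharacter.LFunction χ 0 *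
          (DirichletCharacter.LFunction χ 1 * Aq q χ - 2 * χ 2 * C2 q * P χ) =
        ∑ χ ∈ Finset.univ.filter (fun χ : DirichletCharacter ℂ q => χ ≠ 1),
          (starRingEnd ℂ) (χ ((k : ZMod q))) * DirichletCharacter.LFunction χ 0 *
          DirichletCharacter.LFunction χ 1 * Aq q χ -
        2 * C2 q * ∑ χ ∈ Finset.univ.filter (fun χ : DirichletCharacter ℂ q => χ ≠ 1),
          χ κ⁻¹ * DirichletCharacter.LFunction χ 0 * P χ := by
      rw [Finset.mul_sum, ← Finset.sum_sub_distrib]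
      refine Finset.sum_congr rfl fun χ _ => ?_
      rw [← hchar χ]
      ring
    rw [e1, ← hmain, e2]
    ring
  have hre : Cfun q k + 2 * C2 q * S = ((↑q.totient : ℂ)⁻¹ *
      ∑ χ ∈ Finset.univ.filter (fun χ : DirichletCharacter ℂ q => χ ≠ 1),
        (starRingEnd ℂ) (χ ((k : ZMod q))) * DirichletCharacter.LFunction χ 0 *
          (DirichletCharacter.LFunction χ 1 * Aq q χ - 2 * χ 2 * C2 q * P χ)).re := by
    rw [← hdiff, Complex.add_re, Complex.ofReal_re, Cfun_eq]
  rw [hre]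
  refine (Complex.abs_re_le_norm _).trans ?_
  rw [norm_mul, norm_inv, Complex.norm_natCast]
  have hcard : (Finset.univ.filter (fun χ : DirichletCharacter ℂ q => χ ≠ 1)).card ≤ q.totient := by
    refine (Finset.card_filter_le _ _).trans ?_
    rw [Finset.card_univ, ← Nat.card_eq_fintype_card]
    exact (DirichletCharacter.card_eq_totient_of_hasEnoughRootsOfUnity ℂ q).le
  have hQ : ((q ^ 9 : ℕ) : ℝ) ^ (-(1 / 3 : ℝ)) = ((q : ℝ) ^ 3)⁻¹ := by
    push_cast
    rw [← Real.rpow_natCast, ← Real.rpow_mul hq0.le, ← Real.rpow_natCast, ← Real.rpow_neg hq0.le]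
    norm_num
  have hnorm : ‖∑ χ ∈ Finset.univ.filter (fun χ : DirichletCharacter ℂ q => χ ≠ 1),
        (starRingEnd ℂ) (χ ((k : ZMod q))) * DirichletCharacter.LFunction χ 0 *
          (DirichletCharacter.LFunction χ 1 * Aq q χ - 2 * χ 2 * C2 q * P χ)‖ ≤
      q.totient * (K / q) := by
    refine (norm_sum_le _ _).trans ?_
    calc _ ≤ ∑ χ ∈ Finset.univ.filter (fun χ : DirichletCharacter ℂ q => χ ≠ 1), K / (q : ℝ) := by
          refine Finset.sum_le_sum fun χ hχ => ?_
          have hχ1 := (Finset.mem_filter.1 hχ).2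
          rw [norm_mul, norm_mul, RCLike.norm_conj]
          have a1 := DirichletCharacter.norm_le_one χ (k : ZMod q)
          have a2 := norm_LFunction_zero_le hχ1
          have a3 := h q hq χ hχ1 (q ^ 9) (Nat.one_le_pow _ _ hqp.pos)
          rw [hQ] at a3
          calc _ ≤ 1 * ((q : ℝ) / 2) * (K * q * ((q : ℝ) ^ 3)⁻¹) := by gcongr
            _ = K / q / 2 := by field_simp
            _ ≤ K / q := by
              have : 0 ≤ K / q := by positivity
              linarith
      _ ≤ _ := by
          rw [Finset.sum_const, nsmul_eq_mul]
          gcongr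
  calc _ ≤ (q.totient : ℝ)⁻¹ * (q.totient * (K / q)) := by gcongr
    _ = _ := by field_simp

local notation "ψ" => (ZMod.stdAddChar (N := q))

lemma sum_stdAddChar_mul (a : ZMod q) :
    ∑ x : ZMod q, ψ (x * a) = if a = 0 then (q : ℂ) else 0 := by
  rw [AddChar.sum_mulShift a (ZMod.isPrimitive_stdAddChar q)]
  split_ifs <;> simp [ZMod.card]

/-- Discrete Fourier coefficients of the sawtooth on residues. -/
noncomputable def bhat (j : ZMod q) : ℂ := (q : ℂ)⁻¹ * ∑ s : ZMod q, (bz s : ℂ) * ψ (-(j * s))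

lemma bz_eq_sum_bhat (t : ZMod q) : (bz t : ℂ) = ∑ j : ZMod q, bhat j * ψ (j * t) := by
  have hq : (q : ℂ) ≠ 0 := by exact_mod_cast (Fact.out : q.Prime).ne_zero
  have h : ∀ j : ZMod q, bhat j * ψ (j * t) =
      ∑ s : ZMod q, (q : ℂ)⁻¹ * (bz s : ℂ) * ψ (j * (t - s)) := by
    intro j
    unfold bhat
    rw [mul_assoc, Finset.sum_mul, Finset.mul_sum]
    refine Finset.sum_congr rfl fun s _ => ?_
    rw [mul_assoc, mul_assoc, ← AddChar.map_add_eq_mul]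
    congr 3
    ring
  simp only [h]
  rw [Finset.sum_comm]
  simp only [← Finset.mul_sum, sum_stdAddChar_mul]
  rw [Finset.sum_eq_single t]
  · simp
    field_simp
  · intro s _ hs
    rw [if_neg (sub_ne_zero.2 hs.symm), mul_zero]
  · simp

lemma bz_add_one (t : ZMod q) : bz (t + 1) = bz t + 1 / q - (if t = -1 then 1 else 0) := by
  have hqp : q.Prime := Fact.out
  haveI : Fact (1 < q) := ⟨hqp.one_lt⟩
  have hq : (q : ℝ) ≠ 0 := by exact_mod_cast hqp.ne_zero
  unfold bz
  split_ifs with h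
  · subst h
    have : ((-1 : ZMod q)).val = q - 1 := by
      rw [ZMod.neg_val, if_neg one_ne_zero, ZMod.val_one]
    rw [this, neg_add_cancel, ZMod.val_zero, Nat.cast_sub hqp.one_le]
    field_simp
    push_cast
    ring
  · have hlt : t.val + 1 < q := by
      by_contra hc
      have h1 := ZMod.val_lt t
      have h2 : t.val + 1 = q := by omega
      apply h
      have h3 : ((t.val + 1 : ℕ) : ZMod q) = 0 := by rw [h2]; simp
      push_cast at h3
      rw [ZMod.natCast_zmod_val] at h3
      exact eq_neg_of_add_eq_zero_left h3
    rw [ZMod.val_add_of_lt (by rw [ZMod.val_one]; exact hlt), ZMod.val_one]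
    push_cast
    ring

lemma norm_bhat_zero : ‖bhat (0 : ZMod q)‖ = 1 / (2 * q) := by
  have hq : (0 : ℝ) < q := by exact_mod_cast (Fact.out : q.Prime).pos
  have h : ∑ s : ZMod q, bz s = -(1 / 2) := by
    have h1 := sum_bz_ne_zero (q := q)
    have h2 : ∀ a : ZMod q, bz a = (if a = 0 then 0 else bz a) + if a = 0 then bz a else 0 := by
      intro a; split_ifs <;> simp
    rw [Finset.sum_congr rfl fun a _ => h2 a, Finset.sum_add_distrib, h1]
    simp [bz]
  have h3 : bhat (0 : ZMod q) = (((q : ℝ)⁻¹ * -(1 / 2) : ℝ) : ℂ) := by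
    unfold bhat
    rw [← h]
    push_cast
    simp
  rw [h3, Complex.norm_real, Real.norm_eq_abs, abs_mul, abs_neg, abs_of_pos (inv_pos.2 hq),
    abs_of_pos (by norm_num)]
  field_simp

lemma norm_bhat_mul {j : ZMod q} (hj : j ≠ 0) : q * ‖bhat j‖ * ‖ψ j - 1‖ = 1 := by
  have hq : (q : ℂ) ≠ 0 := by exact_mod_cast (Fact.out : q.Prime).ne_zero
  set A := ∑ s : ZMod q, (bz s : ℂ) * ψ (-(j * s)) with hA
  have h1 : ψ j * A = A - ψ j := by
    have e1 : ∑ s : ZMod q, (bz (s + 1) : ℂ) * ψ (-(j * s)) = ψ j * A := by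
      rw [hA, Finset.mul_sum, ← Equiv.sum_comp (Equiv.addRight (1 : ZMod q))
        (fun s => ψ j * ((bz s : ℂ) * ψ (-(j * s))))]
      refine Finset.sum_congr rfl fun s _ => ?_
      simp only [Equiv.coe_addRight]
      rw [mul_left_comm, ← AddChar.map_add_eq_mul]
      congr 3
      ring
    have e3 : ∑ s : ZMod q, ψ (-(j * s)) = 0 := by
      have := sum_stdAddChar_mul (-j)
      rw [if_neg (neg_ne_zero.2 hj)] at this
      rw [← this]
      exact Finset.sum_congr rfl fun s _ => by congr 1; ring
    have e2 : ∑ s : ZMod q, (bz (s + 1) : ℂ) * ψ (-(j * s)) = A - ψ j := by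
      have : ∀ s : ZMod q, (bz (s + 1) : ℂ) * ψ (-(j * s)) = (bz s : ℂ) * ψ (-(j * s)) +
          (1 / q : ℂ) * ψ (-(j * s)) - (if s = -1 then ψ (-(j * s)) else 0) := by
        intro s
        rw [bz_add_one]
        split_ifs <;> (push_cast; ring)
      simp only [this, Finset.sum_sub_distrib, Finset.sum_add_distrib, ← Finset.mul_sum, e3]
      simp [hA]
    rw [← e1, e2]
  have h2 : A * (ψ j - 1) = -ψ j := by linear_combination h1
  have h3 : (q : ℂ) * bhat j = A := by
    unfold bhat; rw [mul_inv_cancel_left₀ hq]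
  have h4 := congrArg norm h2
  rw [norm_mul, norm_neg, AddChar.norm_apply, ← h3, norm_mul, Complex.norm_natCast] at h4
  exact h4

lemma norm_bhat_le {j : ZMod q} (hj : j ≠ 0) :
    ‖bhat j‖ ≤ 1 / 4 * ((j.val : ℝ)⁻¹ + ((q : ℝ) - j.val)⁻¹) := by
  have hqp : q.Prime := Fact.out
  have hq : (0 : ℝ) < q := by exact_mod_cast hqp.pos
  have hv0 : (0 : ℝ) < j.val := by
    have : j.val ≠ 0 := by rwa [Ne, ZMod.val_eq_zero]
    exact_mod_cast Nat.pos_of_ne_zero this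
  have hv1 : (0 : ℝ) < (q : ℝ) - j.val := by
    have := ZMod.val_lt j
    have : (j.val : ℝ) < q := by exact_mod_cast this
    linarith
  set v : ℝ := ((j.val : ℕ) : ℝ) with hv
  have hnorm : ‖ψ j - 1‖ = 2 * |Real.sin (π * v / q)| := by
    rw [ZMod.stdAddChar_apply, ZMod.toCircle_apply]
    have : 2 * (π : ℂ) * I * (j.val : ℂ) / q = I * ((2 * π * v / q : ℝ) : ℂ) := by
      rw [hv]; push_cast; ring
    rw [this, Complex.norm_exp_I_mul_ofReal_sub_one, Real.norm_eq_abs, abs_mul, abs_two]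
    congr 3
    ring
  have hpi := Real.pi_pos
  have key : ∀ w : ℝ, 0 < w → 2 * w ≤ q → |Real.sin (π * v / q)| = |Real.sin (π * w / q)| →
      ‖bhat j‖ ≤ 1 / 4 * w⁻¹ := by
    intro w hw0 hw1 hw2
    have h1 : 2 / π * (π * w / q) ≤ Real.sin (π * w / q) := by
      refine Real.mul_le_sin (by positivity) ?_
      rw [div_le_div_iff₀ hq (by norm_num)]
      nlinarith
    have h2 : 4 * w / q ≤ ‖ψ j - 1‖ := by
      rw [hnorm, hw2]
      have h3 := le_abs_self (Real.sin (π * w / q))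
      have h4 : 2 / π * (π * w / q) = 2 * w / q := by field_simp
      rw [h4] at h1
      have : 4 * w / q = 2 * (2 * w / q) := by ring
      linarith
    have h5 := norm_bhat_mul hj
    have h6 : q * ‖bhat j‖ * (4 * w / q) ≤ 1 := by
      rw [← h5]
      gcongr
    have h7 : q * ‖bhat j‖ * (4 * w / q) = ‖bhat j‖ * (4 * w) := by field_simp
    rw [h7] at h6
    have h8 : 1 / 4 * w⁻¹ = 1 / (4 * w) := by field_simp
    rw [h8, le_div_iff₀ (by positivity)]
    exact h6
  rcases le_total (2 * v) q with h | h
  · have := key v hv0 h rfl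
    have : 0 ≤ ((q : ℝ) - v)⁻¹ := (inv_pos.2 hv1).le
    linarith
  · have h' : |Real.sin (π * v / q)| = |Real.sin (π * (q - v) / q)| := by
      have : π * (q - v) / q = π - π * v / q := by field_simp
      rw [this, Real.sin_pi_sub]
    have := key (q - v) hv1 (by linarith) h'
    have : 0 ≤ v⁻¹ := (inv_pos.2 hv0).le
    linarith

lemma sum_norm_bhat_le : ∑ j ∈ Finset.univ.erase (0 : ZMod q), ‖bhat j‖ ≤
    (1 + Real.log q) / 2 := by
  have hqp : q.Prime := Fact.out
  have hlog : 0 ≤ Real.log q := Real.log_natCast_nonneg q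
  have hharm : ∑ k ∈ Finset.Icc 1 (q - 1), ((k : ℝ))⁻¹ ≤ 1 + Real.log q := by
    have h1 := harmonic_le_one_add_log q
    rw [harmonic_eq_sum_Icc] at h1
    push_cast at h1
    refine le_trans ?_ h1
    refine Finset.sum_le_sum_of_subset_of_nonneg (Finset.Icc_subset_Icc_right (by omega)) ?_
    intros; positivity
  have hval : ∀ f : ℕ → ℝ, ∑ j ∈ Finset.univ.erase (0 : ZMod q), f j.val =
      ∑ k ∈ Finset.Icc 1 (q - 1), f k := by
    intro f
    refine Finset.sum_nbij' (fun j => j.val) (fun k => (k : ZMod q)) ?_ ?_ (by simp) ?_ (by simp)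
    · intro j hj
      have h1 : j ≠ 0 := Finset.ne_of_mem_erase hj
      have h2 : j.val ≠ 0 := by rwa [Ne, ZMod.val_eq_zero]
      have := ZMod.val_lt j
      rw [Finset.mem_Icc]; omega
    · intro k hk
      rw [Finset.mem_Icc] at hk
      rw [Finset.mem_erase]
      refine ⟨fun h => ?_, Finset.mem_univ _⟩
      rw [ZMod.natCast_eq_zero_iff] at h
      have := Nat.le_of_dvd (by omega) h
      have := hqp.pos
      omega
    · intro k hk
      rw [Finset.mem_Icc] at hk
      have := hqp.pos
      exact ZMod.val_cast_of_lt (by omega)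
  calc _ ≤ ∑ j ∈ Finset.univ.erase (0 : ZMod q), 1 / 4 * ((j.val : ℝ)⁻¹ + ((q : ℝ) - j.val)⁻¹) :=
        Finset.sum_le_sum fun j hj => norm_bhat_le (Finset.ne_of_mem_erase hj)
    _ = 1 / 4 * (∑ k ∈ Finset.Icc 1 (q - 1), ((k : ℝ))⁻¹ +
        ∑ k ∈ Finset.Icc 1 (q - 1), ((q : ℝ) - k)⁻¹) := by
        rw [hval fun v => 1 / 4 * ((v : ℝ)⁻¹ + ((q : ℝ) - v)⁻¹), ← Finset.mul_sum,
          Finset.sum_add_distrib]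
    _ = 1 / 4 * (∑ k ∈ Finset.Icc 1 (q - 1), ((k : ℝ))⁻¹ +
        ∑ k ∈ Finset.Icc 1 (q - 1), ((k : ℝ))⁻¹) := by
        congr 2
        refine Finset.sum_nbij' (fun k => q - k) (fun k => q - k) ?_ ?_ ?_ ?_ ?_
        · intro k hk; rw [Finset.mem_Icc] at *; omega
        · intro k hk; rw [Finset.mem_Icc] at *; omega
        · intro k hk; rw [Finset.mem_Icc] at hk; omega
        · intro k hk; rw [Finset.mem_Icc] at hk; omega
        · intro k hk
          rw [Finset.mem_Icc] at hk
          rw [Nat.cast_sub (by omega)]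
    _ ≤ _ := by linarith

lemma parseval_inv (W : ZMod q → ℝ) :
    ∑ x : ZMod q, ‖∑ u : ZMod q, (W u : ℂ) * ψ (x * u⁻¹)‖ ^ 2 = q * ∑ u, W u ^ 2 := by
  have h : ∀ x : ZMod q, ((‖∑ u : ZMod q, (W u : ℂ) * ψ (x * u⁻¹)‖ ^ 2 : ℝ) : ℂ) =
      ∑ u : ZMod q, ∑ v : ZMod q, (W u : ℂ) * (W v : ℂ) * ψ (x * (u⁻¹ - v⁻¹)) := by
    intro x
    push_cast
    rw [← Complex.mul_conj', map_sum, Finset.sum_mul_sum]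
    refine Finset.sum_congr rfl fun u _ => Finset.sum_congr rfl fun v _ => ?_
    rw [map_mul (starRingEnd ℂ), Complex.conj_ofReal, ← AddChar.map_neg_eq_conj, mul_mul_mul_comm,
      ← AddChar.map_add_eq_mul]
    congr 2
    ring
  have h2 : ((∑ x : ZMod q, ‖∑ u : ZMod q, (W u : ℂ) * ψ (x * u⁻¹)‖ ^ 2 : ℝ) : ℂ) =
      ((q * ∑ u, W u ^ 2 : ℝ) : ℂ) := by
    rw [Complex.ofReal_sum, Finset.sum_congr rfl fun x _ => h x, Finset.sum_comm]
    push_cast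
    rw [Finset.mul_sum]
    refine Finset.sum_congr rfl fun u _ => ?_
    rw [Finset.sum_comm]
    simp only [← Finset.mul_sum, sum_stdAddChar_mul]
    rw [Finset.sum_eq_single u]
    · simp; ring
    · intro v _ hv
      rw [if_neg, mul_zero]
      intro h'
      exact hv (inv_injective (sub_eq_zero.1 h')).symm
    · simp
  exact_mod_cast h2

/-- Mean square bound for sums of dilated sawtooth functions over residues. -/
theorem sum_sq_sum_bz_le (W : ZMod q → ℝ) :
    ∑ κ : ZMod q, (∑ u : ZMod q, W u * bz (κ * u⁻¹)) ^ 2 ≤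
      (1 + Real.log q) ^ 2 * (q * ∑ u, W u ^ 2) := by
  have hqp : q.Prime := Fact.out
  have hq : (1 : ℝ) ≤ q := by exact_mod_cast hqp.one_le
  have hlog : 0 ≤ Real.log q := Real.log_natCast_nonneg q
  set F : ZMod q → ℂ := fun x => ∑ u : ZMod q, (W u : ℂ) * ψ (x * u⁻¹) with hF
  have hpar : ∑ x : ZMod q, ‖F x‖ ^ 2 = q * ∑ u, W u ^ 2 := parseval_inv W
  set E := q * ∑ u, W u ^ 2 with hE
  have hE0 : 0 ≤ E := by
    rw [← hpar]; exact Finset.sum_nonneg fun _ _ => by positivity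
  have hexp : ∀ κ : ZMod q, ((∑ u : ZMod q, W u * bz (κ * u⁻¹) : ℝ) : ℂ) =
      ∑ j : ZMod q, bhat j * F (j * κ) := by
    intro κ
    push_cast
    simp only [bz_eq_sum_bhat, hF, Finset.mul_sum]
    rw [Finset.sum_comm]
    refine Finset.sum_congr rfl fun j _ => Finset.sum_congr rfl fun u _ => ?_
    rw [mul_left_comm, mul_assoc]
  have hA : ∑ j : ZMod q, ‖bhat j‖ ≤ 1 + Real.log q := by
    rw [← Finset.add_sum_erase _ _ (Finset.mem_univ 0), norm_bhat_zero]
    have h1 := sum_norm_bhat_le (q := q)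
    have : 1 / (2 * (q : ℝ)) ≤ 1 / 2 := by
      apply one_div_le_one_div_of_le <;> linarith
    linarith
  have hsq : ∀ κ : ZMod q, (∑ u : ZMod q, W u * bz (κ * u⁻¹)) ^ 2 ≤
      (∑ j : ZMod q, ‖bhat j‖) * ∑ j : ZMod q, ‖bhat j‖ * ‖F (j * κ)‖ ^ 2 := by
    intro κ
    have h1 : |∑ u : ZMod q, W u * bz (κ * u⁻¹)| ≤ ∑ j : ZMod q, ‖bhat j‖ * ‖F (j * κ)‖ := by
      rw [← Real.norm_eq_abs, ← Complex.norm_real, hexp κ]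
      refine (norm_sum_le _ _).trans (le_of_eq ?_)
      simp only [norm_mul]
    rw [← sq_abs]
    refine (pow_le_pow_left₀ (abs_nonneg _) h1 2).trans ?_
    refine Finset.sum_sq_le_sum_mul_sum_of_sq_le_mul _ (fun _ _ => norm_nonneg _)
      (fun _ _ => by positivity) (fun j _ => le_of_eq (by ring))
  have hj : ∀ j : ZMod q, j ≠ 0 → ∑ κ : ZMod q, ‖F (j * κ)‖ ^ 2 = E := by
    intro j hj
    rw [← hpar]
    exact Equiv.sum_comp (Equiv.mulLeft₀ j hj) (fun x => ‖F x‖ ^ 2)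
  have h0 : ∑ κ : ZMod q, ‖F (0 * κ)‖ ^ 2 ≤ q * E := by
    simp only [zero_mul]
    rw [Finset.sum_const, Finset.card_univ, ZMod.card, nsmul_eq_mul]
    gcongr
    rw [← hpar]
    exact Finset.single_le_sum (f := fun x => ‖F x‖ ^ 2) (fun x _ => by positivity)
      (Finset.mem_univ 0)
  have hB : ∑ j : ZMod q, ‖bhat j‖ * ∑ κ : ZMod q, ‖F (j * κ)‖ ^ 2 ≤ (1 + Real.log q) * E := by
    rw [← Finset.add_sum_erase _ _ (Finset.mem_univ 0), norm_bhat_zero]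
    have h1 : ∑ j ∈ Finset.univ.erase (0 : ZMod q), ‖bhat j‖ * ∑ κ : ZMod q, ‖F (j * κ)‖ ^ 2 =
        (∑ j ∈ Finset.univ.erase (0 : ZMod q), ‖bhat j‖) * E := by
      rw [Finset.sum_mul]
      exact Finset.sum_congr rfl fun j hj' => by rw [hj j (Finset.ne_of_mem_erase hj')]
    rw [h1]
    have h2 : 1 / (2 * (q : ℝ)) * ∑ κ : ZMod q, ‖F (0 * κ)‖ ^ 2 ≤ E / 2 := by
      calc _ ≤ 1 / (2 * (q : ℝ)) * (q * E) := by gcongr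
        _ = E / 2 := by field_simp
    have h3 := mul_le_mul_of_nonneg_right (sum_norm_bhat_le (q := q)) hE0
    nlinarith
  calc _ ≤ ∑ κ : ZMod q, (∑ j : ZMod q, ‖bhat j‖) * ∑ j : ZMod q, ‖bhat j‖ * ‖F (j * κ)‖ ^ 2 :=
        Finset.sum_le_sum fun κ _ => hsq κ
    _ = (∑ j : ZMod q, ‖bhat j‖) * ∑ j : ZMod q, ‖bhat j‖ * ∑ κ : ZMod q, ‖F (j * κ)‖ ^ 2 := by
        rw [← Finset.mul_sum, Finset.sum_comm]
        simp only [Finset.mul_sum]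
    _ ≤ (1 + Real.log q) * ((1 + Real.log q) * E) := by
        refine mul_le_mul hA hB ?_ (by linarith)
        exact Finset.sum_nonneg fun j _ => mul_nonneg (norm_nonneg _)
          (Finset.sum_nonneg fun _ _ => by positivity)
    _ = _ := by ring

lemma exists_hw_le_rpow : ∃ K : ℝ, 0 ≤ K ∧ ∀ n : ℕ, 1 ≤ n →
    hw n ≤ K * (n : ℝ) ^ (-(99 / 100) : ℝ) := by
  refine ⟨3 ^ 202, by positivity, fun n hn => ?_⟩
  have hn0 : (0 : ℝ) < n := by exact_mod_cast hn
  unfold hw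
  split_ifs with h
  swap
  · positivity
  obtain ⟨hodd, hsq⟩ := h
  have hp : ∀ p ∈ n.primeFactors, (3 : ℝ) ≤ p := by
    intro p hp
    have hpp := Nat.prime_of_mem_primeFactors hp
    refine two_lt_of_prime hpp ?_
    rintro rfl
    have := Nat.dvd_of_mem_primeFactors hp
    have := hodd.not_two_dvd_nat
    contradiction
  have hprod : (n : ℝ) = ∏ p ∈ n.primeFactors, (p : ℝ) := by
    have := Nat.prod_primeFactors_of_squarefree hsq
    rw [← Nat.cast_prod]
    exact congrArg _ this.symm
  have h1 : ∀ p ∈ n.primeFactors, 1 / ((p : ℝ) - 2) ≤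
      (if p < 202 then 3 else 1) * (p : ℝ) ^ (-(99 / 100) : ℝ) := by
    intro p hpm
    have h3 := hp p hpm
    have hsplit : (p : ℝ) ^ (-(99 / 100) : ℝ) = (p : ℝ) ^ (1 / 100 : ℝ) * (p : ℝ)⁻¹ := by
      rw [← Real.rpow_neg_one, ← Real.rpow_add (by linarith)]
      norm_num
    have h4 : 1 ≤ (p : ℝ) ^ (1 / 100 : ℝ) := Real.one_le_rpow (by linarith) (by norm_num)
    rw [hsplit]
    split_ifs with hlt
    · rw [div_le_iff₀ (by linarith)]
      have : 1 ≤ 3 * ((p : ℝ)⁻¹) * (p - 2) := by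
        have : 3 * ((p : ℝ)⁻¹) * (p - 2) = 3 * (p - 2) / p := by field_simp
        rw [this, le_div_iff₀ (by linarith)]
        linarith
      calc (1 : ℝ) ≤ 1 * (3 * ((p : ℝ)⁻¹) * (p - 2)) := by linarith
        _ ≤ (p : ℝ) ^ (1 / 100 : ℝ) * (3 * ((p : ℝ)⁻¹) * (p - 2)) := by
            apply mul_le_mul_of_nonneg_right h4; linarith
        _ = _ := by ring
    · have h202 : (202 : ℝ) ≤ p := by
        push Not at hlt; exact_mod_cast hlt
      have e1 : Real.exp (1 / 100) ≤ (p : ℝ) ^ (1 / 100 : ℝ) := by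
        rw [← Real.exp_one_rpow]
        apply Real.rpow_le_rpow (Real.exp_pos _).le _ (by norm_num)
        linarith [Real.exp_one_lt_d9]
      have e2 : 1 + 1 / 100 ≤ Real.exp (1 / 100) := by
        linarith [Real.add_one_le_exp (1 / 100 : ℝ)]
      rw [one_mul, ← div_eq_mul_inv, div_le_div_iff₀ (by linarith) (by linarith)]
      nlinarith
  calc ∏ p ∈ n.primeFactors, (1 / ((p : ℝ) - 2)) ≤
      ∏ p ∈ n.primeFactors, ((if p < 202 then 3 else 1) * (p : ℝ) ^ (-(99 / 100) : ℝ)) := by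
        refine Finset.prod_le_prod (fun p hpm => ?_) h1
        have := hp p hpm
        apply div_nonneg <;> linarith
    _ = (∏ p ∈ n.primeFactors, (if p < 202 then (3 : ℝ) else 1)) * (n : ℝ) ^ (-(99 / 100) : ℝ) := by
        rw [Finset.prod_mul_distrib, Real.finsetProd_rpow _ _ (fun p _ => by positivity), ← hprod]
    _ ≤ _ := by
        gcongr
        rw [← Finset.prod_filter, Finset.prod_const]
        apply pow_le_pow_right₀ (by norm_num)
        calc _ ≤ (Finset.range 202).card := by
              apply Finset.card_le_card
              intro p hp'
              simp only [Finset.mem_filter] at hp'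
              exact Finset.mem_range.2 hp'.2
          _ = 202 := by simp

/-- Off-diagonal pairs in a residue class contribute little. -/
lemma sum_sq_fiber_le {q : ℕ} [Fact q.Prime] (S : Finset ℕ) (Q : ℕ) (hS : ∀ n ∈ S, n ≤ Q)
    (f : ℕ → ℝ) (hf : ∀ n, 0 ≤ f n) (g : ℕ → ℝ)
    (hfg : ∀ m j : ℕ, 1 ≤ j → j * q ≤ m → f m ≤ g j) :
    ∑ u : ZMod q, (∑ n ∈ S.filter (fun n : ℕ => (n : ZMod q) = u), f n) ^ 2 ≤
      ∑ n ∈ S, f n ^ 2 + 2 * ((∑ n ∈ S, f n) * ∑ j ∈ Finset.Icc 1 Q, g j) := by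
  have hqp : q.Prime := Fact.out
  have h1 : ∑ u : ZMod q, (∑ n ∈ S.filter (fun n : ℕ => (n : ZMod q) = u), f n) ^ 2 =
      ∑ n ∈ S, ∑ m ∈ S, if (n : ZMod q) = m then f n * f m else 0 := by
    rw [← Finset.sum_fiberwise S (fun n : ℕ => (n : ZMod q))]
    refine Finset.sum_congr rfl fun u _ => ?_
    rw [sq, Finset.sum_mul]
    refine Finset.sum_congr rfl fun n hn => ?_
    rw [Finset.mul_sum, Finset.sum_filter]
    refine Finset.sum_congr rfl fun m _ => ?_
    have := (Finset.mem_filter.1 hn).2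
    rw [this]
    simp only [eq_comm]
  have h2 : ∀ n m : ℕ, (if (n : ZMod q) = m then f n * f m else 0) =
      (if n = m then f n * f m else 0) + ((if n < m ∧ (n : ZMod q) = m then f n * f m else 0) +
      (if m < n ∧ (m : ZMod q) = n then f m * f n else 0)) := by
    intro n m
    rcases lt_trichotomy n m with h | h | h
    · simp [h, h.ne, h.not_gt]
    · simp [h]
    · simp [h, h.ne', h.not_gt, eq_comm, mul_comm]
  have h3 : ∑ n ∈ S, ∑ m ∈ S, (if m < n ∧ (m : ZMod q) = n then f m * f n else 0) =
      ∑ n ∈ S, ∑ m ∈ S, (if n < m ∧ (n : ZMod q) = m then f n * f m else 0) := Finset.sum_comm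
  have h4 : ∑ n ∈ S, ∑ m ∈ S, (if n < m ∧ (n : ZMod q) = m then f n * f m else 0) ≤
      (∑ n ∈ S, f n) * ∑ j ∈ Finset.Icc 1 Q, g j := by
    rw [Finset.sum_mul]
    refine Finset.sum_le_sum fun n _ => ?_
    rw [← Finset.sum_filter, ← Finset.mul_sum]
    refine mul_le_mul_of_nonneg_left ?_ (hf n)
    have hinj : Set.InjOn (fun j => n + j * q) (Finset.Icc 1 Q : Finset ℕ) := by
      intro a _ b _ h
      have : a * q = b * q := by simpa using h
      exact Nat.eq_of_mul_eq_mul_right hqp.pos this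
    calc _ ≤ ∑ m ∈ (Finset.Icc 1 Q).image (fun j => n + j * q), f m := by
          refine Finset.sum_le_sum_of_subset_of_nonneg ?_ fun m _ _ => hf m
          intro m hm
          rw [Finset.mem_filter] at hm
          obtain ⟨hmS, hlt, hcong⟩ := hm
          have hdvd : q ∣ m - n := by
            rw [ZMod.natCast_eq_natCast_iff] at hcong
            exact (Nat.modEq_iff_dvd' hlt.le).1 hcong
          obtain ⟨j, hj⟩ := hdvd
          rw [Finset.mem_image]
          refine ⟨j, Finset.mem_Icc.2 ⟨?_, ?_⟩, ?_⟩
          · rcases Nat.eq_zero_or_pos j with h0 | h0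
            · subst h0; omega
            · exact h0
          · have := hS m hmS
            have : j ≤ q * j := Nat.le_mul_of_pos_left j hqp.pos
            omega
          · rw [mul_comm j q, ← hj]; omega
      _ = ∑ j ∈ Finset.Icc 1 Q, f (n + j * q) := Finset.sum_image hinj
      _ ≤ _ := Finset.sum_le_sum fun j hj => hfg _ _ (Finset.mem_Icc.1 hj).1 (by omega)
  have h5 : ∑ n ∈ S, ∑ m ∈ S, (if n = m then f n * f m else 0) = ∑ n ∈ S, f n ^ 2 := by
    refine Finset.sum_congr rfl fun n hn => ?_
    rw [Finset.sum_ite_eq, if_pos hn, sq]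
  rw [h1]
  simp only [h2, Finset.sum_add_distrib]
  rw [h3, h5]
  linarith

/-- The mean square of the tail of the sawtooth expansion. -/
theorem exists_sum_sq_tail_le : ∃ K : ℝ, 0 ≤ K ∧ ∀ (q : ℕ) [Fact q.Prime] (N : ℕ), 1 ≤ N →
    ∑ κ : ZMod q, (∑ n ∈ (Finset.Ioc N (q ^ 9)).filter (fun n : ℕ => (n : ZMod q) ≠ 0),
      hw n * bz (κ * (n : ZMod q)⁻¹)) ^ 2 ≤
    K * q * (1 + Real.log q) ^ 2 *
      ((N : ℝ) ^ (-(1 / 2) : ℝ) + (q : ℝ) ^ (-(1 / 2) : ℝ)) := by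
  obtain ⟨K, hK, hh⟩ := exists_hw_le_rpow
  have hsum : Summable fun n : ℕ => (n : ℝ) ^ (-(101 / 100) : ℝ) :=
    Real.summable_nat_rpow.2 (by norm_num)
  set Z := ∑' n : ℕ, (n : ℝ) ^ (-(101 / 100) : ℝ) with hZ
  have hZ0 : 0 ≤ Z := tsum_nonneg fun n => by positivity
  have hZle : ∀ s : Finset ℕ, ∑ n ∈ s, (n : ℝ) ^ (-(101 / 100) : ℝ) ≤ Z := fun s =>
    hsum.sum_le_tsum s fun n _ => by positivity
  have hgrow : ∀ (s : Finset ℕ) (Q : ℕ), (∀ n ∈ s, 1 ≤ n ∧ n ≤ Q) →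
      ∑ n ∈ s, (n : ℝ) ^ (-(99 / 100) : ℝ) ≤ (Q : ℝ) ^ (1 / 50 : ℝ) * Z := by
    intro s Q hs
    refine le_trans ?_ (mul_le_mul_of_nonneg_left (hZle s) (by positivity))
    rw [Finset.mul_sum]
    refine Finset.sum_le_sum fun n hn => ?_
    obtain ⟨h1, h2⟩ := hs n hn
    have hn0 : (0 : ℝ) < n := by exact_mod_cast h1
    calc (n : ℝ) ^ (-(99 / 100) : ℝ) = (n : ℝ) ^ (1 / 50 : ℝ) * (n : ℝ) ^ (-(101 / 100) : ℝ) := by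
          rw [← Real.rpow_add hn0]; norm_num
      _ ≤ _ := by
          gcongr
  refine ⟨K ^ 2 * Z + 2 * (K * Z * (K * Z)), by positivity, fun q _ N hN => ?_⟩
  have hqp : q.Prime := Fact.out
  have hq : (1 : ℝ) ≤ q := by exact_mod_cast hqp.one_le
  have hq0 : (0 : ℝ) < q := by linarith
  have hN0 : (0 : ℝ) < N := by exact_mod_cast hN
  have hlog : 0 ≤ Real.log q := Real.log_natCast_nonneg q
  set S := (Finset.Ioc N (q ^ 9)).filter (fun n : ℕ => (n : ZMod q) ≠ 0) with hS
  have hSm : ∀ n ∈ S, N < n ∧ n ≤ q ^ 9 := fun n hn =>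
    Finset.mem_Ioc.1 (Finset.mem_filter.1 hn).1
  set W : ZMod q → ℝ := fun u => ∑ n ∈ S.filter (fun n : ℕ => (n : ZMod q) = u), hw n with hW
  have h1 : ∀ κ : ZMod q, ∑ n ∈ S, hw n * bz (κ * (n : ZMod q)⁻¹) =
      ∑ u : ZMod q, W u * bz (κ * u⁻¹) := by
    intro κ
    rw [← Finset.sum_fiberwise S (fun n : ℕ => (n : ZMod q))]
    refine Finset.sum_congr rfl fun u _ => ?_
    rw [hW, Finset.sum_mul]
    exact Finset.sum_congr rfl fun n hn => by rw [(Finset.mem_filter.1 hn).2]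
  simp only [h1]
  refine (sum_sq_sum_bz_le W).trans ?_
  have h2 := sum_sq_fiber_le (q := q) S (q ^ 9) (fun n hn => (hSm n hn).2) hw hw_nonneg
    (fun j => K * ((j : ℝ) * q) ^ (-(99 / 100) : ℝ)) (by
      intro m j hj hm
      have hm1 : 1 ≤ m := by
        have := Nat.mul_le_mul hj hqp.one_le
        omega
      refine (hh m hm1).trans ?_
      refine mul_le_mul_of_nonneg_left ?_ hK
      refine Real.rpow_le_rpow_of_nonpos ?_ (by exact_mod_cast hm) (by norm_num)
      have : (0 : ℝ) < j := by exact_mod_cast hj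
      positivity)
  have h3 : ∑ n ∈ S, hw n ^ 2 ≤ K ^ 2 * Z * (N : ℝ) ^ (-(1 / 2) : ℝ) := by
    calc ∑ n ∈ S, hw n ^ 2 ≤ ∑ n ∈ S, K ^ 2 * (N : ℝ) ^ (-(1 / 2) : ℝ) *
          (n : ℝ) ^ (-(101 / 100) : ℝ) := by
          refine Finset.sum_le_sum fun n hn => ?_
          obtain ⟨a1, a2⟩ := hSm n hn
          have hn1 : (1 : ℝ) ≤ n := by exact_mod_cast (show 1 ≤ n by omega)
          have hn0 : (0 : ℝ) < n := by linarith
          calc hw n ^ 2 ≤ (K * (n : ℝ) ^ (-(99 / 100) : ℝ)) ^ 2 :=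
                pow_le_pow_left₀ (hw_nonneg n) (hh n (by omega)) 2
            _ = K ^ 2 * (n : ℝ) ^ (-(198 / 100) : ℝ) := by
                rw [mul_pow, ← Real.rpow_natCast ((n : ℝ) ^ _), ← Real.rpow_mul hn0.le]
                norm_num
            _ ≤ K ^ 2 * ((n : ℝ) ^ (-(1 / 2) : ℝ) * (n : ℝ) ^ (-(101 / 100) : ℝ)) := by
                rw [← Real.rpow_add hn0]
                gcongr
                · norm_num
            _ ≤ K ^ 2 * ((N : ℝ) ^ (-(1 / 2) : ℝ) * (n : ℝ) ^ (-(101 / 100) : ℝ)) := by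
                gcongr K ^ 2 * (?_ * _)
                exact Real.rpow_le_rpow_of_nonpos hN0 (by exact_mod_cast a1.le) (by norm_num)
            _ = _ := by ring
      _ = K ^ 2 * (N : ℝ) ^ (-(1 / 2) : ℝ) * ∑ n ∈ S, (n : ℝ) ^ (-(101 / 100) : ℝ) := by
          rw [Finset.mul_sum]
      _ ≤ K ^ 2 * (N : ℝ) ^ (-(1 / 2) : ℝ) * Z := by
          gcongr
          exact hZle S
      _ = _ := by ring
  have h4 : ∑ n ∈ S, hw n ≤ K * ((((q ^ 9 : ℕ) : ℝ)) ^ (1 / 50 : ℝ) * Z) := by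
    calc ∑ n ∈ S, hw n ≤ ∑ n ∈ S, K * (n : ℝ) ^ (-(99 / 100) : ℝ) :=
          Finset.sum_le_sum fun n hn => hh n (by have := hSm n hn; omega)
      _ = K * ∑ n ∈ S, (n : ℝ) ^ (-(99 / 100) : ℝ) := by rw [Finset.mul_sum]
      _ ≤ _ := by
          gcongr
          exact hgrow S _ fun n hn => by have := hSm n hn; omega
  have h5 : ∑ j ∈ Finset.Icc 1 (q ^ 9), K * ((j : ℝ) * q) ^ (-(99 / 100) : ℝ) ≤
      K * ((q : ℝ) ^ (-(99 / 100) : ℝ) * ((((q ^ 9 : ℕ) : ℝ)) ^ (1 / 50 : ℝ) * Z)) := by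
    rw [← Finset.mul_sum]
    gcongr
    calc _ = (q : ℝ) ^ (-(99 / 100) : ℝ) * ∑ j ∈ Finset.Icc 1 (q ^ 9), (j : ℝ) ^ (-(99 / 100) : ℝ) := by
          rw [Finset.mul_sum]
          refine Finset.sum_congr rfl fun j _ => ?_
          rw [Real.mul_rpow (by positivity) hq0.le, mul_comm]
      _ ≤ _ := by
          gcongr
          exact hgrow _ _ fun n hn => Finset.mem_Icc.1 hn
  have h6 : (((q ^ 9 : ℕ) : ℝ)) ^ (1 / 50 : ℝ) = (q : ℝ) ^ (9 / 50 : ℝ) := by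
    push_cast
    rw [← Real.rpow_natCast, ← Real.rpow_mul hq0.le]
    norm_num
  rw [h6] at h4 h5
  have h7 : (q : ℝ) ^ (9 / 50 : ℝ) * ((q : ℝ) ^ (-(99 / 100) : ℝ) * (q : ℝ) ^ (9 / 50 : ℝ)) ≤
      (q : ℝ) ^ (-(1 / 2) : ℝ) := by
    rw [← Real.rpow_add hq0, ← Real.rpow_add hq0]
    exact Real.rpow_le_rpow_of_exponent_le hq (by norm_num)
  have h8 : (∑ n ∈ S, hw n) * ∑ j ∈ Finset.Icc 1 (q ^ 9), K * ((j : ℝ) * q) ^ (-(99 / 100) : ℝ) ≤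
      K * Z * (K * Z) * (q : ℝ) ^ (-(1 / 2) : ℝ) := by
    calc _ ≤ K * ((q : ℝ) ^ (9 / 50 : ℝ) * Z) *
          (K * ((q : ℝ) ^ (-(99 / 100) : ℝ) * ((q : ℝ) ^ (9 / 50 : ℝ) * Z))) := by
          refine mul_le_mul h4 h5 ?_ (by positivity)
          exact Finset.sum_nonneg fun _ _ => by positivity
      _ = K * Z * (K * Z) * ((q : ℝ) ^ (9 / 50 : ℝ) *
          ((q : ℝ) ^ (-(99 / 100) : ℝ) * (q : ℝ) ^ (9 / 50 : ℝ))) := by ring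
      _ ≤ _ := by gcongr
  have h9 : ∑ u, W u ^ 2 ≤ (K ^ 2 * Z + 2 * (K * Z * (K * Z))) *
      ((N : ℝ) ^ (-(1 / 2) : ℝ) + (q : ℝ) ^ (-(1 / 2) : ℝ)) := by
    have b1 : 0 ≤ (N : ℝ) ^ (-(1 / 2) : ℝ) := by positivity
    have b2 : 0 ≤ (q : ℝ) ^ (-(1 / 2) : ℝ) := by positivity
    have b3 : 0 ≤ K ^ 2 * Z := by positivity
    have b4 : 0 ≤ K * Z * (K * Z) := by positivity
    nlinarith [mul_nonneg b3 b2, mul_nonneg b4 b1]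
  calc _ ≤ (1 + Real.log q) ^ 2 * (q * ((K ^ 2 * Z + 2 * (K * Z * (K * Z))) *
      ((N : ℝ) ^ (-(1 / 2) : ℝ) + (q : ℝ) ^ (-(1 / 2) : ℝ)))) := by gcongr
    _ = _ := by ring

/-- Odd primes below `y`. -/
def oddPrimesBelow (y : ℕ) : Finset ℕ := y.primesBelow.erase 2

/-- The product of the odd primes below `y`. -/
def oddPrimorial (y : ℕ) : ℕ := ∏ p ∈ oddPrimesBelow y, p

lemma mem_oddPrimesBelow {y p : ℕ} : p ∈ oddPrimesBelow y ↔ p.Prime ∧ p ≠ 2 ∧ p < y := by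
  rw [oddPrimesBelow, Finset.mem_erase, Nat.mem_primesBelow]
  tauto

lemma oddPrimorial_pos (y : ℕ) : 0 < oddPrimorial y :=
  Finset.prod_pos fun _ hp => (mem_oddPrimesBelow.1 hp).1.pos

lemma primeFactors_oddPrimorial (y : ℕ) : (oddPrimorial y).primeFactors = oddPrimesBelow y :=
  Nat.primeFactors_prod fun _ hp => (mem_oddPrimesBelow.1 hp).1

lemma squarefree_oddPrimorial (y : ℕ) : Squarefree (oddPrimorial y) := by
  have h : oddPrimorial y ∣ primorial y := by
    rw [primorial_eq_prod_primesLE]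
    refine Finset.prod_dvd_prod_of_subset _ _ _ fun p hp => ?_
    have := mem_oddPrimesBelow.1 hp
    exact Nat.mem_primesLE.2 ⟨this.2.2.le, this.1⟩
  exact (squarefree_primorial y).squarefree_of_dvd h

lemma oddPrimorial_le_four_pow (y : ℕ) : oddPrimorial y ≤ 4 ^ y := by
  refine le_trans ?_ (primorial_le_four_pow y)
  refine Nat.le_of_dvd (primorial_pos y) ?_
  rw [primorial_eq_prod_primesLE]
  refine Finset.prod_dvd_prod_of_subset _ _ _ fun p hp => ?_
  have := mem_oddPrimesBelow.1 hp
  exact Nat.mem_primesLE.2 ⟨this.2.2.le, this.1⟩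

lemma dvd_oddPrimorial {n y : ℕ} (hodd : Odd n) (hsq : Squarefree n)
    (h : ∀ p ∈ n.primeFactors, p < y) : n ∣ oddPrimorial y := by
  rw [← Nat.prod_primeFactors_of_squarefree hsq]
  refine Finset.prod_dvd_prod_of_subset _ _ _ fun p hp => ?_
  refine mem_oddPrimesBelow.2 ⟨Nat.prime_of_mem_primeFactors hp, ?_, h p hp⟩
  rintro rfl
  exact hodd.not_two_dvd_nat (Nat.dvd_of_mem_primeFactors hp)

lemma oddPrimorial_dvd {y z : ℕ} (h : y ≤ z) : oddPrimorial y ∣ oddPrimorial z := by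
  refine Finset.prod_dvd_prod_of_subset _ _ _ fun p hp => ?_
  have := mem_oddPrimesBelow.1 hp
  exact mem_oddPrimesBelow.2 ⟨this.1, this.2.1, this.2.2.trans_le h⟩

lemma oddPrimesBelow_succ_of_prime {p : ℕ} (hp : p.Prime) (h2 : p ≠ 2) :
    oddPrimesBelow (p + 1) = insert p (oddPrimesBelow p) := by
  ext r
  simp only [Finset.mem_insert, mem_oddPrimesBelow]
  constructor
  · rintro ⟨a, b, c⟩
    rcases Nat.lt_succ_iff_lt_or_eq.1 c with h | h
    · exact Or.inr ⟨a, b, h⟩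
    · exact Or.inl h
  · rintro (rfl | ⟨a, b, c⟩)
    · exact ⟨hp, h2, by omega⟩
    · exact ⟨a, b, by omega⟩

lemma oddPrimorial_succ_of_prime {p : ℕ} (hp : p.Prime) (h2 : p ≠ 2) :
    oddPrimorial (p + 1) = p * oddPrimorial p := by
  unfold oddPrimorial
  rw [oddPrimesBelow_succ_of_prime hp h2, Finset.prod_insert]
  intro h
  exact (mem_oddPrimesBelow.1 h).2.2.false

lemma oddPrimesBelow_succ_of_not {z : ℕ} (h : ¬ (z.Prime ∧ z ≠ 2)) :
    oddPrimesBelow (z + 1) = oddPrimesBelow z := by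
  ext r
  simp only [mem_oddPrimesBelow]
  constructor
  · rintro ⟨a, b, c⟩
    refine ⟨a, b, ?_⟩
    rcases Nat.lt_succ_iff_lt_or_eq.1 c with h' | h'
    · exact h'
    · subst h'; exact absurd ⟨a, b⟩ h
  · rintro ⟨a, b, c⟩
    exact ⟨a, b, by omega⟩

lemma oddPrimorial_succ_of_not {z : ℕ} (h : ¬ (z.Prime ∧ z ≠ 2)) :
    oddPrimorial (z + 1) = oddPrimorial z := by
  unfold oddPrimorial
  rw [oddPrimesBelow_succ_of_not h]

lemma not_dvd_oddPrimorial {p y : ℕ} (hp : p.Prime) (h : y ≤ p) : ¬ p ∣ oddPrimorial y := by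
  intro hd
  have : p ∈ (oddPrimorial y).primeFactors :=
    Nat.mem_primeFactors.2 ⟨hp, hd, (oddPrimorial_pos y).ne'⟩
  rw [primeFactors_oddPrimorial] at this
  have := (mem_oddPrimesBelow.1 this).2.2
  omega

/-- The Euler product `∏_{2<p<y} (p-1)/(p-2)`. -/
noncomputable def P2 (y : ℕ) : ℝ := ∏ p ∈ oddPrimesBelow y, (1 + 1 / ((p : ℝ) - 2))

lemma sum_divisors_hw (y : ℕ) : ∑ d ∈ (oddPrimorial y).divisors, hw d = P2 y := by
  have hm : ArithmeticFunction.IsMultiplicative (⟨hw, hw_zero⟩ : ArithmeticFunction ℝ) :=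
    ⟨hw_one, fun {m n} h => hw_mul h⟩
  have := hm.prodPrimeFactors_one_add_of_squarefree (squarefree_oddPrimorial y)
  rw [primeFactors_oddPrimorial] at this
  simp only [ArithmeticFunction.coe_mk] at this
  rw [← this, P2]
  refine Finset.prod_congr rfl fun p hp => ?_
  have := mem_oddPrimesBelow.1 hp
  rw [hw_prime this.1 this.2.1]

lemma sum_divisors_sdiff_hw {p : ℕ} (hp : p.Prime) (h2 : p ≠ 2) :
    ∑ d ∈ (oddPrimorial (p + 1)).divisors \ (oddPrimorial p).divisors, hw d =
      1 / ((p : ℝ) - 2) * P2 p := by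
  have hsub : (oddPrimorial p).divisors ⊆ (oddPrimorial (p + 1)).divisors :=
    Nat.divisors_subset_of_dvd (oddPrimorial_pos _).ne' (oddPrimorial_dvd (by omega))
  have h1 := Finset.sum_sdiff (f := hw) hsub
  rw [sum_divisors_hw, sum_divisors_hw] at h1
  have h3 : P2 (p + 1) = (1 + 1 / ((p : ℝ) - 2)) * P2 p := by
    unfold P2
    rw [oddPrimesBelow_succ_of_prime hp h2, Finset.prod_insert]
    intro h
    exact (mem_oddPrimesBelow.1 h).2.2.false
  linarith

lemma one_le_P2 (y : ℕ) : 1 ≤ P2 y := by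
  unfold P2
  refine Finset.prod_induction _ (fun x : ℝ => 1 ≤ x) (fun a b ha hb => by nlinarith) le_rfl ?_
  intro p hp
  have := mem_oddPrimesBelow.1 hp
  have h3 := two_lt_of_prime this.1 this.2.1
  have : 0 ≤ 1 / ((p : ℝ) - 2) := by
    apply div_nonneg <;> linarith
  linarith

lemma C2_ge (q : ℕ) : 3 / 8 ≤ C2 q := by
  have h := prod_mul_le_C2 q (y := 4) (by norm_num)
  have h1 : Nat.primesBelow 4 = {2, 3} := by decide
  rw [h1, Finset.prod_pair (by norm_num)] at h
  have h2 : cfac q 2 = 1 := by simp [cfac]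
  have h3 : 3 / 4 ≤ cfac q 3 := by
    unfold cfac
    split_ifs <;> norm_num
  rw [h2] at h
  norm_num at h
  linarith

/-- `∏_{p<y} (1-1/p)^{-1}` in terms of `P2`. -/
lemma prod_inv_eq {q y : ℕ} (hy : 3 ≤ y) (hq : ∀ p, p.Prime → p < y → ¬ p ∣ q) :
    (∏ p ∈ y.primesBelow, cfac q p) * P2 y =
      1 / 2 * ∏ p ∈ y.primesBelow, (1 - (1 : ℝ) / p)⁻¹ := by
  have h2 : 2 ∈ y.primesBelow := Nat.mem_primesBelow.2 ⟨by omega, Nat.prime_two⟩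
  rw [← Finset.mul_prod_erase _ (cfac q) h2, ← Finset.mul_prod_erase _ (fun p : ℕ => (1 - (1 : ℝ) / p)⁻¹) h2]
  have hc2 : cfac q 2 = 1 := by simp [cfac]
  rw [hc2, one_mul, P2, oddPrimesBelow, ← Finset.prod_mul_distrib, ← mul_assoc]
  have h12 : (1 / 2 : ℝ) * (1 - 1 / ((2 : ℕ) : ℝ))⁻¹ = 1 := by norm_num
  rw [h12, one_mul]
  refine Finset.prod_congr rfl fun p hp => ?_
  obtain ⟨a, b, c⟩ := mem_oddPrimesBelow.1 hp
  have h3 := two_lt_of_prime a b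
  rw [cfac, if_neg (by simp [b, hq p a c])]
  have e1 : (p : ℝ) - 1 ≠ 0 := by linarith
  have e2 : (p : ℝ) - 2 ≠ 0 := by linarith
  have e3 : (p : ℝ) ≠ 0 := by linarith
  have e4 : 1 - 1 / (p : ℝ) = (p - 1) / p := by field_simp
  rw [e4, inv_div]
  field_simp
  ring

/-- Mertens' theorem for primes below `y`. -/
lemma exists_mertens_primesBelow : ∃ C : ℝ, 0 ≤ C ∧ ∀ y : ℕ, 3 ≤ y →
    Real.exp Real.eulerMascheroniConstant * (Real.log y - C) ≤
      ∏ p ∈ y.primesBelow, (1 - (1 : ℝ) / p)⁻¹ ∧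
    ∏ p ∈ y.primesBelow, (1 - (1 : ℝ) / p)⁻¹ ≤
      Real.exp Real.eulerMascheroniConstant * (Real.log y + C) := by
  obtain ⟨C, hC, h⟩ := Mertens.mertens_third
  refine ⟨C + 1, by linarith, fun y hy => ?_⟩
  obtain ⟨h1, h2⟩ := h (y - 1) (by omega)
  rw [← Nat.primesBelow_eq_primesLE_sub_one] at h1 h2
  have hy1 : (2 : ℝ) ≤ ((y - 1 : ℕ) : ℝ) := by exact_mod_cast (show 2 ≤ y - 1 by omega)
  have hyc : ((y - 1 : ℕ) : ℝ) = y - 1 := by rw [Nat.cast_sub (by omega)]; simp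
  have hle : Real.log ((y - 1 : ℕ) : ℝ) ≤ Real.log y :=
    Real.log_le_log (by linarith) (by rw [hyc]; linarith)
  have hge : Real.log y - 1 ≤ Real.log ((y - 1 : ℕ) : ℝ) := by
    have : Real.log y ≤ Real.log (Real.exp 1 * ((y - 1 : ℕ) : ℝ)) := by
      refine Real.log_le_log (by rw [hyc] at hy1; linarith) ?_
      have := Real.add_one_le_exp (1 : ℝ)
      rw [hyc] at hy1 ⊢
      nlinarith
    rw [Real.log_mul (Real.exp_ne_zero _) (by linarith), Real.log_exp] at this
    linarith
  have he := Real.exp_pos Real.eulerMascheroniConstant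
  constructor
  · refine le_trans (mul_le_mul_of_nonneg_left ?_ he.le) h1
    linarith
  · refine h2.trans (mul_le_mul_of_nonneg_left ?_ he.le)
    linarith

lemma exists_P2_le : ∃ K : ℝ, 0 ≤ K ∧ ∀ y : ℕ, 3 ≤ y → P2 y ≤ K * Real.log y := by
  obtain ⟨C, hC, h⟩ := exists_mertens_primesBelow
  refine ⟨4 / 3 * (Real.exp Real.eulerMascheroniConstant * (1 + C)), by positivity, fun y hy => ?_⟩
  have h1 := (h y hy).2
  have h2 := prod_inv_eq (q := 1) hy (fun p hp _ => hp.one_lt.ne' ∘ Nat.dvd_one.1)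
  have h3 := C2_le_prod_primesBelow 1 y
  have h4 := C2_ge 1
  have h5 := one_le_P2 y
  have hlog : 1 ≤ Real.log y := by
    rw [Real.le_log_iff_exp_le (by positivity)]
    have : (3 : ℝ) ≤ y := by exact_mod_cast hy
    linarith [Real.exp_one_lt_d9]
  have he := Real.exp_pos Real.eulerMascheroniConstant
  have h6 : 3 / 8 * P2 y ≤ (∏ p ∈ y.primesBelow, cfac 1 p) * P2 y := by
    gcongr; linarith
  have h7 : Real.log y + C ≤ (1 + C) * Real.log y := by nlinarith
  have h8 := mul_le_mul_of_nonneg_left h7 he.le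
  nlinarith

/-- The normalised fractional part `{x} - 1/2`. -/
noncomputable def sB (x : ℝ) : ℝ := Int.fract x - 1 / 2

lemma abs_sB_le (x : ℝ) : |sB x| ≤ 1 / 2 := by
  unfold sB
  have h1 := Int.fract_nonneg x
  have h2 := (Int.fract_lt_one x).le
  rw [abs_le]; constructor <;> linarith

lemma sB_add_int (x : ℝ) (m : ℤ) : sB (x + m) = sB x := by simp [sB]

lemma measurable_sB : Measurable sB := measurable_fract.sub_const _

/-- Bounded measurable functions of period one. -/
structure Nice (f : ℝ → ℝ) : Prop where
  meas : Measurable f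
  bdd : ∃ C, ∀ x, |f x| ≤ C
  per : ∀ x, f (x + 1) = f x

namespace Nice

variable {f g : ℝ → ℝ}

lemma intervalIntegrable (hf : Nice f) (a b : ℝ) : IntervalIntegrable f volume a b := by
  obtain ⟨C, hC⟩ := hf.bdd
  rw [intervalIntegrable_iff]
  refine Measure.integrableOn_of_bounded (M := C) ?_ hf.meas.aestronglyMeasurable ?_
  · simp
  · exact Filter.Eventually.of_forall fun x => by rw [Real.norm_eq_abs]; exact hC x

lemma periodic (hf : Nice f) : Function.Periodic f 1 := hf.per

lemma const (c : ℝ) : Nice fun _ => c := ⟨measurable_const, ⟨|c|, fun _ => le_rfl⟩, fun _ => rfl⟩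

lemma add (hf : Nice f) (hg : Nice g) : Nice fun x => f x + g x := by
  obtain ⟨C, hC⟩ := hf.bdd
  obtain ⟨D, hD⟩ := hg.bdd
  exact ⟨hf.meas.add hg.meas, ⟨C + D, fun x => (abs_add_le _ _).trans (add_le_add (hC x) (hD x))⟩,
    fun x => by rw [hf.per, hg.per]⟩

lemma mul (hf : Nice f) (hg : Nice g) : Nice fun x => f x * g x := by
  obtain ⟨C, hC⟩ := hf.bdd
  obtain ⟨D, hD⟩ := hg.bdd
  refine ⟨hf.meas.mul hg.meas, ⟨C * D, fun x => ?_⟩, fun x => by rw [hf.per, hg.per]⟩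
  rw [abs_mul]
  exact mul_le_mul (hC x) (hD x) (abs_nonneg _) ((abs_nonneg _).trans (hC x))

lemma const_mul (c : ℝ) (hf : Nice f) : Nice fun x => c * f x := (const c).mul hf

lemma sum {ι : Type*} (s : Finset ι) {F : ι → ℝ → ℝ} (h : ∀ i ∈ s, Nice (F i)) :
    Nice fun x => ∑ i ∈ s, F i x := by
  induction s using Finset.induction_on with
  | empty => simpa using const 0
  | insert a s ha ih =>
    simp only [Finset.sum_insert ha]
    exact (h a (Finset.mem_insert_self a s)).add
      (ih fun i hi => h i (Finset.mem_insert_of_mem hi))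

lemma prod {ι : Type*} (s : Finset ι) {F : ι → ℝ → ℝ} (h : ∀ i ∈ s, Nice (F i)) :
    Nice fun x => ∏ i ∈ s, F i x := by
  induction s using Finset.induction_on with
  | empty => simpa using const 1
  | insert a s ha ih =>
    simp only [Finset.prod_insert ha]
    exact (h a (Finset.mem_insert_self a s)).mul
      (ih fun i hi => h i (Finset.mem_insert_of_mem hi))

lemma pow (hf : Nice f) (k : ℕ) : Nice fun x => f x ^ k := by
  induction k with
  | zero => simpa using const 1
  | succ k ih => simpa only [pow_succ] using ih.mul hf

lemma exp (hf : Nice f) : Nice fun x => Real.exp (f x) := by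
  obtain ⟨C, hC⟩ := hf.bdd
  refine ⟨hf.meas.exp, ⟨Real.exp C, fun x => ?_⟩, fun x => by rw [hf.per]⟩
  rw [abs_of_pos (Real.exp_pos _)]
  exact Real.exp_le_exp.2 ((le_abs_self _).trans (hC x))

lemma comp_add (hf : Nice f) (t : ℝ) : Nice fun x => f (x + t) := by
  obtain ⟨C, hC⟩ := hf.bdd
  refine ⟨hf.meas.comp (measurable_id.add_const t), ⟨C, fun x => hC _⟩, fun x => ?_⟩
  rw [add_right_comm, hf.per]

lemma comp_mul (hf : Nice f) (c : ℕ) : Nice fun x => f (c * x) := by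
  obtain ⟨C, hC⟩ := hf.bdd
  refine ⟨hf.meas.comp (measurable_const.mul measurable_id), ⟨C, fun x => hC _⟩, fun x => ?_⟩
  have := hf.periodic.nat_mul c (c * x)
  rw [mul_one] at this
  rw [mul_add, mul_one, this]

lemma sB : Nice sB :=
  ⟨measurable_sB, ⟨1 / 2, abs_sB_le⟩, fun x => by simpa using sB_add_int x 1⟩

lemma sB_mul_add (m : ℕ) (β : ℝ) : Nice fun x => DirL.sB (m * x + β) :=
  (Nice.sB.comp_add β).comp_mul m

end Nice

/-- The mean of a function over a period. -/
noncomputable def avg (f : ℝ → ℝ) : ℝ := ∫ x in (0 : ℝ)..1, f x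

lemma avg_const (c : ℝ) : avg (fun _ => c) = c := by simp [avg]

lemma avg_add {f g : ℝ → ℝ} (hf : Nice f) (hg : Nice g) :
    avg (fun x => f x + g x) = avg f + avg g :=
  intervalIntegral.integral_add (hf.intervalIntegrable _ _) (hg.intervalIntegrable _ _)

lemma avg_const_mul (c : ℝ) (f : ℝ → ℝ) : avg (fun x => c * f x) = c * avg f :=
  intervalIntegral.integral_const_mul _ _

lemma avg_sum {ι : Type*} (s : Finset ι) {F : ι → ℝ → ℝ} (h : ∀ i ∈ s, Nice (F i)) :
    avg (fun x => ∑ i ∈ s, F i x) = ∑ i ∈ s, avg (F i) :=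
  intervalIntegral.integral_finsetSum fun i hi => (h i hi).intervalIntegrable _ _

lemma avg_mono {f g : ℝ → ℝ} (hf : Nice f) (hg : Nice g) (h : ∀ x, f x ≤ g x) : avg f ≤ avg g :=
  intervalIntegral.integral_mono zero_le_one (hf.intervalIntegrable _ _)
    (hg.intervalIntegrable _ _) h

lemma avg_shift {f : ℝ → ℝ} (hf : Nice f) (t : ℝ) : avg (fun x => f (x + t)) = avg f := by
  unfold avg
  rw [intervalIntegral.integral_comp_add_right, zero_add, add_comm 1 t,
    hf.periodic.intervalIntegral_add_eq t 0, zero_add]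

lemma avg_comp_mul {f : ℝ → ℝ} (hf : Nice f) {c : ℕ} (hc : 0 < c) :
    avg (fun x => f (c * x)) = avg f := by
  have hc' : (c : ℝ) ≠ 0 := by exact_mod_cast hc.ne'
  unfold avg
  rw [intervalIntegral.integral_comp_mul_left _ hc', mul_zero, mul_one]
  have := hf.periodic.intervalIntegral_add_zsmul_eq (c : ℤ) 0 fun a b => hf.intervalIntegrable a b
  simp only [zero_add, zsmul_eq_mul, Int.cast_natCast, mul_one] at this
  rw [this, smul_eq_mul, inv_mul_cancel_left₀ hc']

lemma sum_bz (p : ℕ) [Fact p.Prime] : ∑ a : ZMod p, bz a = -(1 / 2) := by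
  have h1 := sum_bz_ne_zero (q := p)
  have h2 : ∀ a : ZMod p, bz a = (if a = 0 then 0 else bz a) + if a = 0 then bz a else 0 := by
    intro a; split_ifs <;> simp
  rw [Finset.sum_congr rfl fun a _ => h2 a, Finset.sum_add_distrib, h1]
  simp [bz]

lemma sB_add_div {p : ℕ} [Fact p.Prime] {s : ℝ} (h0 : 0 ≤ s) (h1 : s < 1 / p) (k : ℤ) :
    sB (s + k / p) = s + bz (k : ZMod p) := by
  have hp : (0 : ℝ) < p := by exact_mod_cast (Fact.out : p.Prime).pos
  set v := ((k : ZMod p)).val with hv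
  have hvk : ((v : ℤ) : ZMod p) = (k : ZMod p) := by rw [hv]; simp
  rw [ZMod.intCast_eq_intCast_iff_dvd_sub] at hvk
  obtain ⟨m, hm⟩ := hvk
  have hk : (k : ℝ) = v + p * m := by
    have : k = v + p * m := by linarith
    rw [this]; push_cast; ring
  have e : s + (k : ℝ) / p = (s + v / p) + (m : ℤ) := by
    rw [hk]; field_simp; ring
  rw [e, sB_add_int, sB, bz, Int.fract_eq_self.2]
  · ring
  · have hlt : (v : ℝ) + 1 ≤ p := by
      exact_mod_cast (ZMod.val_lt (k : ZMod p))
    constructor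
    · positivity
    · have : s * p < 1 := by rwa [lt_div_iff₀ hp] at h1
      have e2 : s + v / p = (s * p + v) / p := by field_simp
      rw [e2, div_lt_one hp]
      linarith

/-- Averaging the sawtooth over a coset of `(1/p)ℤ/ℤ`. -/
lemma sum_sB_shift {p : ℕ} [Fact p.Prime] {a : ℕ} (ha : ¬ p ∣ a) (t : ℝ) :
    ∑ j ∈ Finset.range p, sB (t + a * (j / p)) = sB (p * t) := by
  have hp : (0 : ℝ) < p := by exact_mod_cast (Fact.out : p.Prime).pos
  set m := ⌊p * t⌋ with hm
  set s := t - m / p with hs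
  have hps : p * s = Int.fract (p * t) := by
    rw [Int.fract, ← hm, hs]; field_simp
  have hs0 : 0 ≤ s := by
    have := Int.fract_nonneg (p * t)
    rw [← hps] at this
    exact nonneg_of_mul_nonneg_right this hp
  have hs1 : s < 1 / p := by
    have := Int.fract_lt_one (p * t)
    rw [← hps] at this
    rw [lt_div_iff₀ hp]; linarith
  have h1 : ∀ j : ℕ, sB (t + a * (j / p)) = s + bz ((m : ZMod p) + (a : ZMod p) * (j : ZMod p)) := by
    intro j
    have : t + a * ((j : ℝ) / p) = s + ((m + a * j : ℤ) : ℝ) / p := by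
      rw [hs]; push_cast; field_simp; ring
    rw [this, sB_add_div hs0 hs1]
    push_cast
    rfl
  simp only [h1]
  rw [sum_range_eq_sum_zmod (fun x : ZMod p => s + bz ((m : ZMod p) + (a : ZMod p) * x)),
    Finset.sum_add_distrib]
  have ha0 : (a : ZMod p) ≠ 0 := by rwa [Ne, ZMod.natCast_eq_zero_iff]
  have h2 : ∑ x : ZMod p, bz ((m : ZMod p) + (a : ZMod p) * x) = -(1 / 2) := by
    rw [← sum_bz p]
    exact Equiv.sum_comp ((Equiv.mulLeft₀ (a : ZMod p) ha0).trans (Equiv.addLeft (m : ZMod p))) bz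
  rw [h2, Finset.sum_const, Finset.card_univ, ZMod.card, nsmul_eq_mul, hps, sB]
  ring

lemma exp_le_add_exp_sq (x : ℝ) : Real.exp x ≤ x + Real.exp (x ^ 2) := by
  have h1 := Real.add_one_le_exp (x ^ 2)
  rcases le_or_gt |x| 1 with h | h
  · have := (abs_le.1 (Real.abs_exp_sub_one_sub_id_le h)).2
    linarith
  · rcases le_total 0 x with h0 | h0
    · rw [abs_of_nonneg h0] at h
      have : Real.exp x ≤ Real.exp (x ^ 2) := Real.exp_le_exp.2 (by nlinarith)
      linarith
    · rw [abs_of_nonpos h0] at h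
      have : Real.exp x ≤ 1 := Real.exp_le_one_iff.2 h0
      nlinarith

lemma avg_exp_step {p : ℕ} (hp : 0 < p) {w D : ℝ → ℝ} (hw : Nice w)
    (hw0 : ∀ x, 0 ≤ w x) (hwp : ∀ (x : ℝ) (j : ℕ), w (x + j / p) = w x) (hD : Nice D) {d : ℝ}
    (hDd : ∀ x, |D x| ≤ d) (hDs : ∀ x : ℝ, |∑ j ∈ Finset.range p, D (x + (j : ℝ) / p)| ≤ d)
    (l : ℝ) :
    avg (fun x => w x * Real.exp (l * D x)) ≤
      Real.exp (l ^ 2 * d ^ 2 + |l| * (d / p)) * avg w := by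
  have hp0 : (0 : ℝ) < p := by exact_mod_cast hp
  have hd : 0 ≤ d := (abs_nonneg _).trans (hDd 0)
  have hf : Nice fun x => w x * Real.exp (l * D x) := hw.mul (hD.const_mul l).exp
  have h1 : p * avg (fun x => w x * Real.exp (l * D x)) =
      avg (fun x => ∑ j ∈ Finset.range p, w (x + (j : ℝ) / p) * Real.exp (l * D (x + (j : ℝ) / p))) := by
    rw [avg_sum _ fun j _ => hf.comp_add _]
    rw [Finset.sum_congr rfl fun j _ => avg_shift hf _]
    simp
  have h2 : avg (fun x => ∑ j ∈ Finset.range p, w (x + (j : ℝ) / p) * Real.exp (l * D (x + (j : ℝ) / p)))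
      ≤ avg (fun x => (p * Real.exp (l ^ 2 * d ^ 2 + |l| * (d / p))) * w x) := by
    refine avg_mono (Nice.sum _ fun j _ => hf.comp_add _) (hw.const_mul _) fun x => ?_
    simp only [hwp]
    rw [← Finset.mul_sum, mul_comm _ (w x)]
    refine mul_le_mul_of_nonneg_left ?_ (hw0 x)
    have e1 : ∑ j ∈ Finset.range p, Real.exp (l * D (x + (j : ℝ) / p)) ≤
        ∑ j ∈ Finset.range p, (l * D (x + (j : ℝ) / p) + Real.exp (l ^ 2 * d ^ 2)) := by
      refine Finset.sum_le_sum fun j _ => (exp_le_add_exp_sq _).trans ?_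
      gcongr
      rw [mul_pow]
      gcongr ?_ * ?_
      rw [← sq_abs]
      gcongr
      exact hDd _
    rw [Finset.sum_add_distrib, ← Finset.mul_sum, Finset.sum_const, Finset.card_range,
      nsmul_eq_mul] at e1
    have e2 : l * ∑ j ∈ Finset.range p, D (x + (j : ℝ) / p) ≤ |l| * d := by
      refine (le_abs_self _).trans ?_
      rw [abs_mul]
      gcongr
      exact hDs x
    have e3 : |l| * (d / p) + 1 ≤ Real.exp (|l| * (d / p)) := Real.add_one_le_exp _
    have e4 : 1 ≤ Real.exp (l ^ 2 * d ^ 2) := Real.one_le_exp (by positivity)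
    have e5 : 0 ≤ |l| * (d / p) := by positivity
    have e6 : |l| * d = p * (|l| * (d / p)) := by field_simp
    rw [Real.exp_add]
    have e7 : |l| * (d / p) + Real.exp (l ^ 2 * d ^ 2) ≤
        Real.exp (l ^ 2 * d ^ 2) * Real.exp (|l| * (d / p)) := by nlinarith
    calc _ ≤ p * (|l| * (d / p) + Real.exp (l ^ 2 * d ^ 2)) := by linarith
      _ ≤ _ := by gcongr
  rw [← h1, avg_const_mul, mul_assoc] at h2
  exact le_of_mul_le_mul_left h2 hp0

/-- The `n ≤ N` dividing the odd primorial of `z` but not that of `y`. -/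
noncomputable def roughSet (y N z : ℕ) : Finset ℕ :=
  (oddPrimorial z).divisors.filter fun n => n ≤ N ∧ ¬ n ∣ oddPrimorial y

/-- The model for the part of the sum over `n` with a prime factor in `[y, z)`. -/
noncomputable def modelSum (M0 : ℕ) (s : Finset ℕ) (x : ℝ) : ℝ :=
  ∑ n ∈ s, hw n * sB ((M0 / n : ℕ) * x)

lemma nice_modelSum (M0 : ℕ) (s : Finset ℕ) : Nice (modelSum M0 s) :=
  Nice.sum s fun n _ => (Nice.sB.comp_mul (M0 / n)).const_mul _

lemma abs_modelSum_le (M0 : ℕ) (s : Finset ℕ) (x : ℝ) :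
    |modelSum M0 s x| ≤ 1 / 2 * ∑ n ∈ s, hw n := by
  rw [modelSum, Finset.mul_sum]
  refine (Finset.abs_sum_le_sum_abs _ _).trans (Finset.sum_le_sum fun n _ => ?_)
  rw [abs_mul, abs_of_nonneg (hw_nonneg n), mul_comm]
  exact mul_le_mul_of_nonneg_right (abs_sB_le _) (hw_nonneg n)

/-- The bound for the part of the model sum with largest prime factor `p`. -/
noncomputable def dP (p : ℕ) : ℝ := 1 / 2 * (1 / ((p : ℝ) - 2) * P2 p)

lemma avg_exp_modelSum_le {y N : ℕ} {w : ℝ → ℝ} (hw : Nice w) (hw0 : ∀ x, 0 ≤ w x)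
    (hwp : ∀ p : ℕ, p.Prime → p ≠ 2 → y ≤ p → p ≤ N → ∀ (x : ℝ) (j : ℕ), w (x + j / p) = w x)
    (l : ℝ) {z : ℕ} (hyz : y ≤ z) (hz : z ≤ N + 1) :
    avg (fun x => w x * Real.exp (l * modelSum (oddPrimorial (N + 1)) (roughSet y N z) x)) ≤
      Real.exp (∑ p ∈ oddPrimesBelow z \ oddPrimesBelow y, (l ^ 2 * dP p ^ 2 + |l| * (dP p / p))) *
        avg w := by
  induction z, hyz using Nat.le_induction with
  | base =>
    have : roughSet y N y = ∅ := by
      refine Finset.filter_eq_empty_iff.2 fun n hn => ?_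
      simp [Nat.dvd_of_mem_divisors hn]
    simp [this, modelSum]
  | succ z hyz ih =>
    have ih := ih (by omega)
    by_cases hz2 : z.Prime ∧ z ≠ 2
    swap
    · have : roughSet y N (z + 1) = roughSet y N z := by
        simp only [roughSet, oddPrimorial_succ_of_not hz2]
      rw [this, oddPrimesBelow_succ_of_not hz2]
      exact ih
    obtain ⟨hzp, hz2⟩ := hz2
    have : Fact z.Prime := ⟨hzp⟩
    set M0 := oddPrimorial (N + 1) with hM0
    have hM0pos : 0 < M0 := oddPrimorial_pos _
    have hzz : oddPrimorial (z + 1) = z * oddPrimorial z := oddPrimorial_succ_of_prime hzp hz2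
    have hdM : oddPrimorial (z + 1) ∣ M0 := oddPrimorial_dvd hz
    have hsub : roughSet y N z ⊆ roughSet y N (z + 1) := by
      refine Finset.filter_subset_filter _ ?_
      exact Nat.divisors_subset_of_dvd (oddPrimorial_pos _).ne' (oddPrimorial_dvd (by omega))
    set R := roughSet y N (z + 1) \ roughSet y N z with hR
    have hsplit : ∀ x, modelSum M0 (roughSet y N (z + 1)) x =
        modelSum M0 (roughSet y N z) x + modelSum M0 R x := by
      intro x
      rw [modelSum, modelSum, modelSum, ← Finset.sum_sdiff hsub, add_comm]
    have hRsub : R ⊆ (oddPrimorial (z + 1)).divisors \ (oddPrimorial z).divisors := by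
      intro n hn
      rw [hR, Finset.mem_sdiff, roughSet, roughSet, Finset.mem_filter, Finset.mem_filter] at hn
      rw [Finset.mem_sdiff]
      tauto
    have hRd : ∀ n ∈ R, n ∣ M0 ∧ ¬ z ∣ M0 / n := by
      intro n hn
      have h1 := Finset.mem_sdiff.1 (hRsub hn)
      have h2 : n ∣ z * oddPrimorial z := hzz ▸ Nat.dvd_of_mem_divisors h1.1
      have h3 : ¬ n ∣ oddPrimorial z := fun h =>
        h1.2 (Nat.mem_divisors.2 ⟨h, (oddPrimorial_pos _).ne'⟩)
      have h4 : z ∣ n := by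
        by_contra hc
        exact h3 ((((Nat.Prime.coprime_iff_not_dvd hzp).2 hc).symm).dvd_of_dvd_mul_left h2)
      have h5 : n ∣ M0 := (Nat.dvd_of_mem_divisors h1.1).trans hdM
      refine ⟨h5, fun hc => ?_⟩
      have h6 : z * z ∣ M0 := by
        rw [← Nat.mul_div_cancel' h5]
        exact Nat.mul_dvd_mul h4 hc
      exact hzp.one_lt.ne' (Nat.isUnit_iff.1 (squarefree_oddPrimorial (N + 1) z h6))
    have hRsum : 1 / 2 * ∑ n ∈ R, DirL.hw n ≤ dP z := by
      rw [dP, ← sum_divisors_sdiff_hw hzp hz2]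
      gcongr
      exact fun n _ _ => hw_nonneg n
    have hzpos : (0 : ℝ) < z := by exact_mod_cast hzp.pos
    have hinv : ∀ (x : ℝ) (j : ℕ), modelSum M0 (roughSet y N z) (x + j / z) =
        modelSum M0 (roughSet y N z) x := by
      intro x j
      refine Finset.sum_congr rfl fun n hn => ?_
      congr 1
      have h1 : n ∣ oddPrimorial z := Nat.dvd_of_mem_divisors (Finset.mem_filter.1 hn).1
      have h2 : n * z ∣ M0 := by
        refine dvd_trans ?_ hdM
        rw [hzz, mul_comm]
        exact Nat.mul_dvd_mul_left z h1
      have hn0 : 0 < n := Nat.pos_of_dvd_of_pos h1 (oddPrimorial_pos _)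
      obtain ⟨c, hc⟩ := h2
      have h3 : M0 / n = z * c := by
        rw [hc, mul_assoc, Nat.mul_div_cancel_left _ hn0]
      rw [h3]
      have : ((z * c : ℕ) : ℝ) * (x + j / z) = ((z * c : ℕ) : ℝ) * x + ((c * j : ℤ) : ℝ) := by
        push_cast; field_simp
      rw [this, sB_add_int]
    have hstep := avg_exp_step hzp.pos
      (w := fun x => w x * Real.exp (l * modelSum M0 (roughSet y N z) x))
      (D := modelSum M0 R) (d := dP z)
      (hw.mul ((nice_modelSum M0 _).const_mul l).exp)
      (fun x => mul_nonneg (hw0 x) (Real.exp_pos _).le)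
      (fun x j => by rw [hwp z hzp hz2 hyz (by omega), hinv])
      (nice_modelSum M0 R) (fun x => (abs_modelSum_le _ _ _).trans hRsum)
      (fun x => by
        have : ∑ j ∈ Finset.range z, modelSum M0 R (x + (j : ℝ) / z) =
            ∑ n ∈ R, DirL.hw n * sB (z * ((M0 / n : ℕ) * x)) := by
          unfold modelSum
          rw [Finset.sum_comm]
          refine Finset.sum_congr rfl fun n hn => ?_
          rw [← Finset.mul_sum, ← sum_sB_shift (hRd n hn).2]
          congr 1
          refine Finset.sum_congr rfl fun j _ => ?_
          congr 1
          ring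
        rw [this]
        refine le_trans ?_ hRsum
        rw [Finset.mul_sum]
        refine (Finset.abs_sum_le_sum_abs _ _).trans (Finset.sum_le_sum fun n _ => ?_)
        rw [abs_mul, abs_of_nonneg (hw_nonneg n), mul_comm]
        exact mul_le_mul_of_nonneg_right (abs_sB_le _) (hw_nonneg n)) l
    have hsd : oddPrimesBelow (z + 1) \ oddPrimesBelow y =
        insert z (oddPrimesBelow z \ oddPrimesBelow y) := by
      rw [oddPrimesBelow_succ_of_prime hzp hz2, Finset.insert_sdiff_of_notMem]
      intro h
      have := (mem_oddPrimesBelow.1 h).2.2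
      omega
    rw [hsd, Finset.sum_insert (fun h => by
      have := (mem_oddPrimesBelow.1 (Finset.mem_sdiff.1 h).1).2.2
      omega), Real.exp_add, mul_assoc]
    have heq : (fun x => w x * Real.exp (l * modelSum M0 (roughSet y N (z + 1)) x)) =
        fun x => w x * Real.exp (l * modelSum M0 (roughSet y N z) x) *
          Real.exp (l * modelSum M0 R x) := by
      funext x
      rw [hsplit, mul_add, Real.exp_add, mul_assoc]
    rw [heq]
    exact hstep.trans (mul_le_mul_of_nonneg_left ih (Real.exp_pos _).le)

lemma one_le_log_of_three_le {y : ℕ} (hy : 3 ≤ y) : 1 ≤ Real.log y := by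
  have : (3 : ℝ) ≤ y := by exact_mod_cast hy
  rw [Real.le_log_iff_exp_le (by linarith)]
  linarith [Real.exp_one_lt_d9]

lemma sum_log_oddPrimesBelow_le (y : ℕ) :
    ∑ p ∈ oddPrimesBelow y, Real.log p ≤ 2 * y := by
  have h1 : ∑ p ∈ oddPrimesBelow y, Real.log p = Real.log (oddPrimorial y) := by
    rw [oddPrimorial, Nat.cast_prod, Real.log_prod]
    intro p hp
    exact_mod_cast (mem_oddPrimesBelow.1 hp).1.ne_zero
  have h2 : Real.log (oddPrimorial y) ≤ Real.log ((4 : ℝ) ^ y) := by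
    refine Real.log_le_log (by exact_mod_cast oddPrimorial_pos y) ?_
    exact_mod_cast oddPrimorial_le_four_pow y
  rw [h1]
  refine h2.trans ?_
  rw [Real.log_pow]
  have h4 : Real.log 4 ≤ 2 := by
    have : (4 : ℝ) = 2 ^ 2 := by norm_num
    rw [this, Real.log_pow]
    have := Real.log_two_lt_d9
    push_cast; linarith
  have : (0 : ℝ) ≤ y := by positivity
  nlinarith

lemma sum_log_sq_block_le {y : ℕ} (hy : 3 ≤ y) :
    ∑ p ∈ oddPrimesBelow (2 * y) \ oddPrimesBelow y, Real.log p ^ 2 / (p : ℝ) ^ 2 ≤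
      4 * (Real.log y + 1) / y := by
  have hy0 : (0 : ℝ) < y := by positivity
  have h1 : ∀ p ∈ oddPrimesBelow (2 * y) \ oddPrimesBelow y,
      Real.log p ^ 2 / (p : ℝ) ^ 2 ≤ (Real.log y + 1) / (y : ℝ) ^ 2 * Real.log p := by
    intro p hp
    rw [Finset.mem_sdiff, mem_oddPrimesBelow, mem_oddPrimesBelow] at hp
    obtain ⟨⟨a, b, c⟩, d⟩ := hp
    have hyp : y ≤ p := by
      by_contra h
      exact d ⟨a, b, by omega⟩
    have hyp' : (y : ℝ) ≤ p := by exact_mod_cast hyp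
    have hp2 : (p : ℝ) ≤ 2 * y := by exact_mod_cast c.le
    have hl0 : 0 ≤ Real.log p := Real.log_natCast_nonneg p
    have hl : Real.log p ≤ Real.log y + 1 := by
      have h := Real.log_le_log (by linarith) hp2
      rw [Real.log_mul (by norm_num) hy0.ne'] at h
      have := Real.log_two_lt_d9
      linarith
    calc _ ≤ Real.log p ^ 2 / (y : ℝ) ^ 2 := by gcongr
      _ = Real.log p * Real.log p / (y : ℝ) ^ 2 := by ring
      _ ≤ (Real.log y + 1) * Real.log p / (y : ℝ) ^ 2 := by gcongr
      _ = _ := by ring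
  have hly : 0 ≤ Real.log y := Real.log_natCast_nonneg y
  calc _ ≤ ∑ p ∈ oddPrimesBelow (2 * y) \ oddPrimesBelow y,
        (Real.log y + 1) / (y : ℝ) ^ 2 * Real.log p := Finset.sum_le_sum h1
    _ = (Real.log y + 1) / (y : ℝ) ^ 2 *
        ∑ p ∈ oddPrimesBelow (2 * y) \ oddPrimesBelow y, Real.log p := by rw [Finset.mul_sum]
    _ ≤ (Real.log y + 1) / (y : ℝ) ^ 2 * (2 * ((2 * y : ℕ) : ℝ)) := by
        gcongr
        refine le_trans ?_ (sum_log_oddPrimesBelow_le (2 * y))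
        exact Finset.sum_le_sum_of_subset_of_nonneg Finset.sdiff_subset
          fun p _ _ => Real.log_natCast_nonneg p
    _ = _ := by push_cast; field_simp; ring

lemma sum_log_sq_dyadic_le (k : ℕ) : ∀ {y : ℕ}, 3 ≤ y →
    ∑ p ∈ oddPrimesBelow (2 ^ k * y) \ oddPrimesBelow y, Real.log p ^ 2 / (p : ℝ) ^ 2 ≤
      8 * (Real.log y + 2) / y := by
  induction k with
  | zero =>
    intro y hy
    have := Real.log_natCast_nonneg y
    simp
    positivity
  | succ k ih =>
    intro y hy
    have hy0 : (0 : ℝ) < y := by positivity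
    have h1 := sum_log_sq_block_le hy
    have h2 := ih (y := 2 * y) (by omega)
    have h3 : oddPrimesBelow (2 ^ (k + 1) * y) \ oddPrimesBelow y ⊆
        (oddPrimesBelow (2 * y) \ oddPrimesBelow y) ∪
        (oddPrimesBelow (2 ^ k * (2 * y)) \ oddPrimesBelow (2 * y)) := by
      intro p hp
      rw [pow_succ, mul_assoc] at hp
      rw [Finset.mem_sdiff] at hp
      rw [Finset.mem_union, Finset.mem_sdiff, Finset.mem_sdiff]
      tauto
    have h4 : ∑ p ∈ oddPrimesBelow (2 ^ (k + 1) * y) \ oddPrimesBelow y,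
        Real.log p ^ 2 / (p : ℝ) ^ 2 ≤ 4 * (Real.log y + 1) / y +
        8 * (Real.log ((2 * y : ℕ) : ℝ) + 2) / ((2 * y : ℕ) : ℝ) := by
      refine (Finset.sum_le_sum_of_subset_of_nonneg h3 fun p _ _ => by positivity).trans ?_
      refine le_trans ?_ (add_le_add h1 h2)
      rw [← Finset.sum_union_inter]
      exact le_add_of_nonneg_right (Finset.sum_nonneg fun p _ => by positivity)
    refine h4.trans ?_
    push_cast
    rw [Real.log_mul (by norm_num) hy0.ne']
    have e : 8 * (Real.log 2 + Real.log y + 2) / (2 * (y : ℝ)) =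
        4 * (Real.log 2 + Real.log y + 2) / y := by field_simp; ring
    rw [e, ← add_div]
    gcongr
    have := Real.log_two_lt_d9
    linarith

lemma sum_log_sq_le {y : ℕ} (hy : 3 ≤ y) (z : ℕ) :
    ∑ p ∈ oddPrimesBelow z \ oddPrimesBelow y, Real.log p ^ 2 / (p : ℝ) ^ 2 ≤
      24 * (Real.log y / y) := by
  have h1 := sum_log_sq_dyadic_le z hy
  have hz : z ≤ 2 ^ z * y := by
    have := (Nat.lt_two_pow_self (n := z)).le
    have : 2 ^ z * 1 ≤ 2 ^ z * y := Nat.mul_le_mul_left _ (by omega)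
    omega
  have h2 : oddPrimesBelow z \ oddPrimesBelow y ⊆ oddPrimesBelow (2 ^ z * y) \ oddPrimesBelow y := by
    refine Finset.sdiff_subset_sdiff (fun p hp => ?_) le_rfl
    have := mem_oddPrimesBelow.1 hp
    exact mem_oddPrimesBelow.2 ⟨this.1, this.2.1, this.2.2.trans_le hz⟩
  refine (Finset.sum_le_sum_of_subset_of_nonneg h2 fun p _ _ => by positivity).trans (h1.trans ?_)
  have hl := one_le_log_of_three_le hy
  rw [← mul_div_assoc]
  refine div_le_div_of_nonneg_right ?_ (by positivity)
  linarith

/-- Variance and drift bounds for the rough part. -/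
lemma exists_sum_dP_le : ∃ K : ℝ, 0 < K ∧ ∀ y : ℕ, 3 ≤ y → ∀ z : ℕ,
    ∑ p ∈ oddPrimesBelow z \ oddPrimesBelow y, dP p ^ 2 ≤ K * (Real.log y / y) ∧
    ∑ p ∈ oddPrimesBelow z \ oddPrimesBelow y, dP p / p ≤ K * (Real.log y / y) := by
  obtain ⟨K, hK, hP⟩ := exists_P2_le
  have hd : ∀ p : ℕ, p.Prime → p ≠ 2 → 0 ≤ dP p ∧ dP p ≤ 3 / 2 * K * (Real.log p / p) := by
    intro p hp h2
    have h3 := two_lt_of_prime hp h2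
    have h3' : 3 ≤ p := by exact_mod_cast h3
    have h4 := one_le_P2 p
    have h5 := hP p h3'
    have h6 : 1 / ((p : ℝ) - 2) ≤ 3 / p := by
      rw [div_le_div_iff₀ (by linarith) (by linarith)]; linarith
    have h7 : 0 ≤ 1 / ((p : ℝ) - 2) := by apply div_nonneg <;> linarith
    have h8 : 0 ≤ Real.log p := Real.log_natCast_nonneg p
    constructor
    · unfold dP
      apply mul_nonneg (by norm_num) (mul_nonneg h7 (by linarith))
    · unfold dP
      calc _ ≤ 1 / 2 * (3 / p * (K * Real.log p)) := by gcongr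
        _ = _ := by ring
  have hlog : ∀ p : ℕ, p.Prime → p ≠ 2 → 1 ≤ Real.log p := by
    intro p hp h2
    exact one_le_log_of_three_le (by exact_mod_cast two_lt_of_prime hp h2)
  refine ⟨(54 * K ^ 2 + 36 * K + 1), by positivity, fun y hy z => ?_⟩
  have hy0 : (0 : ℝ) < y := by positivity
  have hly := one_le_log_of_three_le hy
  have hs := sum_log_sq_le hy z
  have hq0 : 0 ≤ Real.log y / y := by positivity
  have hmem : ∀ p ∈ oddPrimesBelow z \ oddPrimesBelow y, p.Prime ∧ p ≠ 2 := fun p hp => by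
    have := mem_oddPrimesBelow.1 (Finset.mem_sdiff.1 hp).1
    exact ⟨this.1, this.2.1⟩
  constructor
  · calc _ ≤ ∑ p ∈ oddPrimesBelow z \ oddPrimesBelow y,
          (9 / 4 * K ^ 2) * (Real.log p ^ 2 / (p : ℝ) ^ 2) := by
          refine Finset.sum_le_sum fun p hp => ?_
          obtain ⟨h1, h2⟩ := hd p (hmem p hp).1 (hmem p hp).2
          calc dP p ^ 2 ≤ (3 / 2 * K * (Real.log p / p)) ^ 2 := pow_le_pow_left₀ h1 h2 2
            _ = _ := by ring
      _ = (9 / 4 * K ^ 2) * ∑ p ∈ oddPrimesBelow z \ oddPrimesBelow y,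
          (Real.log p ^ 2 / (p : ℝ) ^ 2) := by rw [Finset.mul_sum]
      _ ≤ (9 / 4 * K ^ 2) * (24 * (Real.log y / y)) := by gcongr
      _ ≤ _ := by nlinarith [mul_nonneg hK hq0]
  · calc _ ≤ ∑ p ∈ oddPrimesBelow z \ oddPrimesBelow y,
          (3 / 2 * K) * (Real.log p ^ 2 / (p : ℝ) ^ 2) := by
          refine Finset.sum_le_sum fun p hp => ?_
          obtain ⟨h1, h2⟩ := hd p (hmem p hp).1 (hmem p hp).2
          have h3 := hlog p (hmem p hp).1 (hmem p hp).2
          have hp0 : (0 : ℝ) < p := by exact_mod_cast (hmem p hp).1.pos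
          calc dP p / p ≤ (3 / 2 * K * (Real.log p / p)) / p := by gcongr
            _ = (3 / 2 * K) * (Real.log p / (p : ℝ) ^ 2) := by field_simp
            _ ≤ _ := by
              gcongr
              nlinarith
      _ = (3 / 2 * K) * ∑ p ∈ oddPrimesBelow z \ oddPrimesBelow y,
          (Real.log p ^ 2 / (p : ℝ) ^ 2) := by rw [Finset.mul_sum]
      _ ≤ (3 / 2 * K) * (24 * (Real.log y / y)) := by gcongr
      _ ≤ _ := by nlinarith [mul_nonneg (sq_nonneg K) hq0]

/-- Rounding down to a multiple of `1/q`. -/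
noncomputable def stepFloor (q : ℕ) (x : ℝ) : ℝ := (⌊(q : ℝ) * x⌋ : ℝ) / q

lemma measurable_stepFloor (q : ℕ) : Measurable (stepFloor q) := by
  have h : Measurable fun x : ℝ => ⌊(q : ℝ) * x⌋ :=
    Int.measurable_floor.comp (measurable_const.mul measurable_id)
  have h2 : Measurable fun n : ℤ => (n : ℝ) := measurable_from_top
  exact (h2.comp h).div_const _

lemma stepFloor_bounds {q : ℕ} (hq : 0 < q) (x : ℝ) :
    stepFloor q x ≤ x ∧ x - stepFloor q x ≤ 1 / q := by
  have hq0 : (0 : ℝ) < q := by exact_mod_cast hq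
  unfold stepFloor
  have h1 := Int.floor_le ((q : ℝ) * x)
  have h2 := (Int.lt_floor_add_one ((q : ℝ) * x)).le
  constructor
  · rw [div_le_iff₀ hq0]; linarith
  · rw [sub_le_iff_le_add, ← add_div, le_div_iff₀ hq0]; linarith

lemma stepFloor_add {q : ℕ} (hq : 0 < q) (x : ℝ) (j : ℕ) :
    stepFloor q (x + j / q) = (⌊(q : ℝ) * x⌋ + j : ℤ) / q := by
  have hq0 : (q : ℝ) ≠ 0 := by exact_mod_cast hq.ne'
  unfold stepFloor
  have : (q : ℝ) * (x + j / q) = q * x + (j : ℕ) := by field_simp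
  rw [this, Int.floor_add_natCast]

lemma Nice.add_int {f : ℝ → ℝ} (hf : Nice f) (x : ℝ) (m : ℤ) : f (x + m) = f x := by
  have := hf.periodic.int_mul m x
  rwa [mul_one] at this

lemma Nice.comp_stepFloor {f : ℝ → ℝ} (hf : Nice f) {q : ℕ} (hq : 0 < q) :
    Nice fun x => f (stepFloor q x) := by
  obtain ⟨C, hC⟩ := hf.bdd
  have hq0 : (q : ℝ) ≠ 0 := by exact_mod_cast hq.ne'
  refine ⟨hf.meas.comp (measurable_stepFloor q), ⟨C, fun x => hC _⟩, fun x => ?_⟩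
  have h1 : stepFloor q (x + 1) = stepFloor q x + (1 : ℤ) := by
    have := stepFloor_add hq x q
    rw [div_self hq0] at this
    rw [this, stepFloor]
    push_cast; field_simp
  rw [h1, hf.add_int]

lemma Nice.eval_val {f : ℝ → ℝ} (hf : Nice f) {q : ℕ} [NeZero q] (k : ℤ) :
    f ((k : ℝ) / q) = f ((((k : ZMod q)).val : ℝ) / q) := by
  have hq0 : (q : ℝ) ≠ 0 := by exact_mod_cast NeZero.ne q
  set v := ((k : ZMod q)).val with hv
  have hvk : ((v : ℤ) : ZMod q) = (k : ZMod q) := by rw [hv]; simp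
  rw [ZMod.intCast_eq_intCast_iff_dvd_sub] at hvk
  obtain ⟨m, hm⟩ := hvk
  have hk : (k : ℝ) / q = (v : ℝ) / q + m := by
    have : k = v + q * m := by linarith
    rw [this]; push_cast; field_simp
  rw [hk, hf.add_int]

lemma avg_stepFloor {f : ℝ → ℝ} (hf : Nice f) {q : ℕ} [NeZero q] :
    avg (fun x => f (stepFloor q x)) = (1 / q) * ∑ a : ZMod q, f ((a.val : ℝ) / q) := by
  have hq : 0 < q := Nat.pos_of_ne_zero (NeZero.ne q)
  have hq0 : (q : ℝ) ≠ 0 := by exact_mod_cast hq.ne'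
  have hs := hf.comp_stepFloor hq
  have h1 : q * avg (fun x => f (stepFloor q x)) =
      avg (fun x => ∑ j ∈ Finset.range q, f (stepFloor q (x + (j : ℝ) / q))) := by
    rw [avg_sum _ fun j _ => hs.comp_add _]
    rw [Finset.sum_congr rfl fun j _ => avg_shift hs _]
    simp
  have h2 : ∀ x : ℝ, ∑ j ∈ Finset.range q, f (stepFloor q (x + (j : ℝ) / q)) =
      ∑ a : ZMod q, f ((a.val : ℝ) / q) := by
    intro x
    have h3 : ∀ j : ℕ, f (stepFloor q (x + (j : ℝ) / q)) =
        f (((((⌊(q : ℝ) * x⌋ : ℤ) : ZMod q) + (j : ZMod q)).val : ℝ) / q) := by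
      intro j
      rw [stepFloor_add hq, ← Int.cast_natCast j, hf.eval_val]
      push_cast; rfl
    simp only [h3]
    have h4 : ∑ j ∈ Finset.range q, f (((((⌊(q : ℝ) * x⌋ : ℤ) : ZMod q) + (j : ZMod q)).val : ℝ) / q) =
        ∑ a : ZMod q, f (((((⌊(q : ℝ) * x⌋ : ℤ) : ZMod q) + a).val : ℝ) / q) := by
      refine Finset.sum_nbij' (fun j => (j : ZMod q)) (fun a => a.val) (by simp) ?_ ?_ (by simp) (by simp)
      · intro a _; exact Finset.mem_range.2 (ZMod.val_lt a)
      · intro j hj; exact ZMod.val_cast_of_lt (Finset.mem_range.1 hj)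
    rw [h4]
    exact Equiv.sum_comp (Equiv.addLeft ((⌊(q : ℝ) * x⌋ : ℤ) : ZMod q))
      fun a => f ((a.val : ℝ) / q)
  simp only [h2, avg_const] at h1
  rw [← h1]
  field_simp

lemma avg_sB : avg sB = 0 := by
  have : Fact (Nat.Prime 2) := ⟨Nat.prime_two⟩
  have h1 : avg (fun x => ∑ j ∈ Finset.range 2, sB (x + (j : ℝ) / (2 : ℕ))) = 2 * avg sB := by
    rw [avg_sum _ fun j _ => Nice.sB.comp_add _]
    rw [Finset.sum_congr rfl fun j _ => avg_shift Nice.sB _]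
    simp
  have h2 : ∀ x : ℝ, ∑ j ∈ Finset.range 2, sB (x + (j : ℝ) / (2 : ℕ)) = sB ((2 : ℕ) * x) := by
    intro x
    have := sum_sB_shift (p := 2) (a := 1) (by norm_num) x
    rw [← this]
    simp
  simp only [h2] at h1
  rw [avg_comp_mul Nice.sB two_pos] at h1
  linarith

lemma avg_sB_mul_add {m : ℕ} (hm : 0 < m) (β : ℝ) : avg (fun x => sB (m * x + β)) = 0 := by
  rw [avg_comp_mul (f := fun x => sB (x + β)) (Nice.sB.comp_add β) hm, avg_shift Nice.sB, avg_sB]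

lemma abs_sB_sub_le {u v : ℝ} (h : u ≤ v) : |sB v - sB u| ≤ 2 * (v - u) - (sB v - sB u) := by
  unfold sB
  have h1 : (⌊u⌋ : ℝ) ≤ ⌊v⌋ := by exact_mod_cast Int.floor_le_floor h
  rw [Int.fract, Int.fract, abs_le]
  constructor <;> linarith

lemma Nice.abs {f : ℝ → ℝ} (hf : Nice f) : Nice fun x => |f x| := by
  obtain ⟨C, hC⟩ := hf.bdd
  exact ⟨hf.meas.norm, ⟨C, fun x => by rw [abs_abs]; exact hC x⟩, fun x => by rw [hf.per]⟩

lemma Nice.sub {f g : ℝ → ℝ} (hf : Nice f) (hg : Nice g) : Nice fun x => f x - g x := by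
  simpa [sub_eq_add_neg] using hf.add (hg.const_mul (-1))

lemma avg_sub {f g : ℝ → ℝ} (hf : Nice f) (hg : Nice g) :
    avg (fun x => f x - g x) = avg f - avg g :=
  intervalIntegral.integral_sub (hf.intervalIntegrable _ _) (hg.intervalIntegrable _ _)

lemma abs_avg_le {f : ℝ → ℝ} : |avg f| ≤ avg fun x => |f x| :=
  intervalIntegral.abs_integral_le_integral_abs zero_le_one

/-- Discretising a dilated sawtooth at scale `1/q` changes it little in mean. -/
lemma avg_abs_sB_stepFloor_le {q : ℕ} [Fact q.Prime] {m : ℕ} (hm : ¬ q ∣ m) (β : ℝ) :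
    avg (fun x => |sB (m * stepFloor q x + β) - sB (m * x + β)|) ≤ 3 * m / q := by
  have hqp : q.Prime := Fact.out
  have hq0 : (0 : ℝ) < q := by exact_mod_cast hqp.pos
  have hm0 : 0 < m := Nat.pos_of_ne_zero (by rintro rfl; exact hm (dvd_zero q))
  have hm1 : (1 : ℝ) ≤ m := by exact_mod_cast hm0
  have hf := Nice.sB_mul_add m β
  have hs := hf.comp_stepFloor hqp.pos
  have h1 : avg (fun x => |sB (m * stepFloor q x + β) - sB (m * x + β)|) ≤
      avg (fun x => 2 * m / q + (sB (m * stepFloor q x + β) - sB (m * x + β))) := by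
    refine avg_mono (hs.sub hf).abs ((Nice.const _).add (hs.sub hf)) fun x => ?_
    obtain ⟨a, b⟩ := stepFloor_bounds hqp.pos x
    have h2 : m * stepFloor q x + β ≤ m * x + β := by gcongr
    have h3 := abs_sB_sub_le h2
    rw [abs_sub_comm]
    have h4 : (m : ℝ) * (x - stepFloor q x) ≤ m * (1 / q) := by gcongr
    have h5 : 2 * (m : ℝ) / q = 2 * (m * (1 / q)) := by ring
    rw [h5]
    linarith
  rw [avg_add (Nice.const _) (hs.sub hf), avg_const, avg_sub hs hf, avg_sB_mul_add hm0,
    avg_stepFloor hf] at h1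
  have h2 : ∑ a : ZMod q, sB (m * ((a.val : ℝ) / q) + β) = sB (q * β) := by
    rw [← sum_sB_shift hm β]
    symm
    refine Finset.sum_nbij' (fun j => (j : ZMod q)) (fun a => a.val) (by simp) ?_ ?_ (by simp) ?_
    · intro a _; exact Finset.mem_range.2 (ZMod.val_lt a)
    · intro j hj; exact ZMod.val_cast_of_lt (Finset.mem_range.1 hj)
    · intro j hj
      rw [ZMod.val_cast_of_lt (Finset.mem_range.1 hj), add_comm]
  rw [h2] at h1
  have h3 := (abs_le.1 (abs_sB_le (q * β))).2
  have h4 : 1 / (q : ℝ) * sB (q * β) ≤ 1 / q * m := by gcongr; linarith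
  have h5 : 3 * (m : ℝ) / q = 2 * m / q + 1 / q * m := by ring
  linarith

/-- The indicator of `{x} < δ`. -/
noncomputable def uInd (δ x : ℝ) : ℝ := if Int.fract x < δ then 1 else 0

lemma uInd_eq {δ : ℝ} (h0 : 0 < δ) (h1 : δ ≤ 1) (x : ℝ) :
    uInd δ x = δ + (sB (x + -δ) - sB x) := by
  unfold uInd sB
  have hf0 := Int.fract_nonneg x
  have hf1 := Int.fract_lt_one x
  split_ifs with h
  · have : Int.fract (x + -δ) = Int.fract x - δ + 1 := by
      rw [Int.fract_eq_iff]
      refine ⟨by linarith, by linarith, ⌊x⌋ - 1, ?_⟩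
      rw [Int.fract]; push_cast; ring
    rw [this]; ring
  · push Not at h
    have : Int.fract (x + -δ) = Int.fract x - δ := by
      rw [Int.fract_eq_iff]
      refine ⟨by linarith, by linarith, ⌊x⌋, ?_⟩
      rw [Int.fract]; ring
    rw [this]; ring

lemma uInd_nonneg (δ x : ℝ) : 0 ≤ uInd δ x := by unfold uInd; split_ifs <;> norm_num

lemma uInd_le_one (δ x : ℝ) : uInd δ x ≤ 1 := by unfold uInd; split_ifs <;> norm_num

lemma nice_uInd {δ : ℝ} (h0 : 0 < δ) (h1 : δ ≤ 1) : Nice (uInd δ) := by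
  have : uInd δ = fun x => δ + (sB (x + -δ) - sB x) := funext fun x => uInd_eq h0 h1 x
  rw [this]
  exact (Nice.const δ).add ((Nice.sB.comp_add _).sub Nice.sB)

lemma avg_uInd {δ : ℝ} (h0 : 0 < δ) (h1 : δ ≤ 1) : avg (uInd δ) = δ := by
  have : uInd δ = fun x => δ + (sB (x + -δ) - sB x) := funext fun x => uInd_eq h0 h1 x
  rw [this, avg_add (Nice.const δ) ((Nice.sB.comp_add _).sub Nice.sB),
    avg_sub (Nice.sB.comp_add _) Nice.sB, avg_shift Nice.sB, avg_const]
  ring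

lemma avg_abs_uInd_stepFloor_le {q : ℕ} [Fact q.Prime] {m : ℕ} (hm : ¬ q ∣ m) {δ : ℝ}
    (h0 : 0 < δ) (h1 : δ ≤ 1) :
    avg (fun x => |uInd δ (m * stepFloor q x) - uInd δ (m * x)|) ≤ 6 * m / q := by
  have hqp : q.Prime := Fact.out
  have hA := avg_abs_sB_stepFloor_le hm (-δ)
  have hB := avg_abs_sB_stepFloor_le hm 0
  have n1 := ((Nice.sB_mul_add m (-δ)).comp_stepFloor hqp.pos).sub (Nice.sB_mul_add m (-δ))
  have n2 := ((Nice.sB_mul_add m 0).comp_stepFloor hqp.pos).sub (Nice.sB_mul_add m 0)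
  have hu := (nice_uInd h0 h1).comp_mul m
  have h2 : avg (fun x => |uInd δ (m * stepFloor q x) - uInd δ (m * x)|) ≤
      avg (fun x => |sB (m * stepFloor q x + -δ) - sB (m * x + -δ)| +
        |sB (m * stepFloor q x + 0) - sB (m * x + 0)|) := by
    refine avg_mono ((hu.comp_stepFloor hqp.pos).sub hu).abs (n1.abs.add n2.abs) fun x => ?_
    rw [uInd_eq h0 h1, uInd_eq h0 h1, add_zero, add_zero]
    refine le_trans (le_of_eq ?_) (abs_sub _ _)
    congr 1
    ring
  rw [avg_add n1.abs n2.abs] at h2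
  have : 6 * (m : ℝ) / q = 3 * m / q + 3 * m / q := by ring
  linarith

lemma abs_prod_sub_prod_le {ι : Type*} (s : Finset ι) {a b : ι → ℝ} (ha : ∀ i, |a i| ≤ 1)
    (hb : ∀ i, |b i| ≤ 1) : |∏ i ∈ s, a i - ∏ i ∈ s, b i| ≤ ∑ i ∈ s, |a i - b i| := by
  induction s using Finset.induction_on with
  | empty => simp
  | insert i s hi ih =>
    rw [Finset.prod_insert hi, Finset.prod_insert hi, Finset.sum_insert hi]
    have h1 : a i * ∏ j ∈ s, a j - b i * ∏ j ∈ s, b j =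
        (a i - b i) * ∏ j ∈ s, a j + b i * (∏ j ∈ s, a j - ∏ j ∈ s, b j) := by ring
    have h2 : |∏ j ∈ s, a j| ≤ 1 := by
      rw [Finset.abs_prod]
      exact Finset.prod_le_one (fun _ _ => abs_nonneg _) fun j _ => ha j
    rw [h1]
    refine (abs_add_le _ _).trans (add_le_add ?_ (le_trans ?_ ih))
    · rw [abs_mul]
      exact mul_le_of_le_one_right (abs_nonneg _) h2
    · rw [abs_mul]
      exact mul_le_of_le_one_left (abs_nonneg _) (hb i)

lemma bz_eq_sB {q : ℕ} [NeZero q] (a : ZMod q) : bz a = sB ((a.val : ℝ) / q) := by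
  have hq : (0 : ℝ) < q := by exact_mod_cast Nat.pos_of_ne_zero (NeZero.ne q)
  have h1 : ((a.val : ℕ) : ℝ) < q := by exact_mod_cast ZMod.val_lt a
  rw [bz, sB, Int.fract_eq_self.2 ⟨by positivity, (div_lt_one hq).2 h1⟩]

lemma Nice.eval_mul_val {f : ℝ → ℝ} (hf : Nice f) {q : ℕ} [NeZero q] (m : ℕ) (a : ZMod q) :
    f (m * ((a.val : ℝ) / q)) = f ((((m : ZMod q) * a).val : ℝ) / q) := by
  have := hf.eval_val (q := q) ((m : ℤ) * (a.val : ℤ))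
  push_cast at this
  rw [ZMod.natCast_zmod_val] at this
  rw [← this]
  congr 1
  ring

/-- The discrete average over `ZMod q` of a product of dilated sawtooth functions agrees with the
average of the corresponding model, up to a small error. -/
lemma transfer_tuple {q : ℕ} [Fact q.Prime] {M0 M N : ℕ} (hM0 : 0 < M0) (hM : M ∣ M0)
    (hqM : ¬ q ∣ M) (hN : N < q) {k : ℕ} {f : Fin k → ℕ}
    (hf : ∀ i, f i ∣ M0 ∧ f i ≤ N) {δ : ℝ} (h0 : 0 < δ) (h1 : δ ≤ 1) :
    |(1 / q) * ∑ κ : ZMod q, uInd δ (((κ * (M : ZMod q)⁻¹).val : ℝ) / q) *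
        ∏ i, bz (κ * (f i : ZMod q)⁻¹) -
      avg (fun x => uInd δ ((M0 / M : ℕ) * x) * ∏ i, sB ((M0 / f i : ℕ) * x))| ≤
      (3 * k + 6) * (M * (N : ℝ) ^ k) / q := by
  have hqp : q.Prime := Fact.out
  have hq0 : (0 : ℝ) < q := by exact_mod_cast hqp.pos
  have hfpos : ∀ i, 0 < f i := fun i => Nat.pos_of_dvd_of_pos (hf i).1 hM0
  have hMpos : 0 < M := Nat.pos_of_dvd_of_pos hM hM0
  have hqf : ∀ i, ¬ q ∣ f i := fun i h => by
    have := Nat.le_of_dvd (hfpos i) h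
    have := (hf i).2
    omega
  set L := M * ∏ i, f i with hL
  have hLpos : 0 < L := Nat.mul_pos hMpos (Finset.prod_pos fun i _ => hfpos i)
  have hqL : ¬ q ∣ L := by
    rw [hL, hqp.dvd_mul, not_or, Prime.dvd_finsetProd_iff hqp.prime]
    exact ⟨hqM, by rintro ⟨i, _, h⟩; exact hqf i h⟩
  have hML : M ∣ L := Dvd.intro _ rfl
  have hfL : ∀ i, f i ∣ L := fun i => (Finset.dvd_prod_of_mem f (Finset.mem_univ i)).mul_left M
  have hLle : (L : ℝ) ≤ M * (N : ℝ) ^ k := by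
    rw [hL]; push_cast
    refine mul_le_mul_of_nonneg_left ?_ (by positivity)
    calc ∏ i, (f i : ℝ) ≤ ∏ _i : Fin k, (N : ℝ) :=
          Finset.prod_le_prod (fun _ _ => by positivity) fun i _ => by exact_mod_cast (hf i).2
      _ = _ := by simp
  have hnd : ∀ {n : ℕ}, n ∣ L → ¬ q ∣ L / n := fun {n} hn h =>
    hqL (h.trans (Nat.div_dvd_of_dvd hn))
  have hdivle : ∀ n : ℕ, ((L / n : ℕ) : ℝ) ≤ L := fun n => by exact_mod_cast Nat.div_le_self L n
  set u : ℝ → ℝ := fun x => uInd δ ((L / M : ℕ) * x) with hu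
  set b : Fin k → ℝ → ℝ := fun i x => sB ((L / f i : ℕ) * x) with hb
  have nu : Nice u := (nice_uInd h0 h1).comp_mul _
  have nb : ∀ i, Nice (b i) := fun i => Nice.sB.comp_mul _
  set F : ℝ → ℝ := fun x => u x * ∏ i, b i x with hF
  have nF : Nice F := nu.mul (Nice.prod _ fun i _ => nb i)
  have hLz : (L : ZMod q) ≠ 0 := by rwa [Ne, ZMod.natCast_eq_zero_iff]
  -- substitution
  have e1 : (1 / q) * ∑ κ : ZMod q, uInd δ (((κ * (M : ZMod q)⁻¹).val : ℝ) / q) *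
      ∏ i, bz (κ * (f i : ZMod q)⁻¹) = avg (fun x => F (stepFloor q x)) := by
    rw [avg_stepFloor nF]
    congr 1
    rw [← Equiv.sum_comp (Equiv.mulLeft₀ (L : ZMod q) hLz)]
    refine Finset.sum_congr rfl fun a _ => ?_
    have h2 : ∀ n : ℕ, n ∣ L → (L : ZMod q) * a * (n : ZMod q)⁻¹ = ((L / n : ℕ) : ZMod q) * a := by
      intro n hn
      have hn0 : (n : ZMod q) ≠ 0 := by
        rw [Ne, ZMod.natCast_eq_zero_iff]
        exact fun h => hqL (h.trans hn)
      have : (L : ZMod q) = ((L / n : ℕ) : ZMod q) * n := by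
        rw [← Nat.cast_mul, Nat.div_mul_cancel hn]
      rw [this]
      field_simp
    have h3 : Equiv.mulLeft₀ (L : ZMod q) hLz a = L * a := rfl
    simp only [h3, hF, hu, hb]
    rw [h2 M hML, (nice_uInd h0 h1).eval_mul_val]
    congr 1
    refine Finset.prod_congr rfl fun i _ => ?_
    rw [h2 _ (hfL i), bz_eq_sB, Nice.sB.eval_mul_val]
  -- scaling
  have e2 : avg (fun x => uInd δ ((M0 / M : ℕ) * x) * ∏ i, sB ((M0 / f i : ℕ) * x)) = avg F := by
    have nG : Nice fun x => uInd δ ((M0 / M : ℕ) * x) * ∏ i, sB ((M0 / f i : ℕ) * x) :=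
      ((nice_uInd h0 h1).comp_mul _).mul (Nice.prod _ fun i _ => Nice.sB.comp_mul _)
    rw [← avg_comp_mul nG hLpos, ← avg_comp_mul nF hM0]
    congr 1
    funext x
    have h3 : ∀ n : ℕ, n ∣ L → n ∣ M0 →
        ((M0 / n : ℕ) : ℝ) * (L * x) = ((L / n : ℕ) : ℝ) * (M0 * x) := by
      intro n hn hn'
      have hn0 : (n : ℝ) ≠ 0 := by
        have := Nat.pos_of_dvd_of_pos hn hLpos
        positivity
      rw [Nat.cast_div hn hn0, Nat.cast_div hn' hn0]
      ring
    simp only [hF, hu, hb]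
    rw [h3 M hML hM]
    congr 1
    refine Finset.prod_congr rfl fun i _ => ?_
    rw [h3 _ (hfL i) (hf i).1]
  rw [e1, e2, ← avg_sub (nF.comp_stepFloor hqp.pos) nF]
  refine abs_avg_le.trans ?_
  have du := ((nu.comp_stepFloor hqp.pos).sub nu).abs
  have db := fun i => (((nb i).comp_stepFloor hqp.pos).sub (nb i)).abs
  have h4 : avg (fun x => |F (stepFloor q x) - F x|) ≤
      avg (fun x => |u (stepFloor q x) - u x| + ∑ i, |b i (stepFloor q x) - b i x|) := by
    refine avg_mono ((nF.comp_stepFloor hqp.pos).sub nF).abs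
      (du.add (Nice.sum _ fun i _ => db i)) fun x => ?_
    have key := abs_prod_sub_prod_le (Finset.univ : Finset (Option (Fin k)))
      (a := fun o => o.elim (u (stepFloor q x)) fun i => b i (stepFloor q x))
      (b := fun o => o.elim (u x) fun i => b i x) ?_ ?_
    · simpa [Fintype.prod_option, Fintype.sum_option] using key
    all_goals
      rintro (_ | i)
      · simp only [Option.elim]
        rw [hu, abs_of_nonneg (uInd_nonneg _ _)]
        exact uInd_le_one _ _
      · simp only [Option.elim]
        exact (abs_sB_le _).trans (by norm_num)
  refine h4.trans ?_
  rw [avg_add du (Nice.sum _ fun i _ => db i), avg_sum _ fun i _ => db i]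
  have h5 := avg_abs_uInd_stepFloor_le (hnd hML) h0 h1
  have h6 : ∀ i, avg (fun x => |b i (stepFloor q x) - b i x|) ≤ 3 * (M * (N : ℝ) ^ k) / q := by
    intro i
    have := avg_abs_sB_stepFloor_le (hnd (hfL i)) 0
    simp only [add_zero] at this
    refine this.trans ?_
    gcongr
    exact (hdivle _).trans hLle
  have h7 : 6 * ((L / M : ℕ) : ℝ) / q ≤ 6 * (M * (N : ℝ) ^ k) / q := by
    gcongr
    exact (hdivle _).trans hLle
  have h8 := Finset.sum_le_sum fun i (_ : i ∈ Finset.univ) => h6 i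
  rw [Finset.sum_const, Finset.card_univ, Fintype.card_fin, nsmul_eq_mul] at h8
  calc _ ≤ 6 * (M * (N : ℝ) ^ k) / q + k * (3 * (M * (N : ℝ) ^ k) / q) :=
        add_le_add (h5.trans h7) h8
    _ = _ := by ring

lemma hw_le_one (n : ℕ) : hw n ≤ 1 := by
  unfold hw
  split_ifs with h
  · refine Finset.prod_le_one (fun p hp => ?_) fun p hp => ?_
    all_goals
      have h2 : p ≠ 2 := by
        rintro rfl
        exact (Nat.not_even_iff_odd.2 h.1) (even_iff_two_dvd.2 (Nat.dvd_of_mem_primeFactors hp))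
      have := two_lt_of_prime (Nat.prime_of_mem_primeFactors hp) h2
    · exact div_nonneg zero_le_one (by linarith)
    · rw [div_le_one (by linarith)]; linarith
  · exact zero_le_one

/-- The weighted moments of the arithmetic sum are close to those of the model. -/
lemma moment_transfer {q : ℕ} [Fact q.Prime] {M0 M N : ℕ} (hM0 : 0 < M0) (hM : M ∣ M0)
    (hqM : ¬ q ∣ M) (hN : N < q) (k : ℕ) {s : Finset ℕ} (hs : ∀ n ∈ s, n ∣ M0 ∧ n ≤ N)
    {δ : ℝ} (h0 : 0 < δ) (h1 : δ ≤ 1) :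
    (1 / q) * ∑ κ : ZMod q, uInd δ (((κ * (M : ZMod q)⁻¹).val : ℝ) / q) *
        (∑ n ∈ s, hw n * bz (κ * (n : ZMod q)⁻¹)) ^ k ≤
      avg (fun x => uInd δ ((M0 / M : ℕ) * x) * modelSum M0 s x ^ k) +
      (3 * k + 6) * (M * (N : ℝ) ^ k) / q * (∑ n ∈ s, hw n) ^ k := by
  have e1 : (1 / q) * ∑ κ : ZMod q, uInd δ (((κ * (M : ZMod q)⁻¹).val : ℝ) / q) *
      (∑ n ∈ s, hw n * bz (κ * (n : ZMod q)⁻¹)) ^ k =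
      ∑ f ∈ Fintype.piFinset fun _ : Fin k => s, (∏ i, hw (f i)) *
        ((1 / q) * ∑ κ : ZMod q, uInd δ (((κ * (M : ZMod q)⁻¹).val : ℝ) / q) *
        ∏ i, bz (κ * (f i : ZMod q)⁻¹)) := by
    simp only [Finset.sum_pow', Finset.mul_sum]
    rw [Finset.sum_comm]
    refine Finset.sum_congr rfl fun f _ => Finset.sum_congr rfl fun κ _ => ?_
    rw [Finset.prod_mul_distrib]
    ring
  have e2 : avg (fun x => uInd δ ((M0 / M : ℕ) * x) * modelSum M0 s x ^ k) =
      ∑ f ∈ Fintype.piFinset fun _ : Fin k => s, (∏ i, hw (f i)) *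
        avg (fun x => uInd δ ((M0 / M : ℕ) * x) * ∏ i, sB ((M0 / f i : ℕ) * x)) := by
    have n1 : ∀ f : Fin k → ℕ,
        Nice fun x => uInd δ ((M0 / M : ℕ) * x) * ∏ i, sB ((M0 / f i : ℕ) * x) := fun f =>
      ((nice_uInd h0 h1).comp_mul _).mul (Nice.prod _ fun i _ => Nice.sB.comp_mul _)
    rw [← Finset.sum_congr rfl fun f _ => avg_const_mul (∏ i, hw (f i))
      (fun x => uInd δ ((M0 / M : ℕ) * x) * ∏ i, sB ((M0 / f i : ℕ) * x)),
      ← avg_sum _ fun f _ => (n1 f).const_mul _]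
    congr 1
    funext x
    rw [modelSum, Finset.sum_pow', Finset.mul_sum]
    refine Finset.sum_congr rfl fun f _ => ?_
    rw [Finset.prod_mul_distrib]
    ring
  rw [e1, e2, Finset.sum_pow', Finset.mul_sum, ← Finset.sum_add_distrib]
  refine Finset.sum_le_sum fun f hf => ?_
  rw [Fintype.mem_piFinset] at hf
  have h2 := (abs_le.1 (transfer_tuple hM0 hM hqM hN (fun i => hs _ (hf i)) h0 h1)).2
  have h3 : 0 ≤ ∏ i, hw (f i) := Finset.prod_nonneg fun i _ => hw_nonneg _
  have h4 := mul_le_mul_of_nonneg_left h2 h3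
  linarith

lemma pow_two_mul_le (r : ℕ) {l : ℝ} (hl : 0 < l) (x : ℝ) :
    x ^ (2 * r) ≤ (2 * r).factorial * (l ^ (2 * r))⁻¹ *
      (Real.exp (l * x) + Real.exp (-l * x)) := by
  have h1 : (l * x) ^ (2 * r) = |l * x| ^ (2 * r) := by
    rw [pow_mul, pow_mul, sq_abs]
  have h2 := Real.pow_div_factorial_le_exp _ (abs_nonneg (l * x)) (2 * r)
  rw [← h1] at h2
  have h3 : Real.exp |l * x| ≤ Real.exp (l * x) + Real.exp (-l * x) := by
    rcases abs_cases (l * x) with ⟨h, _⟩ | ⟨h, _⟩ <;> rw [h]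
    · linarith [Real.exp_pos (-l * x)]
    · rw [← neg_mul]; linarith [Real.exp_pos (l * x)]
  have h4 : (0 : ℝ) < (2 * r).factorial := by exact_mod_cast Nat.factorial_pos _
  rw [div_le_iff₀ h4] at h2
  rw [mul_pow] at h2
  have h5 : 0 < l ^ (2 * r) := by positivity
  calc x ^ (2 * r) = (l ^ (2 * r))⁻¹ * (l ^ (2 * r) * x ^ (2 * r)) := by field_simp
    _ ≤ (l ^ (2 * r))⁻¹ * ((Real.exp (l * x) + Real.exp (-l * x)) * (2 * r).factorial) := by
        refine mul_le_mul_of_nonneg_left (h2.trans ?_) (by positivity)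
        exact mul_le_mul_of_nonneg_right h3 h4.le
    _ = _ := by ring

lemma mem_roughSet {y N z n : ℕ} (h : n ∈ roughSet y N z) : n ∣ oddPrimorial z ∧ n ≤ N := by
  rw [roughSet, Finset.mem_filter] at h
  exact ⟨Nat.dvd_of_mem_divisors h.1, h.2.1⟩

lemma sum_hw_roughSet_le (y N z : ℕ) : ∑ n ∈ roughSet y N z, hw n ≤ N := by
  have h1 : roughSet y N z ⊆ Finset.Icc 1 N := fun n hn => by
    have := mem_roughSet hn
    exact Finset.mem_Icc.2 ⟨Nat.pos_of_dvd_of_pos this.1 (oddPrimorial_pos z), this.2⟩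
  calc ∑ n ∈ roughSet y N z, hw n ≤ ∑ n ∈ roughSet y N z, (1 : ℝ) :=
        Finset.sum_le_sum fun n _ => hw_le_one n
    _ ≤ ∑ n ∈ Finset.Icc 1 N, (1 : ℝ) :=
        Finset.sum_le_sum_of_subset_of_nonneg h1 fun _ _ _ => zero_le_one
    _ = N := by simp

/-- Moment bound for the part of the sum over `n ≤ N` with a prime factor at least `y`,
restricted to a Bohr-type set. -/
lemma moment_rough_le {q : ℕ} [Fact q.Prime] {M y N : ℕ} (hM : M ∣ oddPrimorial y)
    (hqM : ¬ q ∣ M) (hy : y ≤ N + 1) (hN : N < q) (r : ℕ) {v l : ℝ} (hl : 0 < l)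
    (hv : ∑ p ∈ oddPrimesBelow (N + 1) \ oddPrimesBelow y, dP p ^ 2 ≤ v ∧
      ∑ p ∈ oddPrimesBelow (N + 1) \ oddPrimesBelow y, dP p / p ≤ v)
    {δ : ℝ} (h0 : 0 < δ) (h1 : δ ≤ 1) :
    (1 / q) * ∑ κ : ZMod q, uInd δ (((κ * (M : ZMod q)⁻¹).val : ℝ) / q) *
        (∑ n ∈ roughSet y N (N + 1), hw n * bz (κ * (n : ZMod q)⁻¹)) ^ (2 * r) ≤
      2 * (2 * r).factorial * (l ^ (2 * r))⁻¹ * Real.exp ((l ^ 2 + l) * v) * δ +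
      (6 * r + 6) * (M * (N : ℝ) ^ (4 * r)) / q := by
  set M0 := oddPrimorial (N + 1) with hM0
  have hM0pos : 0 < M0 := oddPrimorial_pos _
  have hMM0 : M ∣ M0 := hM.trans (oddPrimorial_dvd hy)
  have hMpos : 0 < M := Nat.pos_of_dvd_of_pos hMM0 hM0pos
  set s := roughSet y N (N + 1) with hs
  have hq0 : (0 : ℝ) < q := by exact_mod_cast (Fact.out : q.Prime).pos
  have hT := moment_transfer hM0pos hMM0 hqM hN (2 * r) (fun n hn => mem_roughSet (y := y) hn) h0 h1
  refine hT.trans (add_le_add ?_ ?_)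
  · set w : ℝ → ℝ := fun x => uInd δ ((M0 / M : ℕ) * x) with hw'
    have nw : Nice w := (nice_uInd h0 h1).comp_mul _
    have hw0 : ∀ x, 0 ≤ w x := fun x => uInd_nonneg _ _
    have aw : avg w = δ := by
      rw [hw', avg_comp_mul (nice_uInd h0 h1), avg_uInd h0 h1]
      exact Nat.div_pos (Nat.le_of_dvd hM0pos hMM0) hMpos
    have hwp : ∀ p : ℕ, p.Prime → p ≠ 2 → y ≤ p → p ≤ N →
        ∀ (x : ℝ) (j : ℕ), w (x + j / p) = w x := by
      intro p hp hp2 hyp hpN x j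
      have hpM : ¬ p ∣ M := fun h => not_dvd_oddPrimorial hp hyp (h.trans hM)
      have hpM0 : p ∣ M0 := by
        have : p ∈ (oddPrimorial (N + 1)).primeFactors := by
          rw [primeFactors_oddPrimorial, mem_oddPrimesBelow]
          exact ⟨hp, hp2, by omega⟩
        exact Nat.dvd_of_mem_primeFactors this
      have hpd : p ∣ M0 / M := by
        have h2 : p ∣ M * (M0 / M) := by rwa [Nat.mul_div_cancel' hMM0]
        exact (hp.dvd_mul.1 h2).resolve_left hpM
      obtain ⟨t, ht⟩ := hpd
      have hp0 : (p : ℝ) ≠ 0 := by exact_mod_cast hp.ne_zero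
      simp only [hw', ht]
      have h3 : ((p * t : ℕ) : ℝ) * (x + j / p) = ((p * t : ℕ) : ℝ) * x + ((t * j : ℕ) : ℤ) := by
        push_cast; field_simp
      rw [h3, (nice_uInd h0 h1).add_int]
    have nS := nice_modelSum M0 s
    have hexp : ∀ l' : ℝ, |l'| = l →
        avg (fun x => w x * Real.exp (l' * modelSum M0 s x)) ≤
          Real.exp ((l ^ 2 + l) * v) * δ := by
      intro l' hl'
      refine (avg_exp_modelSum_le nw hw0 hwp l' hy le_rfl).trans ?_
      rw [aw]
      refine mul_le_mul_of_nonneg_right (Real.exp_le_exp.2 ?_) h0.le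
      rw [Finset.sum_add_distrib, ← Finset.mul_sum, ← Finset.mul_sum, hl', ← sq_abs, hl', add_mul]
      exact add_le_add (mul_le_mul_of_nonneg_left hv.1 (by positivity))
        (mul_le_mul_of_nonneg_left hv.2 (by positivity))
    set c : ℝ := (2 * r).factorial * (l ^ (2 * r))⁻¹ with hc
    have hc0 : 0 ≤ c := by positivity
    have n1 := fun l' : ℝ => nw.mul (nS.const_mul l').exp
    calc avg (fun x => w x * modelSum M0 s x ^ (2 * r))
        ≤ avg (fun x => c * (w x * Real.exp (l * modelSum M0 s x) +
            w x * Real.exp (-l * modelSum M0 s x))) := by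
          refine avg_mono (nw.mul (nS.pow _)) (((n1 l).add (n1 (-l))).const_mul c) fun x => ?_
          have := mul_le_mul_of_nonneg_left (pow_two_mul_le r hl (modelSum M0 s x)) (hw0 x)
          rw [← hc] at this
          linarith
      _ ≤ c * (Real.exp ((l ^ 2 + l) * v) * δ + Real.exp ((l ^ 2 + l) * v) * δ) := by
          rw [avg_const_mul, avg_add (n1 l) (n1 (-l))]
          exact mul_le_mul_of_nonneg_left (add_le_add (hexp l (abs_of_pos hl))
            (hexp (-l) (by rw [abs_neg, abs_of_pos hl]))) hc0
      _ = _ := by rw [hc]; ring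
  · have hH := sum_hw_roughSet_le y N (N + 1)
    have hH0 : 0 ≤ ∑ n ∈ s, hw n := Finset.sum_nonneg fun n _ => hw_nonneg n
    have h5 : (∑ n ∈ s, hw n) ^ (2 * r) ≤ (N : ℝ) ^ (2 * r) := pow_le_pow_left₀ hH0 hH _
    calc _ ≤ (3 * (2 * r : ℕ) + 6) * (M * (N : ℝ) ^ (2 * r)) / q * (N : ℝ) ^ (2 * r) :=
          mul_le_mul_of_nonneg_left h5 (by positivity)
      _ = _ := by
          rw [show 4 * r = 2 * r + 2 * r by ring, pow_add]; push_cast; ring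

/-- The smooth part of the sum. -/
noncomputable def smoothPart (q y : ℕ) (κ : ZMod q) : ℝ :=
  ∑ n ∈ (oddPrimorial y).divisors, hw n * bz (κ * (n : ZMod q)⁻¹)

/-- The short rough part of the sum. -/
noncomputable def roughPart (q y N : ℕ) (κ : ZMod q) : ℝ :=
  ∑ n ∈ roughSet y N (N + 1), hw n * bz (κ * (n : ZMod q)⁻¹)

/-- The tail of the sum. -/
noncomputable def tailPart (q N : ℕ) (κ : ZMod q) : ℝ :=
  ∑ n ∈ (Finset.Ioc N (q ^ 9)).filter (fun n : ℕ => (n : ZMod q) ≠ 0),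
    hw n * bz (κ * (n : ZMod q)⁻¹)

lemma hw_eq_zero_of_not_dvd {n N : ℕ} (hn : n ≤ N) (h : ¬ n ∣ oddPrimorial (N + 1)) : hw n = 0 := by
  rw [hw, if_neg]
  rintro ⟨h1, h2⟩
  exact h (dvd_oddPrimorial h1 h2 fun p hp =>
    Nat.lt_succ_of_le ((Nat.le_of_mem_primeFactors hp).trans hn))

lemma sum_eq_parts {q : ℕ} [Fact q.Prime] {y N : ℕ} (hy : oddPrimorial y ≤ N)
    (hN : N < q) (κ : ZMod q) :
    ∑ n ∈ (Finset.Icc 1 (q ^ 9)).filter (fun n : ℕ => (n : ZMod q) ≠ 0),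
      hw n * bz (κ * (n : ZMod q)⁻¹) = smoothPart q y κ + roughPart q y N κ + tailPart q N κ := by
  set F : ℕ → ℝ := fun n => hw n * bz (κ * (n : ZMod q)⁻¹) with hF
  have hNq : N ≤ q ^ 9 := hN.le.trans (Nat.le_self_pow (by norm_num) q)
  have h1 : (Finset.Icc 1 (q ^ 9)).filter (fun n : ℕ => (n : ZMod q) ≠ 0) =
      Finset.Icc 1 N ∪ (Finset.Ioc N (q ^ 9)).filter (fun n : ℕ => (n : ZMod q) ≠ 0) := by
    ext n
    simp only [Finset.mem_filter, Finset.mem_union, Finset.mem_Icc, Finset.mem_Ioc]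
    constructor
    · rintro ⟨⟨a, b⟩, c⟩
      rcases le_or_gt n N with h | h
      · exact Or.inl ⟨a, h⟩
      · exact Or.inr ⟨⟨h, b⟩, c⟩
    · rintro (⟨a, b⟩ | ⟨⟨a, b⟩, c⟩)
      · refine ⟨⟨a, b.trans hNq⟩, ?_⟩
        rw [Ne, ZMod.natCast_eq_zero_iff]
        intro h
        have := Nat.le_of_dvd a h
        omega
      · exact ⟨⟨by omega, b⟩, c⟩
  have h2 : Disjoint (Finset.Icc 1 N)
      ((Finset.Ioc N (q ^ 9)).filter (fun n : ℕ => (n : ZMod q) ≠ 0)) := by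
    rw [Finset.disjoint_left]
    intro n ha hb
    simp only [Finset.mem_filter, Finset.mem_Icc, Finset.mem_Ioc] at ha hb
    omega
  have h3 : (oddPrimorial y).divisors ∪ roughSet y N (N + 1) ⊆ Finset.Icc 1 N := by
    intro n hn
    rw [Finset.mem_Icc]
    rcases Finset.mem_union.1 hn with h | h
    · exact ⟨Nat.pos_of_mem_divisors h, (Nat.divisor_le h).trans hy⟩
    · have := mem_roughSet h
      exact ⟨Nat.pos_of_dvd_of_pos this.1 (oddPrimorial_pos _), this.2⟩
  have h4 : Disjoint (oddPrimorial y).divisors (roughSet y N (N + 1)) := by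
    rw [Finset.disjoint_left]
    intro n ha hb
    rw [roughSet, Finset.mem_filter] at hb
    exact hb.2.2 (Nat.dvd_of_mem_divisors ha)
  have h5 : ∑ n ∈ Finset.Icc 1 N, F n = smoothPart q y κ + roughPart q y N κ := by
    rw [smoothPart, roughPart, ← Finset.sum_union h4]
    symm
    refine Finset.sum_subset h3 fun n hn hn' => ?_
    have : ¬ n ∣ oddPrimorial (N + 1) := by
      intro hd
      refine hn' (Finset.mem_union.2 ?_)
      by_cases h : n ∣ oddPrimorial y
      · exact Or.inl (Nat.mem_divisors.2 ⟨h, (oddPrimorial_pos y).ne'⟩)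
      · refine Or.inr (Finset.mem_filter.2 ⟨Nat.mem_divisors.2 ⟨hd, (oddPrimorial_pos _).ne'⟩,
          (Finset.mem_Icc.1 hn).2, h⟩)
    rw [hw_eq_zero_of_not_dvd (Finset.mem_Icc.1 hn).2 this, zero_mul]
  rw [h1, Finset.sum_union h2, h5]
  rfl

lemma exists_abs_Cfun_add_parts_le : ∃ K : ℝ, 0 ≤ K ∧ ∀ (q : ℕ) [Fact q.Prime], q ≠ 2 →
    ∀ y N : ℕ, oddPrimorial y ≤ N → N < q → ∀ κ : ZMod q, κ ≠ 0 →
    |Cfun q ((2 * κ).val : ℤ) +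
      2 * C2 q * (smoothPart q y κ + roughPart q y N κ + tailPart q N κ)| ≤ K := by
  obtain ⟨K, hK, h⟩ := exists_abs_Cfun_add_le
  refine ⟨K, hK, fun q _ hq2 y N hy hN κ hκ => ?_⟩
  have := h q hq2 κ hκ ((2 * κ).val : ℤ) (by simp)
  rw [sum_eq_parts hy hN] at this
  refine this.trans (div_le_self hK ?_)
  exact_mod_cast (Fact.out : q.Prime).one_lt.le

lemma Cfun_zero (q : ℕ) [Fact q.Prime] : Cfun q 0 = 0 := by
  have := Cfun_neg (q := q) 0
  rw [neg_zero] at this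
  linarith

lemma card_Cfun_ge (q : ℕ) [Fact q.Prime] (hq : q ≠ 2) (a : ℝ) :
    ((Finset.range q).filter (fun k : ℕ => a ≤ Cfun q k)).card =
      (Finset.univ.filter fun κ : ZMod q => a ≤ Cfun q ((2 * κ).val : ℤ)).card := by
  have h2 : (2 : ZMod q) ≠ 0 := by
    intro h
    have h' : ((2 : ℕ) : ZMod q) = 0 := by exact_mod_cast h
    rw [ZMod.natCast_eq_zero_iff] at h'
    exact hq ((Nat.prime_dvd_prime_iff_eq Fact.out Nat.prime_two).1 h')
  rw [Finset.card_filter, Finset.card_filter]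
  have h3 := Equiv.sum_comp (Equiv.mulLeft₀ (2 : ZMod q) h2)
    fun b : ZMod q => if a ≤ Cfun q (b.val : ℤ) then 1 else 0
  have h4 := sum_range_eq_sum_zmod (q := q) fun b : ZMod q => if a ≤ Cfun q (b.val : ℤ) then 1 else 0
  refine Eq.trans ?_ (h4.trans h3.symm)
  refine Finset.sum_congr rfl fun k _ => ?_
  rw [Cfun_congr (q := q) (k := (k : ℤ)) (l := (((k : ZMod q)).val : ℤ)) (by simp)]

lemma card_abs_gt_one_le {ι : Type*} (s : Finset ι) {w f : ι → ℝ} (hw : ∀ i, 0 ≤ w i) (r : ℕ) :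
    ((s.filter fun i => w i = 1 ∧ 1 < |f i|).card : ℝ) ≤ ∑ i ∈ s, w i * f i ^ (2 * r) := by
  rw [Finset.card_filter]
  push_cast
  refine Finset.sum_le_sum fun i _ => ?_
  have h0 : 0 ≤ f i ^ (2 * r) := by rw [pow_mul]; positivity
  split_ifs with h
  · rw [h.1, one_mul, pow_mul, ← sq_abs, ← pow_mul]
    exact one_le_pow₀ h.2.le
  · exact mul_nonneg (hw i) h0

open Filter in
lemma tendsto_sqrt_log : Tendsto (fun q : ℕ => √(Real.log q)) atTop atTop :=
  (Real.tendsto_sqrt_atTop.comp Real.tendsto_log_atTop).comp tendsto_natCast_atTop_atTop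

open Filter in
lemma eventually_exp_le {ε b : ℝ} (hε : 0 < ε) (hb : 0 < b) : ∀ᶠ q : ℕ in atTop,
    ∀ x : ℝ, x ≤ (1 / 2 - ε) * Real.log (Real.log q) → Real.exp x ≤ b * √(Real.log q) := by
  have h1 : Tendsto (fun q : ℕ => Real.log (Real.log q)) atTop atTop :=
    (Real.tendsto_log_atTop.comp Real.tendsto_log_atTop).comp tendsto_natCast_atTop_atTop
  have h2 : Tendsto (fun q : ℕ => Real.log q) atTop atTop :=
    Real.tendsto_log_atTop.comp tendsto_natCast_atTop_atTop
  filter_upwards [h1.eventually_ge_atTop (-Real.log b / ε), h2.eventually_gt_atTop 0]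
    with q hq hl x hx
  rw [div_le_iff₀ hε] at hq
  have h3 : √(Real.log q) = Real.exp (Real.log (Real.log q) / 2) := by
    rw [← Real.log_sqrt hl.le, Real.exp_log (Real.sqrt_pos.2 hl)]
  rw [h3]
  nth_rewrite 1 [← Real.exp_log hb]
  rw [← Real.exp_add]
  exact Real.exp_le_exp.2 (by linarith)

/-- The truncation point. -/
noncomputable def cutoff (q : ℕ) : ℕ := ⌊Real.exp √(Real.log q)⌋₊

lemma cutoff_le (q : ℕ) : (cutoff q : ℝ) ≤ Real.exp √(Real.log q) :=
  Nat.floor_le (Real.exp_pos _).le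

lemma exp_le_two_mul_cutoff (q : ℕ) : Real.exp √(Real.log q) ≤ 2 * cutoff q := by
  have h1 := (Nat.lt_floor_add_one (Real.exp √(Real.log q))).le
  have h2 : 1 ≤ cutoff q := Nat.le_floor (by simp)
  have h3 : (1 : ℝ) ≤ cutoff q := by exact_mod_cast h2
  unfold cutoff at *
  linarith

lemma eq_exp_sq {q : ℕ} (hq : 1 ≤ q) : (q : ℝ) = Real.exp (√(Real.log q) ^ 2) := by
  have h1 : (1 : ℝ) ≤ q := by exact_mod_cast hq
  rw [Real.sq_sqrt (Real.log_nonneg h1), Real.exp_log (by linarith)]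

lemma cutoff_lt {q : ℕ} (hq : 1 ≤ q) (h : 2 ≤ √(Real.log q)) : cutoff q < q := by
  have h1 := cutoff_le q
  have h2 := eq_exp_sq hq
  have h3 : Real.exp √(Real.log q) < Real.exp (√(Real.log q) ^ 2) :=
    Real.exp_lt_exp.2 (by nlinarith)
  have : (cutoff q : ℝ) < q := by linarith
  exact_mod_cast this

open Filter in
lemma eventually_tail_le : ∀ᶠ q : ℕ in atTop, ∀ _ : Fact q.Prime,
    ∑ κ : ZMod q, tailPart q (cutoff q) κ ^ 2 ≤ q * Real.exp (-√(Real.log q) / 4) := by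
  obtain ⟨K, hK, h⟩ := exists_sum_sq_tail_le
  have h1 : Tendsto (fun s : ℝ => 3 * K * ((1 + s ^ 2) ^ 2 * Real.exp (-(1 / 4) * s))) atTop (nhds 0) := by
    have e1 : ∀ k : ℕ, Tendsto (fun s : ℝ => s ^ k * Real.exp (-(1 / 4) * s)) atTop (nhds 0) := fun k => by
      have := tendsto_rpow_mul_exp_neg_mul_atTop_nhds_zero (k : ℝ) (1 / 4) (by norm_num)
      simpa using this
    have e2 := ((e1 0).add (((e1 2).const_mul 2).add (e1 4))).const_mul (3 * K)
    simp only [mul_zero, add_zero] at e2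
    refine e2.congr fun s => ?_
    ring
  have h2 := (h1.comp tendsto_sqrt_log).eventually_le_const (zero_lt_one)
  filter_upwards [h2, tendsto_sqrt_log.eventually_ge_atTop 2, eventually_ge_atTop 1]
    with q hq hs hq1 hp
  set s := √(Real.log q) with hsd
  have hls : Real.log q = s ^ 2 := by
    rw [hsd, Real.sq_sqrt (Real.log_nonneg (by exact_mod_cast hq1))]
  have hN1 : 1 ≤ cutoff q := Nat.le_floor (by simp)
  refine (h q (cutoff q) hN1).trans ?_
  have hq0 : (0 : ℝ) < q := by exact_mod_cast hq1
  rw [hls]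
  have h3 : (q : ℝ) ^ (-(1 / 2) : ℝ) ≤ Real.exp (-s / 2) := by
    rw [eq_exp_sq hq1, ← hsd, ← Real.exp_mul]
    exact Real.exp_le_exp.2 (by nlinarith)
  have h4 : (cutoff q : ℝ) ^ (-(1 / 2) : ℝ) ≤ 2 * Real.exp (-s / 2) := by
    have e1 : Real.exp s / 2 ≤ cutoff q := by
      have := exp_le_two_mul_cutoff q
      rw [← hsd] at this
      linarith
    have e2 : (cutoff q : ℝ) ^ (-(1 / 2) : ℝ) ≤ (Real.exp s / 2) ^ (-(1 / 2) : ℝ) :=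
      Real.rpow_le_rpow_of_nonpos (by positivity) e1 (by norm_num)
    refine e2.trans ?_
    rw [Real.div_rpow (Real.exp_pos _).le zero_le_two, ← Real.exp_mul]
    have e3 : (2 : ℝ)⁻¹ ≤ 2 ^ (-(1 / 2) : ℝ) := by
      rw [← Real.rpow_neg_one]
      exact Real.rpow_le_rpow_of_exponent_le one_le_two (by norm_num)
    rw [div_le_iff₀ (by positivity)]
    have e4 : s * -(1 / 2) = -s / 2 := by ring
    rw [e4]
    have := Real.exp_pos (-s / 2)
    nlinarith
  simp only [Function.comp] at hq
  have h5 : Real.exp (-s / 2) = Real.exp (-(1 / 4) * s) * Real.exp (-s / 4) := by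
    rw [← Real.exp_add]; congr 1; ring
  calc K * q * (1 + s ^ 2) ^ 2 * ((cutoff q : ℝ) ^ (-(1 / 2) : ℝ) + (q : ℝ) ^ (-(1 / 2) : ℝ))
      ≤ K * q * (1 + s ^ 2) ^ 2 * (3 * Real.exp (-s / 2)) := by
        refine mul_le_mul_of_nonneg_left ?_ (by positivity)
        linarith
    _ = q * Real.exp (-s / 4) * (3 * K * ((1 + s ^ 2) ^ 2 * Real.exp (-(1 / 4) * s))) := by
        rw [h5]; ring
    _ ≤ q * Real.exp (-s / 4) * 1 := mul_le_mul_of_nonneg_left hq (by positivity)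
    _ = _ := mul_one _

lemma one_le_exp_gamma : 1 ≤ Real.exp Real.eulerMascheroniConstant :=
  Real.one_le_exp (by linarith [Real.one_half_lt_eulerMascheroniConstant])

lemma abs_smoothPart_le (q y : ℕ) [Fact q.Prime] (κ : ZMod q) : |smoothPart q y κ| ≤ 1 / 2 * P2 y := by
  rw [smoothPart, ← sum_divisors_hw, Finset.mul_sum]
  refine (Finset.abs_sum_le_sum_abs _ _).trans (Finset.sum_le_sum fun n _ => ?_)
  rw [abs_mul, abs_of_nonneg (hw_nonneg n), mul_comm]
  exact mul_le_mul_of_nonneg_right (abs_bz_le _) (hw_nonneg n)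

lemma not_dvd_of_lt_prime {q y : ℕ} (hq : q.Prime) (hy : y ≤ q) :
    ∀ p, p.Prime → p < y → ¬ p ∣ q := fun p hp hpy h => by
  have := (Nat.prime_dvd_prime_iff_eq hp hq).1 h
  omega

lemma exists_upper_count : ∃ C : ℝ, 0 ≤ C ∧ ∀ (q : ℕ) [Fact q.Prime], q ≠ 2 →
    ∀ y N : ℕ, 3 ≤ y → oddPrimorial y ≤ N → y ≤ N → N < q → ∀ x : ℝ, 0 < x →
    Real.log y + C ≤ x → ∀ r : ℕ,
    (((Finset.range q).filter
      (fun k : ℕ => Real.exp Real.eulerMascheroniConstant / 2 * x ≤ Cfun q k)).card : ℝ) ≤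
      ∑ κ : ZMod q, roughPart q y N κ ^ (2 * r) + ∑ κ : ZMod q, tailPart q N κ ^ 2 := by
  obtain ⟨K, hK, hpar⟩ := exists_abs_Cfun_add_parts_le
  obtain ⟨C, hC, hmer⟩ := exists_mertens_primesBelow
  refine ⟨C + 2 * (K + 4) + 1, by positivity, ?_⟩
  intro q _ hq2 y N hy hyN hyN' hNq x hx hxy r
  have hqp : q.Prime := Fact.out
  set g := Real.exp Real.eulerMascheroniConstant with hg
  have hg1 : 1 ≤ g := one_le_exp_gamma
  rw [card_Cfun_ge q hq2]
  have hA := card_abs_gt_one_le (Finset.univ : Finset (ZMod q)) (w := fun _ => 1)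
    (f := roughPart q y N) (fun _ => zero_le_one) r
  have hB := card_abs_gt_one_le (Finset.univ : Finset (ZMod q)) (w := fun _ => 1)
    (f := tailPart q N) (fun _ => zero_le_one) 1
  simp only [one_mul, true_and, mul_one] at hA hB
  refine le_trans ?_ (add_le_add hA hB)
  rw [← Nat.cast_add]
  refine Nat.cast_le.2 (le_trans (Finset.card_le_card ?_) (Finset.card_union_le _ _))
  intro κ hκ
  rw [Finset.mem_filter] at hκ
  by_contra hcon
  simp only [Finset.mem_union, Finset.mem_filter, Finset.mem_univ, true_and, not_or, not_lt] at hcon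
  have hκ0 : κ ≠ 0 := by
    rintro rfl
    have := hκ.2
    simp only [mul_zero, ZMod.val_zero, Nat.cast_zero, Cfun_zero] at this
    have : 0 < g / 2 * x := by positivity
    linarith
  have h1 := (abs_le.1 (hpar q hq2 y N hyN hNq κ hκ0)).2
  have hc0 := C2_nonneg q
  have hc1 := C2_le_one q
  have hP := one_le_P2 y
  have h2 : C2 q * P2 y ≤ 1 / 2 * (g * (Real.log y + C)) := by
    calc C2 q * P2 y ≤ (∏ p ∈ y.primesBelow, cfac q p) * P2 y :=
          mul_le_mul_of_nonneg_right (C2_le_prod_primesBelow q y) (by linarith)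
      _ ≤ _ := by
          rw [prod_inv_eq hy (not_dvd_of_lt_prime hqp (by omega))]
          exact mul_le_mul_of_nonneg_left (hmer y hy).2 (by norm_num)
  have h3 : -(1 / 2 * P2 y) - 2 ≤ smoothPart q y κ + roughPart q y N κ + tailPart q N κ := by
    have a1 := (abs_le.1 (abs_smoothPart_le q y κ)).1
    have a2 := (abs_le.1 hcon.1).1
    have a3 := (abs_le.1 hcon.2).1
    linarith
  have h4 := mul_le_mul_of_nonneg_left h3 (by linarith : 0 ≤ 2 * C2 q)
  have h5 := hκ.2
  have h6 : g * (Real.log y + (C + 2 * (K + 4) + 1)) ≤ g * x :=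
    mul_le_mul_of_nonneg_left hxy (by linarith)
  have h7 : 2 * (K + 4) + 1 ≤ g * (2 * (K + 4) + 1) := le_mul_of_one_le_left (by positivity) hg1
  linarith

lemma factorial_mul_inv_pow_le {l : ℝ} (hl : 0 < l) :
    ((2 * ⌊l / 8⌋₊).factorial : ℝ) * (l ^ (2 * ⌊l / 8⌋₊))⁻¹ ≤ Real.exp (2 - l / 4) := by
  set r := ⌊l / 8⌋₊ with hr
  have h1 : (r : ℝ) ≤ l / 8 := Nat.floor_le (by positivity)
  have h2 : l / 8 < r + 1 := Nat.lt_floor_add_one _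
  have h3 : ((2 * r).factorial : ℝ) ≤ (l / 4) ^ (2 * r) := by
    calc ((2 * r).factorial : ℝ) ≤ ((2 * r : ℕ) : ℝ) ^ (2 * r) := by
          exact_mod_cast Nat.factorial_le_pow (2 * r)
      _ ≤ _ := pow_le_pow_left₀ (by positivity) (by push_cast; linarith) _
  have h4 : (1 / 4 : ℝ) ≤ Real.exp (-1) := by
    rw [Real.exp_neg, one_div]
    exact inv_anti₀ (Real.exp_pos _) (by linarith [Real.exp_one_lt_d9])
  calc ((2 * r).factorial : ℝ) * (l ^ (2 * r))⁻¹ ≤ (l / 4) ^ (2 * r) * (l ^ (2 * r))⁻¹ :=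
        mul_le_mul_of_nonneg_right h3 (by positivity)
    _ = (1 / 4) ^ (2 * r) := by
        rw [div_pow, div_pow, one_pow]; field_simp
    _ ≤ Real.exp (-1) ^ (2 * r) := pow_le_pow_left₀ (by norm_num) h4 _
    _ = Real.exp (-(2 * r)) := by
        rw [← Real.exp_nat_mul]; push_cast; congr 1; ring
    _ ≤ _ := Real.exp_le_exp.2 (by linarith)

lemma four_pow_le_cutoff {q y : ℕ} (h : 2 * (y : ℝ) ≤ √(Real.log q) / 2) (hs : 2 ≤ √(Real.log q)) :
    4 ^ y ≤ cutoff q := by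
  set s := √(Real.log q) with hsd
  refine Nat.le_floor ?_
  have h1 : (4 : ℝ) ≤ Real.exp 2 := by
    rw [show (2 : ℝ) = 1 + 1 by norm_num, Real.exp_add]
    nlinarith [Real.exp_one_gt_d9]
  push_cast
  calc (4 : ℝ) ^ y ≤ Real.exp 2 ^ y := pow_le_pow_left₀ (by norm_num) h1 _
    _ = Real.exp (2 * y) := by rw [← Real.exp_nat_mul]; congr 1; ring
    _ ≤ Real.exp s := Real.exp_le_exp.2 (by linarith)

set_option maxHeartbeats 1000000 in
open Filter in
lemma exists_upper_large {ε : ℝ} (hε : 0 < ε) : ∃ A X : ℝ, 0 < A ∧ Real.exp 1 ≤ X ∧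
    ∀ᶠ q : ℕ in atTop, ∀ _ : Fact q.Prime, ∀ x : ℝ, X ≤ x →
      x ≤ (1 / 2 - ε) * Real.log (Real.log q) →
      (((Finset.range q).filter
        (fun k : ℕ => Real.exp Real.eulerMascheroniConstant / 2 * x ≤ Cfun q k)).card : ℝ) / q ≤
      Real.exp (-(A * Real.exp x / x)) := by
  obtain ⟨C, hC, hcount⟩ := exists_upper_count
  obtain ⟨K, hK, hdP⟩ := exists_sum_dP_le
  set η : ℝ := 1 / (20 * K) with hη
  have hη0 : 0 < η := by positivity
  set B : ℝ := η * Real.exp (-C) / 2 with hB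
  have hB0 : 0 < B := by positivity
  set A : ℝ := B / 10 with hA
  have hA0 : 0 < A := by positivity
  set b : ℝ := 1 / (4 + 2 * η + 8 * A) with hb
  have hb0 : 0 < b := by positivity
  have hb1 : 4 * b + 2 * (η * b) + 8 * (A * b) = 1 := by rw [hb]; field_simp
  have hηb : 0 < η * b := by positivity
  have hAb : 0 < A * b := by positivity
  refine ⟨A, C + 3 + 100 / B, hA0, ?_, ?_⟩
  · have := Real.exp_one_lt_d9
    have : 0 < 100 / B := by positivity
    linarith
  filter_upwards [eventually_exp_le hε hb0, eventually_tail_le,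
    tendsto_sqrt_log.eventually_ge_atTop 16, eventually_ge_atTop 3] with q hE htail hs hq3 hp x hX hx
  have hxE := hE x hx
  have htail' := htail hp
  have hqp : q.Prime := hp.out
  have hq0 : (0 : ℝ) < q := by exact_mod_cast hqp.pos
  set s := √(Real.log q) with hsd
  set N := cutoff q with hN
  set E := Real.exp x with hEd
  have h100 : 0 < 100 / B := by positivity
  have hx3 : 3 ≤ x := by linarith
  have hx0 : 0 < x := by linarith
  -- the parameter `y`
  set y := ⌊Real.exp (x - C)⌋₊ with hy
  have hyle : (y : ℝ) ≤ Real.exp (x - C) := Nat.floor_le (Real.exp_pos _).le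
  have he3 : (4 : ℝ) ≤ Real.exp (x - C) := by linarith [Real.add_one_le_exp (x - C)]
  have hy3 : 3 ≤ y := Nat.le_floor (by push_cast; linarith)
  have hy3' : (3 : ℝ) ≤ y := by exact_mod_cast hy3
  have hyge : Real.exp (x - C) / 2 ≤ y := by
    have := Nat.lt_floor_add_one (Real.exp (x - C))
    rw [← hy] at this
    linarith
  have hyE : (y : ℝ) ≤ E := hyle.trans (Real.exp_le_exp.2 (by linarith))
  have hlog1 := one_le_log_of_three_le hy3
  have hlogx : Real.log y + C ≤ x := by
    have := Real.log_le_log (by linarith) hyle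
    rw [Real.log_exp] at this
    linarith
  have hbs : E ≤ s / 4 := by
    have : b ≤ 1 / 4 := by linarith
    have := mul_le_mul_of_nonneg_right this (by linarith : 0 ≤ s)
    linarith
  have h4N : 4 ^ y ≤ N := four_pow_le_cutoff (by rw [← hsd]; linarith) (by rw [← hsd]; linarith)
  have hNq : N < q := cutoff_lt (by omega) (by rw [← hsd]; linarith)
  have hyN : y ≤ N := (Nat.lt_pow_self (by norm_num)).le.trans h4N
  -- the parameter `l`
  set l : ℝ := η * y / Real.log y with hl
  have hl0 : 0 < l := by rw [hl]; positivity
  have hlE : l ≤ η * E := by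
    calc l ≤ η * y := div_le_self (by positivity) hlog1
      _ ≤ _ := by gcongr
  have hls : l ≤ s / 2 := by
    have e1 := mul_le_mul_of_nonneg_left hxE hη0.le
    have e2 : η * b * s ≤ 1 / 2 * s :=
      mul_le_mul_of_nonneg_right (by linarith) (by linarith)
    linarith
  have hlZ : B * (E / x) ≤ l := by
    have e1 : Real.exp (x - C) = E * Real.exp (-C) := by rw [hEd, ← Real.exp_add]; congr 1
    calc B * (E / x) = η * (Real.exp (x - C) / 2) / x := by rw [hB, e1]; ring
      _ ≤ η * y / x := by gcongr
      _ ≤ l := by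
        rw [hl]
        exact div_le_div_of_nonneg_left (by positivity) (by linarith) (by linarith)
  set Z := E / x with hZ
  have hZ0 : 0 < Z := by positivity
  have hZs : Z ≤ E := div_le_self (Real.exp_pos x).le (by linarith)
  have hZB : 50 ≤ B * Z := by
    have e1 : x / 2 ≤ Z := by
      rw [hZ, le_div_iff₀ hx0]
      have := Real.quadratic_le_exp_of_nonneg hx0.le
      rw [← hEd] at this
      linarith
    have e2 : 100 / B ≤ x := by linarith
    rw [div_le_iff₀ hB0] at e2
    have := mul_le_mul_of_nonneg_left e1 hB0.le
    linarith
  -- counting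
  set r := ⌊l / 8⌋₊ with hr
  have hr8 : (r : ℝ) ≤ l / 8 := Nat.floor_le (by positivity)
  have hc := hcount q (by omega) y N hy3 ((oddPrimorial_le_four_pow y).trans h4N) hyN hNq x hx0 hlogx r
  have hm := moment_rough_le (q := q) (M := 1) (y := y) (N := N) (one_dvd _)
    (by simpa using hqp.one_lt.ne') (by omega) hNq r hl0 (hdP y hy3 (N + 1)) one_pos le_rfl
  have hu : ∀ z : ℝ, uInd 1 z = 1 := fun z => by rw [uInd, if_pos (Int.fract_lt_one z)]
  simp only [hu, one_mul, mul_one, Nat.cast_one] at hm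
  have hrough : (1 / (q : ℝ)) * ∑ κ : ZMod q, roughPart q y N κ ^ (2 * r) ≤
      2 * Real.exp (2.05 - l / 5) + 6 * Real.exp (-s / 2) := by
    refine hm.trans (add_le_add ?_ ?_)
    · have e1 : (l ^ 2 + l) * (K * (Real.log y / y)) = l / 20 + 1 / 20 := by
        have e2 : l * (K * (Real.log y / y)) = 1 / 20 := by
          rw [hl, hη]; field_simp
        calc _ = (l + 1) * (l * (K * (Real.log y / y))) := by ring
          _ = _ := by rw [e2]; ring
      have e3 := factorial_mul_inv_pow_le hl0
      rw [← hr] at e3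
      rw [e1, mul_assoc 2]
      calc 2 * (((2 * r).factorial : ℝ) * (l ^ (2 * r))⁻¹) * Real.exp (l / 20 + 1 / 20)
          ≤ 2 * Real.exp (2 - l / 4) * Real.exp (l / 20 + 1 / 20) := by gcongr
        _ = 2 * Real.exp (2.05 - l / 5) := by
          rw [mul_assoc, ← Real.exp_add]; congr 2; ring
    · have e1 : (N : ℝ) ^ (4 * r) ≤ Real.exp (s ^ 2 / 4) := by
        calc (N : ℝ) ^ (4 * r) ≤ Real.exp s ^ (4 * r) :=
              pow_le_pow_left₀ (by positivity) (cutoff_le q) _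
          _ = Real.exp (4 * r * s) := by rw [← Real.exp_nat_mul]; push_cast; rfl
          _ ≤ _ := Real.exp_le_exp.2 (by
            have := mul_le_mul_of_nonneg_right (show (r : ℝ) ≤ s / 16 by linarith)
              (show 0 ≤ s by linarith)
            linarith)
      have e2 : 6 * (r : ℝ) + 6 ≤ 6 * Real.exp s := by
        have := Real.add_one_le_exp s
        linarith
      rw [eq_exp_sq (by omega : 1 ≤ q), ← hsd]
      calc (6 * (r : ℝ) + 6) * (N : ℝ) ^ (4 * r) / Real.exp (s ^ 2)
          ≤ 6 * Real.exp s * Real.exp (s ^ 2 / 4) / Real.exp (s ^ 2) := by gcongr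
        _ = 6 * Real.exp (s + s ^ 2 / 4 - s ^ 2) := by
          rw [Real.exp_sub, Real.exp_add]; ring
        _ ≤ _ := by
          have := mul_le_mul_of_nonneg_right hs (show 0 ≤ s by linarith)
          gcongr
          linarith
  have htot : (((Finset.range q).filter
      (fun k : ℕ => Real.exp Real.eulerMascheroniConstant / 2 * x ≤ Cfun q k)).card : ℝ) / q ≤
      2 * Real.exp (2.05 - l / 5) + 6 * Real.exp (-s / 2) + Real.exp (-s / 4) := by
    have e1 := div_le_div_of_nonneg_right hc hq0.le
    have e2 : (∑ κ : ZMod q, tailPart q N κ ^ 2) / q ≤ Real.exp (-s / 4) := by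
      rw [div_le_iff₀ hq0, mul_comm]; exact htail'
    rw [add_div] at e1
    have e3 : (∑ κ : ZMod q, roughPart q y N κ ^ (2 * r)) / q =
      (1 / (q : ℝ)) * ∑ κ : ZMod q, roughPart q y N κ ^ (2 * r) := by ring
    linarith
  have hgoal : A * E / x = A * Z := by rw [hZ]; ring
  rw [hgoal]
  refine htot.trans ?_
  have hexp6 : ∀ {u v c : ℝ} (n : ℕ), c ≤ 2.7 ^ n → u + n ≤ v → c * Real.exp u ≤ Real.exp v := by
    intro u v c n h1 h2
    calc c * Real.exp u ≤ Real.exp n * Real.exp u := by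
          refine mul_le_mul_of_nonneg_right (h1.trans ?_) (Real.exp_pos _).le
          rw [← mul_one (n : ℝ), Real.exp_nat_mul]
          exact pow_le_pow_left₀ (by norm_num) (by linarith [Real.exp_one_gt_d9]) _
      _ = Real.exp (n + u) := by rw [Real.exp_add]
      _ ≤ _ := Real.exp_le_exp.2 (by linarith)
  have hAZ : A * Z ≤ s / 8 := by
    have e1 : A * Z ≤ A * (b * s) := by gcongr; linarith
    have e2 : A * b * s ≤ 1 / 8 * s :=
      mul_le_mul_of_nonneg_right (by linarith) (by linarith)
    linarith
  have hA10 : A * Z = B * Z / 10 := by rw [hA]; ring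
  have t1 : 6 * Real.exp (2.05 - l / 5) ≤ Real.exp (-(A * Z)) := by
    refine hexp6 (c := 6) 2 (by norm_num) ?_
    push_cast
    rw [hA10]
    norm_num
    linarith
  have t2 : 18 * Real.exp (-s / 2) ≤ Real.exp (-(A * Z)) := by
    refine hexp6 3 (by norm_num) ?_
    push_cast
    linarith
  have t3 : 3 * Real.exp (-s / 4) ≤ Real.exp (-(A * Z)) := by
    refine hexp6 2 (by norm_num) ?_
    push_cast
    linarith
  linarith

/-- On the set of multiples `κ = M ℓ` with `ℓ / q` small, the smooth part is very negative. -/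
lemma smoothPart_le {q y X : ℕ} [Fact q.Prime] (hM : oddPrimorial y < q) (hX : 0 < X) {κ : ZMod q}
    (hκ : uInd (1 / ((oddPrimorial y : ℝ) * X))
      (((κ * (oddPrimorial y : ZMod q)⁻¹).val : ℝ) / q) = 1) :
    smoothPart q y κ ≤ -((1 / 2 - 1 / X) * P2 y) := by
  have hq0 : (0 : ℝ) < q := by exact_mod_cast (Fact.out : q.Prime).pos
  set M := oddPrimorial y with hMd
  have hMpos : 0 < M := oddPrimorial_pos y
  have hMr : (0 : ℝ) < M := by exact_mod_cast hMpos
  have hXr : (0 : ℝ) < X := by exact_mod_cast hX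
  set ℓ := κ * (M : ZMod q)⁻¹ with hℓ
  have hM0 : (M : ZMod q) ≠ 0 := by
    rw [Ne, ZMod.natCast_eq_zero_iff]
    intro h
    have := Nat.le_of_dvd hMpos h
    omega
  have hκM : κ = M * ℓ := by rw [hℓ]; field_simp
  have hlt : (M : ℝ) * ((ℓ.val : ℝ) / q) < 1 / X := by
    rw [uInd] at hκ
    split_ifs at hκ with h
    · have h1 : ((ℓ.val : ℕ) : ℝ) < q := by exact_mod_cast ZMod.val_lt ℓ
      rw [Int.fract_eq_self.2 ⟨by positivity, (div_lt_one hq0).2 h1⟩, lt_div_iff₀ (by positivity)] at h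
      rw [lt_div_iff₀ hXr]
      linarith
    · norm_num at hκ
  rw [smoothPart, ← hMd, ← sum_divisors_hw, ← hMd, Finset.mul_sum, ← Finset.sum_neg_distrib]
  refine Finset.sum_le_sum fun d hd => ?_
  have hdM := Nat.dvd_of_mem_divisors hd
  have hd0 : (d : ZMod q) ≠ 0 := by
    rw [Ne, ZMod.natCast_eq_zero_iff]
    exact fun h => hM0 ((ZMod.natCast_eq_zero_iff _ _).2 (h.trans hdM))
  have h2 : κ * (d : ZMod q)⁻¹ = (((M / d) * ℓ.val : ℕ) : ZMod q) := by
    have : (M : ZMod q) = ((M / d : ℕ) : ZMod q) * d := by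
      rw [← Nat.cast_mul, Nat.div_mul_cancel hdM]
    rw [hκM, this, Nat.cast_mul, ZMod.natCast_zmod_val]
    field_simp
  have h3 : ((((M / d) * ℓ.val : ℕ) : ℝ)) ≤ M * ℓ.val := by
    push_cast
    refine mul_le_mul_of_nonneg_right ?_ (by positivity)
    exact_mod_cast Nat.div_le_self M d
  have h3' : ((((M / d) * ℓ.val : ℕ) : ℝ)) / q < 1 / X := by
    refine lt_of_le_of_lt ?_ hlt
    rw [← mul_div_assoc]
    exact div_le_div_of_nonneg_right h3 hq0.le
  have h4 : (M / d) * ℓ.val < q := by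
    have h5 : (1 : ℝ) / X ≤ 1 := by
      rw [div_le_one hXr]; exact_mod_cast hX
    have h6 := h3'.trans_le h5
    rw [div_lt_one hq0] at h6
    exact_mod_cast h6
  have h7 : bz (κ * (d : ZMod q)⁻¹) ≤ -(1 / 2 - 1 / X) := by
    rw [h2, bz, ZMod.val_cast_of_lt h4]
    linarith
  have := mul_le_mul_of_nonneg_left h7 (hw_nonneg d)
  linarith

lemma exists_Cfun_ge : ∃ D : ℝ, 0 ≤ D ∧ ∀ (q : ℕ) [Fact q.Prime], q ≠ 2 →
    ∀ y N X : ℕ, 4 ≤ y → y ≤ N → oddPrimorial y ≤ N → N < q → 3 ≤ X → ∀ x : ℝ, 0 < x → x ≤ X →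
    x + D ≤ Real.log y → ∀ κ : ZMod q, κ ≠ 0 →
    uInd (1 / ((oddPrimorial y : ℝ) * X))
      (((κ * (oddPrimorial y : ZMod q)⁻¹).val : ℝ) / q) = 1 →
    |roughPart q y N κ| ≤ 1 → |tailPart q N κ| ≤ 1 →
    Real.exp Real.eulerMascheroniConstant / 2 * x ≤ Cfun q ((2 * κ).val : ℤ) := by
  obtain ⟨K, hK, hpar⟩ := exists_abs_Cfun_add_parts_le
  obtain ⟨C, hC, hmer⟩ := exists_mertens_primesBelow
  refine ⟨C + (7 + 6 * (4 + K)), by positivity, ?_⟩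
  intro q _ hq2 y N X hy hyN hMN hNq hX x hx hxX hxy κ hκ hu hS hT
  have hqp : q.Prime := Fact.out
  set g := Real.exp Real.eulerMascheroniConstant with hg
  have hg1 : 1 ≤ g := one_le_exp_gamma
  have hy4 : (4 : ℝ) ≤ y := by exact_mod_cast hy
  have hX3 : (3 : ℝ) ≤ X := by exact_mod_cast hX
  have h1 := (abs_le.1 (hpar q hq2 y N hMN hNq κ hκ)).1
  have hc0 := C2_nonneg q
  have hc1 := C2_le_one q
  have hG := smoothPart_le (hMN.trans_lt hNq) (by omega : 0 < X) hu
  have hlogy : Real.log y ≤ y - 2 := by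
    have e1 := Real.log_le_sub_one_of_pos (show (0 : ℝ) < y / 4 by linarith)
    rw [Real.log_div (by linarith) (by norm_num)] at e1
    have e2 : Real.log 4 ≤ 2 := by
      rw [Real.log_le_iff_le_exp (by norm_num), show (2 : ℝ) = 1 + 1 by norm_num, Real.exp_add]
      nlinarith [Real.exp_one_gt_d9]
    linarith
  set W := Real.log y - C with hW
  have hWx : x + (7 + 6 * (4 + K)) ≤ W := by linarith
  have hcP : 1 / 2 * (g * (W - 1)) ≤ C2 q * P2 y := by
    have e1 := prod_mul_le_C2 q (y := y) (by omega)
    have e2 := prod_inv_eq (q := q) (y := y) (by omega) (not_dvd_of_lt_prime hqp (by omega))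
    have e3 := (hmer y (by omega)).1
    have e4 : 0 ≤ 1 - 1 / ((y : ℝ) - 2) := by
      rw [sub_nonneg, div_le_one (by linarith)]; linarith
    have e5 : W - 1 ≤ (1 - 1 / ((y : ℝ) - 2)) * W := by
      have : 1 / ((y : ℝ) - 2) * W ≤ 1 := by
        rw [one_div, inv_mul_le_iff₀ (by linarith)]; linarith
      linarith
    calc 1 / 2 * (g * (W - 1)) ≤ 1 / 2 * (g * ((1 - 1 / ((y : ℝ) - 2)) * W)) := by gcongr
      _ = (1 - 1 / ((y : ℝ) - 2)) * (1 / 2 * (g * W)) := by ring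
      _ ≤ (1 - 1 / ((y : ℝ) - 2)) * ((∏ p ∈ y.primesBelow, cfac q p) * P2 y) := by
          refine mul_le_mul_of_nonneg_left ?_ e4
          rw [e2]
          linarith
      _ = ((∏ p ∈ y.primesBelow, cfac q p) * (1 - 1 / ((y : ℝ) - 2))) * P2 y := by ring
      _ ≤ _ := mul_le_mul_of_nonneg_right e1 (by linarith [one_le_P2 y])
  have hsum : smoothPart q y κ + roughPart q y N κ + tailPart q N κ ≤
      -((1 / 2 - 1 / X) * P2 y) + 2 := by
    linarith [(abs_le.1 hS).2, (abs_le.1 hT).2]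
  have h2 := mul_le_mul_of_nonneg_left hsum (by linarith : 0 ≤ 2 * C2 q)
  set t : ℝ := 1 - 2 / X with ht
  have ht3 : 1 / 3 ≤ t := by
    have : (2 : ℝ) / X ≤ 2 / 3 := by gcongr
    linarith
  have htx : x - 2 ≤ t * x := by
    have : 2 / (X : ℝ) * x ≤ 2 := by
      rw [div_mul_eq_mul_div, div_le_iff₀ (by linarith)]; linarith
    rw [ht]; linarith
  have h3 : t * (1 / 2 * (g * (W - 1))) ≤ t * (C2 q * P2 y) :=
    mul_le_mul_of_nonneg_left hcP (by linarith)
  have h4 : x + 2 * (4 + K) ≤ t * (W - 1) := by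
    have e1 : t * (x + (6 + 6 * (4 + K))) ≤ t * (W - 1) :=
      mul_le_mul_of_nonneg_left (by linarith) (by linarith)
    have e2 : 1 / 3 * (6 + 6 * (4 + K)) ≤ t * (6 + 6 * (4 + K)) :=
      mul_le_mul_of_nonneg_right ht3 (by linarith)
    linarith
  have h5 : g * (x + 2 * (4 + K)) ≤ g * (t * (W - 1)) :=
    mul_le_mul_of_nonneg_left h4 (by linarith)
  have h6 : 2 * (4 + K) ≤ g * (2 * (4 + K)) := le_mul_of_one_le_left (by linarith) hg1
  have h7 : 2 * C2 q * (-((1 / 2 - 1 / X) * P2 y) + 2) = -(t * (C2 q * P2 y)) + 4 * C2 q := by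
    rw [ht]; ring
  rw [h7] at h2
  linarith

lemma card_uInd_ge {q M : ℕ} [Fact q.Prime] (hM0 : (M : ZMod q) ≠ 0) {δ : ℝ} (h1 : δ ≤ 1) :
    δ * q ≤ ((Finset.univ.filter fun κ : ZMod q =>
      uInd δ (((κ * (M : ZMod q)⁻¹).val : ℝ) / q) = 1).card : ℝ) := by
  have hq0 : (0 : ℝ) < q := by exact_mod_cast (Fact.out : q.Prime).pos
  have hm : ⌈δ * q⌉₊ ≤ q := Nat.ceil_le.2 (mul_le_of_le_one_left hq0.le h1)
  refine (Nat.le_ceil _).trans ?_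
  rw [Nat.cast_le]
  nth_rewrite 1 [← Finset.card_range ⌈δ * q⌉₊]
  refine Finset.card_le_card_of_injOn (fun j : ℕ => (M : ZMod q) * (j : ZMod q)) ?_ ?_
  · intro j hj
    have hj' : j < ⌈δ * q⌉₊ := by simpa using hj
    have hjq : j < q := hj'.trans_le hm
    have e1 : (M : ZMod q) * j * (M : ZMod q)⁻¹ = j := by field_simp
    simp only [Finset.coe_filter, Finset.mem_univ, true_and, Set.mem_ofPred_eq]
    rw [e1, ZMod.val_cast_of_lt hjq, uInd, if_pos]
    have hjr : (j : ℝ) < q := by exact_mod_cast hjq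
    rw [Int.fract_eq_self.2 ⟨by positivity, (div_lt_one hq0).2 hjr⟩, div_lt_iff₀ hq0]
    exact Nat.lt_ceil.1 hj'
  · intro i hi j hj hij
    have hi' : i < q := (show i < ⌈δ * q⌉₊ by simpa using hi).trans_le hm
    have hj' : j < q := (show j < ⌈δ * q⌉₊ by simpa using hj).trans_le hm
    have := mul_left_cancel₀ hM0 hij
    have e := congrArg ZMod.val this
    rwa [ZMod.val_cast_of_lt hi', ZMod.val_cast_of_lt hj'] at e

lemma card_le_of_subset_union {ι : Type*} {W S T U : Finset ι} {a : ι}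
    (h : W ⊆ S ∪ {a} ∪ T ∪ U) : (W.card : ℝ) ≤ S.card + 1 + T.card + U.card := by
  have h1 := Finset.card_le_card h
  have h2 := Finset.card_union_le (S ∪ {a} ∪ T) U
  have h3 := Finset.card_union_le (S ∪ {a}) T
  have h4 := Finset.card_union_le S {a}
  rw [Finset.card_singleton] at h4
  exact_mod_cast h1.trans (h2.trans (by omega))

lemma exists_lower_count : ∃ D : ℝ, 0 ≤ D ∧ ∀ (q : ℕ) [Fact q.Prime], q ≠ 2 →
    ∀ y N X : ℕ, 4 ≤ y → y ≤ N → oddPrimorial y ≤ N → N < q → 3 ≤ X → ∀ x : ℝ, 0 < x → x ≤ X →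
    x + D ≤ Real.log y →
    1 / ((oddPrimorial y : ℝ) * X) * q ≤ (((Finset.range q).filter
      (fun k : ℕ => Real.exp Real.eulerMascheroniConstant / 2 * x ≤ Cfun q k)).card : ℝ) + 1 +
      ∑ κ : ZMod q, uInd (1 / ((oddPrimorial y : ℝ) * X))
        (((κ * (oddPrimorial y : ZMod q)⁻¹).val : ℝ) / q) * roughPart q y N κ ^ (2 * 1) +
      ∑ κ : ZMod q, tailPart q N κ ^ 2 := by
  obtain ⟨D, hD, hge⟩ := exists_Cfun_ge
  refine ⟨D, hD, ?_⟩
  intro q _ hq2 y N X hy hyN hMN hNq hX x hx hxX hxy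
  have hMpos := oddPrimorial_pos y
  have hM0 : (oddPrimorial y : ZMod q) ≠ 0 := by
    rw [Ne, ZMod.natCast_eq_zero_iff]
    intro h
    have := Nat.le_of_dvd hMpos h
    omega
  have hδ1 : 1 / ((oddPrimorial y : ℝ) * X) ≤ 1 := by
    have e1 : (1 : ℝ) ≤ oddPrimorial y := by exact_mod_cast hMpos
    have e2 : (1 : ℝ) ≤ X := by exact_mod_cast (by omega : 1 ≤ X)
    rw [div_le_one (by positivity)]
    exact one_le_mul_of_one_le_of_one_le e1 e2
  refine (card_uInd_ge hM0 hδ1).trans ?_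
  set w : ZMod q → ℝ := fun κ => uInd (1 / ((oddPrimorial y : ℝ) * X))
        (((κ * (oddPrimorial y : ZMod q)⁻¹).val : ℝ) / q) with hwd
  rw [card_Cfun_ge q hq2]
  have hA := card_abs_gt_one_le (Finset.univ : Finset (ZMod q)) (w := w)
    (f := roughPart q y N) (fun _ => uInd_nonneg _ _) 1
  have hB := card_abs_gt_one_le (Finset.univ : Finset (ZMod q)) (w := fun _ => 1)
    (f := tailPart q N) (fun _ => zero_le_one) 1
  simp only [one_mul, true_and, mul_one] at hB
  refine (card_le_of_subset_union (a := 0) ?_).trans (add_le_add (add_le_add le_rfl hA) hB)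
  intro κ hκ
  have hκw : w κ = 1 := (Finset.mem_filter.1 hκ).2
  by_contra hcon
  simp only [Finset.mem_union, Finset.mem_filter, Finset.mem_univ, true_and, Finset.mem_singleton,
    not_or, not_and, not_lt] at hcon
  obtain ⟨⟨⟨h1, h2⟩, h3⟩, h4⟩ := hcon
  exact h1 (hge q hq2 y N X hy hyN hMN hNq hX x hx hxX hxy κ h2 hκw (h3 hκw) h4)

set_option maxHeartbeats 1000000 in
open Filter in
lemma exists_lower {ε : ℝ} (hε : 0 < ε) : ∃ A : ℝ, 0 < A ∧
    ∀ᶠ q : ℕ in atTop, ∀ _ : Fact q.Prime, ∀ x : ℝ, Real.exp 1 ≤ x →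
      x ≤ (1 / 2 - ε) * Real.log (Real.log q) →
      Real.exp (-(A * Real.exp x * Real.log x)) ≤ (((Finset.range q).filter
        (fun k : ℕ => Real.exp Real.eulerMascheroniConstant / 2 * x ≤ Cfun q k)).card : ℝ) / q := by
  obtain ⟨D, hD, hcount⟩ := exists_lower_count
  obtain ⟨K, hK, hdP⟩ := exists_sum_dP_le
  obtain ⟨Y, hY⟩ := eventually_atTop.1 (Real.isLittleO_log_id_atTop.bound
    (show (0 : ℝ) < 1 / (110 * K) by positivity))
  set c2 : ℝ := D + max 0 Y + 1 with hc2
  have hc2D : D ≤ c2 := by linarith [le_max_left 0 Y]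
  have hc2Y : Y ≤ c2 := by linarith [le_max_right 0 Y]
  have hc21 : 1 ≤ c2 := by linarith [le_max_left 0 Y]
  set c : ℝ := Real.exp c2 with hc
  have hc1 : 1 ≤ c := Real.one_le_exp (by linarith)
  refine ⟨1 + 4 * c, by linarith, ?_⟩
  filter_upwards [eventually_exp_le hε (show (0 : ℝ) < 1 / (32 * c) by positivity),
    eventually_tail_le, tendsto_sqrt_log.eventually_ge_atTop 100, eventually_ge_atTop 3]
    with q hE htail hs hq3 hp x hxe hx
  have hxE := hE x hx
  have htail' := htail hp
  have hqp : q.Prime := hp.out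
  have hq0 : (0 : ℝ) < q := by exact_mod_cast hqp.pos
  set s := √(Real.log q) with hsd
  set N := cutoff q with hN
  set E := Real.exp x with hEd
  have hx27 : 2.7 < x := by linarith [Real.exp_one_gt_d9]
  have hlogx : 1 ≤ Real.log x := by rwa [Real.le_log_iff_exp_le (by linarith)]
  have hxE1 : x + 1 ≤ E := Real.add_one_le_exp x
  have hcE : c * E ≤ s / 32 := by
    have := mul_le_mul_of_nonneg_left hxE (show 0 ≤ c by linarith)
    calc c * E ≤ c * (1 / (32 * c) * s) := this
      _ = s / 32 := by field_simp
  have hEs : E ≤ s / 32 := (le_mul_of_one_le_left (by linarith) hc1).trans hcE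
  -- the parameter `y`
  have hexc : Real.exp (x + c2) = c * E := by rw [Real.exp_add, mul_comm]
  set y := ⌈Real.exp (x + c2)⌉₊ with hy
  have hyge : Real.exp (x + c2) ≤ y := Nat.le_ceil _
  have hadd := Real.add_one_le_exp (x + c2)
  have hyle : (y : ℝ) ≤ 2 * (c * E) := by
    have := Nat.ceil_lt_add_one (Real.exp_pos (x + c2)).le
    rw [← hy] at this
    linarith
  have hy4' : (4 : ℝ) ≤ y := by linarith
  have hy4 : 4 ≤ y := by exact_mod_cast hy4'
  have hys : (y : ℝ) ≤ s / 16 := by linarith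
  have hlogy : x + D ≤ Real.log y := by
    have := Real.log_le_log (Real.exp_pos _) hyge
    rw [Real.log_exp] at this
    linarith
  have hv : K * (Real.log y / y) ≤ 1 / 110 := by
    have h1 := hY y (by linarith)
    simp only [id, Real.norm_eq_abs] at h1
    rw [abs_of_nonneg (by linarith : (0 : ℝ) ≤ y)] at h1
    have h2 := (le_abs_self _).trans h1
    rw [← mul_div_assoc, div_le_iff₀ (by linarith)]
    calc K * Real.log y ≤ K * (1 / (110 * K) * y) := by gcongr
      _ = 1 / 110 * y := by field_simp
  have h4N : 4 ^ y ≤ N := four_pow_le_cutoff (by rw [← hsd]; linarith) (by rw [← hsd]; linarith)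
  have hNq : N < q := cutoff_lt (by omega) (by rw [← hsd]; linarith)
  have hyN : y ≤ N := (Nat.lt_pow_self (by norm_num)).le.trans h4N
  have hM4 := oddPrimorial_le_four_pow y
  have hMpos := oddPrimorial_pos y
  -- the parameter `X`
  set X := ⌈x⌉₊ with hX
  have hxX : x ≤ X := Nat.le_ceil _
  have hX3 : 3 ≤ X := by
    have : (2 : ℝ) < X := by linarith
    have : 2 < X := by exact_mod_cast this
    omega
  have hX3' : (3 : ℝ) ≤ X := by exact_mod_cast hX3
  have hXE : (X : ℝ) ≤ E := by
    have := Nat.ceil_lt_add_one (show 0 ≤ x by linarith)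
    rw [← hX] at this
    linarith
  have hcnt := hcount q (by omega) y N X hy4 hyN (hM4.trans h4N) hNq hX3 x (by linarith) hxX hlogy
  set M := oddPrimorial y with hM
  have hMr : (1 : ℝ) ≤ M := by exact_mod_cast hMpos
  have hMe : (M : ℝ) ≤ Real.exp (2 * y) := by
    have h1 : (4 : ℝ) ≤ Real.exp 2 := by
      rw [show (2 : ℝ) = 1 + 1 by norm_num, Real.exp_add]
      nlinarith [Real.exp_one_gt_d9]
    calc (M : ℝ) ≤ 4 ^ y := by exact_mod_cast hM4
      _ ≤ Real.exp 2 ^ y := pow_le_pow_left₀ (by norm_num) h1 _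
      _ = Real.exp (2 * y) := by rw [← Real.exp_nat_mul]; congr 1; ring
  have hMX : 1 ≤ (M : ℝ) * X := one_le_mul_of_one_le_of_one_le hMr (by linarith)
  set δ : ℝ := 1 / (M * X) with hδ
  have hδ0 : 0 < δ := by positivity
  have hδ1 : δ ≤ 1 := by rw [hδ, div_le_one (by linarith)]; exact hMX
  have hδx : Real.exp (-(2 * y + x)) ≤ δ := by
    rw [Real.exp_neg, hδ, one_div, Real.exp_add]
    exact inv_anti₀ (by linarith) (mul_le_mul hMe hXE (by linarith) (Real.exp_pos _).le)
  have hδs : Real.exp (-(s / 6)) ≤ δ := by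
    refine le_trans (Real.exp_le_exp.2 ?_) hδx
    linarith
  have hexp6 : ∀ {u v d : ℝ} (n : ℕ), d ≤ 2.7 ^ n → u + n ≤ v → d * Real.exp u ≤ Real.exp v := by
    intro u v d n h1 h2
    calc d * Real.exp u ≤ Real.exp n * Real.exp u := by
          refine mul_le_mul_of_nonneg_right (h1.trans ?_) (Real.exp_pos _).le
          rw [← mul_one (n : ℝ), Real.exp_nat_mul]
          exact pow_le_pow_left₀ (by norm_num) (by linarith [Real.exp_one_gt_d9]) _
      _ = Real.exp (n + u) := by rw [Real.exp_add]
      _ ≤ _ := Real.exp_le_exp.2 (by linarith)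
  have hss : 100 * s ≤ s ^ 2 := by
    rw [pow_two]; exact mul_le_mul_of_nonneg_right hs (by linarith)
  have hqs : (q : ℝ) = Real.exp (s ^ 2) := eq_exp_sq (by omega)
  have hqM : ¬ q ∣ M := fun h => by
    have := Nat.le_of_dvd hMpos h
    omega
  have hm := moment_rough_le (q := q) (M := M) (y := y) (N := N) dvd_rfl hqM (by omega) hNq 1
    (l := 10) (by norm_num) (v := 1 / 110)
    ⟨(hdP y (by omega) (N + 1)).1.trans hv, (hdP y (by omega) (N + 1)).2.trans hv⟩ hδ0 hδ1
  have hR : (∑ κ : ZMod q, uInd δ (((κ * (M : ZMod q)⁻¹).val : ℝ) / q) *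
      roughPart q y N κ ^ (2 * 1)) / q ≤ δ / 4 := by
    have e1 : (∑ κ : ZMod q, uInd δ (((κ * (M : ZMod q)⁻¹).val : ℝ) / q) *
      roughPart q y N κ ^ (2 * 1)) / q = (1 / (q : ℝ)) *
      ∑ κ : ZMod q, uInd δ (((κ * (M : ZMod q)⁻¹).val : ℝ) / q) *
      roughPart q y N κ ^ (2 * 1) := by ring
    rw [e1]
    refine hm.trans ?_
    have e2 : 2 * ((2 * 1).factorial : ℝ) * ((10 : ℝ) ^ (2 * 1))⁻¹ *
        Real.exp ((10 ^ 2 + 10) * (1 / 110)) * δ ≤ δ / 8 := by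
      have e3 : ((10 : ℝ) ^ 2 + 10) * (1 / 110) = 1 := by norm_num
      rw [e3]
      have e4 : 2 * ((2 * 1).factorial : ℝ) * ((10 : ℝ) ^ (2 * 1))⁻¹ * Real.exp 1 ≤ 1 / 8 := by
        norm_num [Nat.factorial]
        linarith [Real.exp_one_lt_d9]
      have := mul_le_mul_of_nonneg_right e4 hδ0.le
      linarith
    have e5 : (6 * ((1 : ℕ) : ℝ) + 6) * (M * (N : ℝ) ^ (4 * 1)) / q ≤ δ / 8 := by
      have f1 : (N : ℝ) ^ (4 * 1) ≤ Real.exp (4 * s) := by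
        calc (N : ℝ) ^ (4 * 1) ≤ Real.exp s ^ (4 * 1) :=
              pow_le_pow_left₀ (by positivity) (cutoff_le q) _
          _ = Real.exp (4 * s) := by rw [← Real.exp_nat_mul]; norm_num
      have f2 : (M : ℝ) ≤ Real.exp s := hMe.trans (Real.exp_le_exp.2 (by linarith))
      have f3 : (6 * ((1 : ℕ) : ℝ) + 6) * (M * (N : ℝ) ^ (4 * 1)) / q ≤
          12 * Real.exp (5 * s - s ^ 2) := by
        rw [hqs]
        calc (6 * ((1 : ℕ) : ℝ) + 6) * (M * (N : ℝ) ^ (4 * 1)) / Real.exp (s ^ 2)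
            ≤ 12 * (Real.exp s * Real.exp (4 * s)) / Real.exp (s ^ 2) := by
              push_cast
              norm_num only
              gcongr
          _ = 12 * Real.exp (5 * s - s ^ 2) := by
              rw [Real.exp_sub, ← Real.exp_add, mul_div_assoc]; congr 4; ring
      have f4 : 96 * Real.exp (5 * s - s ^ 2) ≤ Real.exp (-(s / 6)) :=
        hexp6 5 (by norm_num) (by push_cast; linarith)
      linarith
    linarith
  have hT : (∑ κ : ZMod q, tailPart q N κ ^ 2) / q ≤ δ / 8 := by
    have e2 : (∑ κ : ZMod q, tailPart q N κ ^ 2) / q ≤ Real.exp (-s / 4) := by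
      rw [div_le_iff₀ hq0, mul_comm]; exact htail'
    have e3 : 8 * Real.exp (-s / 4) ≤ Real.exp (-(s / 6)) :=
      hexp6 3 (by norm_num) (by push_cast; linarith)
    linarith
  have h1q : 1 / (q : ℝ) ≤ δ / 8 := by
    have e3 : 8 * Real.exp (-(s ^ 2)) ≤ Real.exp (-(s / 6)) :=
      hexp6 3 (by norm_num) (by push_cast; linarith)
    have e4 : 1 / (q : ℝ) = Real.exp (-(s ^ 2)) := by rw [hqs, Real.exp_neg, one_div]
    linarith
  have hcard : δ / 2 ≤ (((Finset.range q).filter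
      (fun k : ℕ => Real.exp Real.eulerMascheroniConstant / 2 * x ≤ Cfun q k)).card : ℝ) / q := by
    rw [← le_div_iff₀ hq0, add_div, add_div, add_div] at hcnt
    linarith
  refine le_trans ?_ hcard
  have e1 : 2 * Real.exp (-((1 + 4 * c) * E * Real.log x)) ≤ Real.exp (-(2 * y + x)) := by
    refine hexp6 1 (by norm_num) ?_
    have : (1 + 4 * c) * E * 1 ≤ (1 + 4 * c) * E * Real.log x :=
      mul_le_mul_of_nonneg_left hlogx (by positivity)
    push_cast
    linarith
  linarith

lemma card_Cfun_ge_le_half {q : ℕ} [Fact q.Prime] (hq : q ≠ 2) {a : ℝ} (ha : 0 < a) :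
    (((Finset.range q).filter (fun k : ℕ => a ≤ Cfun q k)).card : ℝ) / q ≤ 1 / 2 := by
  have hq0 : (0 : ℝ) < q := by exact_mod_cast (Fact.out : q.Prime).pos
  rw [card_Cfun_ge q hq]
  set S := Finset.univ.filter fun κ : ZMod q => a ≤ Cfun q ((2 * κ).val : ℤ) with hS
  have hneg : ∀ κ ∈ S, -κ ∉ S := by
    intro κ h1 h2
    rw [hS, Finset.mem_filter] at h1 h2
    have e : Cfun q ((2 * -κ).val : ℤ) = -Cfun q ((2 * κ).val : ℤ) := by
      rw [← Cfun_neg]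
      exact Cfun_congr (by simp)
    have := h2.2
    rw [e] at this
    linarith [h1.2]
  have hdis : Disjoint S (S.map (Equiv.neg (ZMod q)).toEmbedding) := by
    rw [Finset.disjoint_left]
    intro κ h1 h2
    obtain ⟨μ, h3, rfl⟩ := Finset.mem_map.1 h2
    exact hneg μ h3 h1
  have hcard := Finset.card_le_univ (S ∪ S.map (Equiv.neg (ZMod q)).toEmbedding)
  rw [Finset.card_union_of_disjoint hdis, Finset.card_map, ZMod.card] at hcard
  have : (S.card : ℝ) + S.card ≤ q := by exact_mod_cast hcard
  rw [div_le_iff₀ hq0]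
  linarith

/-- The range of residues, coerced elementwise to the integers through the monad structure. -/
lemma card_filter_bind_pure (s : Finset ℕ) (P : ℤ → Prop) :
    (Finset.filter P (s >>= fun a : ℕ => pure (a : ℤ))).card =
      (s.filter fun k : ℕ => P k).card := by
  have h : Finset.filter P (s >>= fun a : ℕ => pure (a : ℤ)) =
      (s.filter fun k : ℕ => P k).image (Nat.cast : ℕ → ℤ) := by
    ext n
    simp only [Finset.bind_def, Finset.pure_def, Finset.mem_filter, Finset.mem_sup,
      Finset.mem_singleton, Finset.mem_image]
    constructor
    · rintro ⟨⟨a, ha, rfl⟩, hP⟩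
      exact ⟨a, ⟨ha, hP⟩, rfl⟩
    · rintro ⟨a, ⟨ha, hP⟩, rfl⟩
      exact ⟨⟨a, ha, rfl⟩, hP⟩
  rw [h, Finset.card_image_of_injective _ Nat.cast_injective]

end DirL

/-- Tail bounds for the distribution of `C(k)` (Theorem 1, part 2). -/
theorem distribution_tail_bounds_C :
    ∀ ε : ℝ, 0 < ε → ε < 1/2 →
    ∃ A₁ A₂ : ℝ, 0 < A₁ ∧ 0 < A₂ ∧ ∃ q₀ : ℕ,
    ∀ q : ℕ, q.Prime → Odd q → q₀ ≤ q →
    ∀ x : ℝ, Real.exp 1 ≤ x → x ≤ (1/2 - ε) * Real.log (Real.log q) →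
      Real.exp (-(A₁ * Real.exp x / x)) ≥
        (((Finset.range q).filter
            (fun k => Real.exp Real.eulerMascheroniConstant / 2 * x ≤ Cfun q k)).card : ℝ) /
          q ∧
      (((Finset.range q).filter
            (fun k => Real.exp Real.eulerMascheroniConstant / 2 * x ≤ Cfun q k)).card : ℝ) /
          q ≥
        Real.exp (-(A₂ * Real.exp x * Real.log x)) := by
  intro ε hε _
  obtain ⟨A, X, hA, hX, hup⟩ := DirL.exists_upper_large hε
  obtain ⟨A₂, hA₂, hlow⟩ := DirL.exists_lower hε
  obtain ⟨q₀, hq₀⟩ := Filter.eventually_atTop.1 (hup.and hlow)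
  refine ⟨min A (1 / (2 * Real.exp X)), A₂, lt_min hA (by positivity), hA₂, q₀, ?_⟩
  intro q hq hodd hqq x hx1 hx2
  have : Fact q.Prime := ⟨hq⟩
  obtain ⟨h1, h2⟩ := hq₀ q hqq
  have hq2 : q ≠ 2 := by
    rintro rfl
    exact absurd hodd (by decide)
  have hx0 : 1 < x := by linarith [Real.exp_one_gt_d9]
  rw [DirL.card_filter_bind_pure]
  refine ⟨?_, h2 ⟨hq⟩ x hx1 hx2⟩
  rcases le_or_gt X x with h | h
  · refine (h1 ⟨hq⟩ x h hx2).trans (Real.exp_le_exp.2 (neg_le_neg ?_))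
    gcongr
    exact min_le_left _ _
  · refine (DirL.card_Cfun_ge_le_half hq2 (by positivity)).trans ?_
    have e1 : min A (1 / (2 * Real.exp X)) * Real.exp x / x ≤ 1 / 2 := by
      calc min A (1 / (2 * Real.exp X)) * Real.exp x / x
          ≤ min A (1 / (2 * Real.exp X)) * Real.exp x :=
            div_le_self (mul_nonneg (le_min hA.le (by positivity)) (Real.exp_pos _).le) hx0.le
        _ ≤ 1 / (2 * Real.exp X) * Real.exp X := by
            gcongr
            exact min_le_right _ _
        _ = 1 / 2 := by field_simp
    have e2 := Real.add_one_le_exp (-(min A (1 / (2 * Real.exp X)) * Real.exp x / x))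
    linarith
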